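/- Under the stated hypotheses (Hessian determinant bounds and ∇f a diffeomorphism onto its image), for all Q ≥ 2 and all δ ∈ (0,1/2): N_S^w(Q,δ) = (2ŵ(0)/n) δ Q^n + O(E_n(Q)), where ŵ(0) = ∫_{ℝ^{n-1}} w(x) dx, E_3(Q) = Q² exp(c√(log Q)) and E_n(Q) = Q^{n-1}(log Q)^κ for n ≥ 4, with constants c, κ and the implied constant depending only on f and w. -/

import Mathlib

open MeasureTheory

/-- Distance from a real number to the nearest integer. -/
noncomputable def nint (θ : ℝ) : ℝ := |θ - round θ|

/-- Gradient of `f` at `x`. -/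
noncomputable def gradv {m : ℕ} (f : (Fin m → ℝ) → ℝ) (x : Fin m → ℝ) : Fin m → ℝ :=
  fun i => fderiv ℝ f x (Pi.single i 1)

/-- Hessian matrix of `f` at `x`. -/
noncomputable def hess {m : ℕ} (f : (Fin m → ℝ) → ℝ) (x : Fin m → ℝ) :
    Matrix (Fin m) (Fin m) ℝ :=
  Matrix.of fun i j => fderiv ℝ (fun y => fderiv ℝ f y (Pi.single j 1)) x (Pi.single i 1)

/-- The weighted counting function
`N_S^w(Q,δ) = ∑_{a ∈ ℤ^{m}, q ∈ ℤ, 1 ≤ q ≤ Q, ‖q f(a/q)‖ < δ} w(a/q)`. -/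
noncomputable def NSw {m : ℕ} (f w : (Fin m → ℝ) → ℝ) (Q δ : ℝ) : ℝ :=
  ∑ᶠ (q : ℤ) (a : Fin m → ℤ),
    if 1 ≤ q ∧ (q : ℝ) ≤ Q ∧ nint ((q : ℝ) * f (fun i => (a i : ℝ) / (q : ℝ))) < δ
      then w (fun i => (a i : ℝ) / (q : ℝ)) else 0

/-- Partial derivative in the `i`-th coordinate direction. -/
noncomputable def pderivAt {m : ℕ} (i : Fin m) (a : (Fin m → ℝ) → ℂ) : (Fin m → ℝ) → ℂ :=
  fun x => fderiv ℝ a x (Pi.single i 1)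

/-- Symbol-type bounds of order `s`: each partial derivative up to order `r` costs one power of the
gauge `ρ`, uniformly in the parameter `p`, on the set `Ω`. -/
def SymbolBound {P : Type*} {m : ℕ} (Ω : Set (Fin m → ℝ)) (ρ : P → (Fin m → ℝ) → ℝ) :
    ℕ → ℤ → (P → (Fin m → ℝ) → ℂ) → Prop
  | 0, s, a => ∃ C : ℝ, 0 ≤ C ∧ ∀ p, ∀ x ∈ Ω, ‖a p x‖ ≤ C * ρ p x ^ s
  | r + 1, s, a => (∃ C : ℝ, 0 ≤ C ∧ ∀ p, ∀ x ∈ Ω, ‖a p x‖ ≤ C * ρ p x ^ s) ∧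
      ∀ i, SymbolBound Ω ρ r (s - 1) (fun p => pderivAt i (a p))

/-- Families of `C^r` functions with symbol-type bounds. -/
def IsSymbol {P : Type*} {m : ℕ} (Ω : Set (Fin m → ℝ)) (ρ : P → (Fin m → ℝ) → ℝ)
    (r : ℕ) (s : ℤ) (a : P → (Fin m → ℝ) → ℂ) : Prop :=
  (∀ p, ContDiff ℝ r (a p)) ∧ SymbolBound Ω ρ r s a

section Symbols

variable {P : Type*} {m : ℕ} {Ω : Set (Fin m → ℝ)} {ρ : P → (Fin m → ℝ) → ℝ}

theorem contDiff_pderivAt {r : ℕ} {a : (Fin m → ℝ) → ℂ} (h : ContDiff ℝ (r + 1 : ℕ) a)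
    (i : Fin m) : ContDiff ℝ r (pderivAt i a) := by
  have h1 : ContDiff ℝ r (fderiv ℝ a) := h.fderiv_right (by norm_cast)
  exact h1.clm_apply contDiff_const

theorem pderivAt_eq_zero {K : Set (Fin m → ℝ)} (hK : IsClosed K) {a : (Fin m → ℝ) → ℂ}
    (h : ∀ x ∉ K, a x = 0) (i : Fin m) : ∀ x ∉ K, pderivAt i a x = 0 := by
  intro x hx
  have h1 : a =ᶠ[nhds x] fun _ => 0 := by
    filter_upwards [hK.isOpen_compl.mem_nhds hx] with y hy using h y hy
  simp [pderivAt, h1.fderiv_eq]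

theorem SymbolBound.base {r : ℕ} {s : ℤ} {a : P → (Fin m → ℝ) → ℂ}
    (h : SymbolBound Ω ρ r s a) : ∃ C : ℝ, 0 ≤ C ∧ ∀ p, ∀ x ∈ Ω, ‖a p x‖ ≤ C * ρ p x ^ s := by
  cases r with
  | zero => exact h
  | succ r => exact h.1

theorem SymbolBound.of_succ {r : ℕ} {s : ℤ} {a : P → (Fin m → ℝ) → ℂ}
    (h : SymbolBound Ω ρ (r + 1) s a) : SymbolBound Ω ρ r s a := by
  induction r generalizing s a with
  | zero => exact h.1
  | succ r ih => exact ⟨h.1, fun i => ih (h.2 i)⟩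

theorem IsSymbol.of_succ {r : ℕ} {s : ℤ} {a : P → (Fin m → ℝ) → ℂ}
    (h : IsSymbol Ω ρ (r + 1) s a) : IsSymbol Ω ρ r s a :=
  ⟨fun p => (h.1 p).of_le (by norm_cast; omega), h.2.of_succ⟩

theorem IsSymbol.partial {r : ℕ} {s : ℤ} {a : P → (Fin m → ℝ) → ℂ}
    (h : IsSymbol Ω ρ (r + 1) s a) (i : Fin m) :
    IsSymbol Ω ρ r (s - 1) (fun p => pderivAt i (a p)) :=
  ⟨fun p => contDiff_pderivAt (h.1 p) i, h.2.2 i⟩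

theorem IsSymbol.succ_intro {r : ℕ} {s : ℤ} {a : P → (Fin m → ℝ) → ℂ}
    (h0 : ∀ p, ContDiff ℝ (r + 1 : ℕ) (a p))
    (h1 : ∃ C : ℝ, 0 ≤ C ∧ ∀ p, ∀ x ∈ Ω, ‖a p x‖ ≤ C * ρ p x ^ s)
    (h2 : ∀ i, IsSymbol Ω ρ r (s - 1) (fun p => pderivAt i (a p))) :
    IsSymbol Ω ρ (r + 1) s a :=
  ⟨h0, h1, fun i => (h2 i).2⟩

theorem IsSymbol.mk_zero {s : ℤ} {a : P → (Fin m → ℝ) → ℂ}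
    (h0 : ∀ p, Continuous (a p))
    (h1 : ∃ C : ℝ, 0 ≤ C ∧ ∀ p, ∀ x ∈ Ω, ‖a p x‖ ≤ C * ρ p x ^ s) :
    IsSymbol Ω ρ 0 s a :=
  ⟨fun p => contDiff_zero.2 (h0 p), h1⟩

theorem IsSymbol.add {r : ℕ} {s : ℤ} {a b : P → (Fin m → ℝ) → ℂ}
    (ha : IsSymbol Ω ρ r s a) (hb : IsSymbol Ω ρ r s b) :
    IsSymbol Ω ρ r s (fun p x => a p x + b p x) := by
  have key : ∃ C : ℝ, 0 ≤ C ∧ ∀ p, ∀ x ∈ Ω, ‖a p x + b p x‖ ≤ C * ρ p x ^ s := by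
    obtain ⟨C, hC, h⟩ := ha.2.base
    obtain ⟨C', hC', h'⟩ := hb.2.base
    refine ⟨C + C', by positivity, fun p x hx => ?_⟩
    rw [add_mul]
    exact (norm_add_le _ _).trans (add_le_add (h p x hx) (h' p x hx))
  induction r generalizing s a b with
  | zero => exact ⟨fun p => (ha.1 p).add (hb.1 p), key⟩
  | succ r ih =>
    refine IsSymbol.succ_intro (fun p => (ha.1 p).add (hb.1 p)) key fun i => ?_
    have h2 := ih (ha.partial i) (hb.partial i) (by
      obtain ⟨C, hC, h⟩ := (ha.partial i).2.base
      obtain ⟨C', hC', h'⟩ := (hb.partial i).2.base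
      refine ⟨C + C', by positivity, fun p x hx => ?_⟩
      rw [add_mul]
      exact (norm_add_le _ _).trans (add_le_add (h p x hx) (h' p x hx)))
    convert h2 using 3 with p x
    have d1 : DifferentiableAt ℝ (a p) x := ((ha.1 p).differentiable (by norm_cast)) x
    have d2 : DifferentiableAt ℝ (b p) x := ((hb.1 p).differentiable (by norm_cast)) x
    simp only [pderivAt]
    rw [fderiv_fun_add d1 d2]
    rfl

theorem IsSymbol.mul (hρ : ∀ p x, 0 < ρ p x) {r : ℕ} {s t : ℤ} {a b : P → (Fin m → ℝ) → ℂ}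
    (ha : IsSymbol Ω ρ r s a) (hb : IsSymbol Ω ρ r t b) :
    IsSymbol Ω ρ r (s + t) (fun p x => a p x * b p x) := by
  have key : ∃ C : ℝ, 0 ≤ C ∧ ∀ p, ∀ x ∈ Ω, ‖a p x * b p x‖ ≤ C * ρ p x ^ (s + t) := by
    obtain ⟨C, hC, h⟩ := ha.2.base
    obtain ⟨C', hC', h'⟩ := hb.2.base
    refine ⟨C * C', by positivity, fun p x hx => ?_⟩
    rw [norm_mul, zpow_add₀ (hρ p x).ne']
    calc ‖a p x‖ * ‖b p x‖ ≤ (C * ρ p x ^ s) * (C' * ρ p x ^ t) :=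
          mul_le_mul (h p x hx) (h' p x hx) (norm_nonneg _)
            (mul_nonneg hC (zpow_nonneg (hρ p x).le _))
      _ = _ := by ring
  induction r generalizing s t a b with
  | zero => exact ⟨fun p => (ha.1 p).mul (hb.1 p), key⟩
  | succ r ih =>
    have kk : ∀ {s t : ℤ} {a b : P → (Fin m → ℝ) → ℂ}, IsSymbol Ω ρ r s a → IsSymbol Ω ρ r t b →
        IsSymbol Ω ρ r (s + t) (fun p x => a p x * b p x) := fun {s t a b} ha hb => by
      refine ih ha hb ?_
      obtain ⟨C, hC, h⟩ := ha.2.base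
      obtain ⟨C', hC', h'⟩ := hb.2.base
      refine ⟨C * C', by positivity, fun p x hx => ?_⟩
      rw [norm_mul, zpow_add₀ (hρ p x).ne']
      calc ‖a p x‖ * ‖b p x‖ ≤ (C * ρ p x ^ s) * (C' * ρ p x ^ t) :=
            mul_le_mul (h p x hx) (h' p x hx) (norm_nonneg _)
              (mul_nonneg hC (zpow_nonneg (hρ p x).le _))
        _ = _ := by ring
    refine IsSymbol.succ_intro (fun p => (ha.1 p).mul (hb.1 p)) key fun i => ?_
    have h1 := kk (ha.partial i) hb.of_succ
    have h2 := kk ha.of_succ (hb.partial i)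
    have h3 : IsSymbol Ω ρ r (s + t - 1) _ :=
      IsSymbol.add (by convert h1 using 1; ring) (by convert h2 using 1; ring)
    convert h3 using 3 with p x
    have d1 : DifferentiableAt ℝ (a p) x := ((ha.1 p).differentiable (by norm_cast)) x
    have d2 : DifferentiableAt ℝ (b p) x := ((hb.1 p).differentiable (by norm_cast)) x
    simp only [pderivAt]
    rw [fderiv_fun_mul d1 d2]
    simp
    ring

/-- The zero function is a symbol of every order. -/
theorem IsSymbol.zero (r : ℕ) (s : ℤ) :
    IsSymbol Ω ρ r s (fun _ _ => (0 : ℂ)) := by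
  induction r generalizing s with
  | zero => exact IsSymbol.mk_zero (fun p => continuous_const) ⟨0, le_rfl, by simp⟩
  | succ r ih =>
    refine IsSymbol.succ_intro (fun p => contDiff_const) ⟨0, le_rfl, by simp⟩ fun i => ?_
    convert ih (s - 1) using 3 with p x
    simp [pderivAt]

theorem IsSymbol.const {r : ℕ} {s : ℤ} {c : P → ℂ}
    (h : ∃ C : ℝ, 0 ≤ C ∧ ∀ p, ∀ x ∈ Ω, ‖c p‖ ≤ C * ρ p x ^ s) :
    IsSymbol Ω ρ r s (fun p _ => c p) := by
  cases r with
  | zero => exact IsSymbol.mk_zero (fun p => continuous_const) h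
  | succ r =>
    refine IsSymbol.succ_intro (fun p => contDiff_const) h fun i => ?_
    convert IsSymbol.zero r (s - 1) using 3 with p x
    simp [pderivAt]

theorem IsSymbol.sum {r : ℕ} {s : ℤ} {κ : Type*} (S : Finset κ) {a : κ → P → (Fin m → ℝ) → ℂ}
    (ha : ∀ i ∈ S, IsSymbol Ω ρ r s (a i)) :
    IsSymbol Ω ρ r s (fun p x => ∑ i ∈ S, a i p x) := by
  classical
  induction S using Finset.induction_on with
  | empty => simpa using IsSymbol.zero r s
  | insert i S hi ih =>
    have h1 := ha i (Finset.mem_insert_self _ _)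
    have h2 := ih fun j hj => ha j (Finset.mem_insert_of_mem hj)
    convert h1.add h2 using 3 with p x
    rw [Finset.sum_insert hi]

/-- A nonvanishing symbol of order `2` bounded below by `c ρ²` has an inverse of order `-2`. -/
theorem IsSymbol.inv (hρ : ∀ p x, 0 < ρ p x) {r : ℕ} {b : P → (Fin m → ℝ) → ℂ}
    (hb : IsSymbol Ω ρ r 2 b) (hb0 : ∀ p x, b p x ≠ 0) {c : ℝ} (hc : 0 < c)
    (hbc : ∀ p, ∀ x ∈ Ω, c * ρ p x ^ 2 ≤ ‖b p x‖) :
    IsSymbol Ω ρ r (-2) (fun p x => (b p x)⁻¹) := by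
  have key : ∃ C : ℝ, 0 ≤ C ∧ ∀ p, ∀ x ∈ Ω, ‖(b p x)⁻¹‖ ≤ C * ρ p x ^ (-2 : ℤ) := by
    refine ⟨c⁻¹, by positivity, fun p x hx => ?_⟩
    have := hρ p x
    rw [norm_inv, zpow_neg, ← mul_inv]
    exact inv_anti₀ (by positivity) (by exact_mod_cast hbc p x hx)
  induction r with
  | zero => exact ⟨fun p => (hb.1 p).inv (hb0 p), key⟩
  | succ r ih =>
    refine IsSymbol.succ_intro (fun p => (hb.1 p).inv (hb0 p)) key fun i => ?_
    have hu := ih hb.of_succ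
    have h1 := (((hu.mul hρ hu).mul hρ (hb.partial i))).mul hρ
      (IsSymbol.const (s := 0) (c := fun _ => (-1 : ℂ)) ⟨1, by norm_num, by simp⟩)
    have h2 : (fun p => pderivAt i fun x => (b p x)⁻¹) =
        fun p x => (b p x)⁻¹ * (b p x)⁻¹ * pderivAt i (b p) x * (-1) := by
      funext p x
      have d1 : DifferentiableAt ℝ (b p) x := ((hb.1 p).differentiable (by norm_cast)) x
      have h3 := ((hasFDerivAt_inv' (𝕜 := ℝ) (hb0 p x)).comp x d1.hasFDerivAt).fderiv
      have h4 : (Inv.inv ∘ b p) = fun x => (b p x)⁻¹ := rfl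
      rw [h4] at h3
      simp only [pderivAt]
      rw [h3]
      simp
      ring
    rw [h2]
    exact h1

end Symbols

/-- Partial derivative of a real function, as a complex-valued function. -/
noncomputable def gradC {m : ℕ} (g : (Fin m → ℝ) → ℝ) (i : Fin m) : (Fin m → ℝ) → ℂ :=
  fun x => ((fderiv ℝ g x (Pi.single i 1) : ℝ) : ℂ)

/-- The oscillating exponential `e^{iλg}`. -/
noncomputable def oscExp {m : ℕ} (lam : ℝ) (g : (Fin m → ℝ) → ℝ) : (Fin m → ℝ) → ℂ :=
  fun x => Complex.exp (((lam * g x : ℝ) : ℂ) * Complex.I)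

section Oscillatory

variable {m : ℕ}

theorem norm_oscExp (lam : ℝ) (g : (Fin m → ℝ) → ℝ) (x : Fin m → ℝ) : ‖oscExp lam g x‖ = 1 :=
  Complex.norm_exp_ofReal_mul_I _

theorem contDiff_oscExp {r : ℕ} (lam : ℝ) {g : (Fin m → ℝ) → ℝ} (hg : ContDiff ℝ r g) :
    ContDiff ℝ r (oscExp lam g) := by
  unfold oscExp
  have h1 : ContDiff ℝ r fun x => ((lam * g x : ℝ) : ℂ) :=
    Complex.ofRealCLM.contDiff.comp (contDiff_const.mul hg)
  exact (h1.mul contDiff_const).cexp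

theorem pderivAt_oscExp (lam : ℝ) {g : (Fin m → ℝ) → ℝ} (hg : Differentiable ℝ g)
    (i : Fin m) (x : Fin m → ℝ) :
    pderivAt i (oscExp lam g) x = Complex.I * lam * gradC g i x * oscExp lam g x := by
  have h1 : HasFDerivAt (fun x => ((lam * g x : ℝ) : ℂ))
      (Complex.ofRealCLM.comp (lam • fderiv ℝ g x)) x :=
    Complex.ofRealCLM.hasFDerivAt.comp x ((hg x).hasFDerivAt.const_mul lam)
  have h2 := (h1.mul_const Complex.I).cexp
  unfold pderivAt oscExp gradC
  rw [h2.fderiv]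
  simp
  ring

theorem integrable_of_zero_off {Ω : Set (Fin m → ℝ)} (hΩ : IsCompact Ω) {a : (Fin m → ℝ) → ℂ}
    (ha : Continuous a) (h0 : ∀ x ∉ Ω, a x = 0) : Integrable a := by
  apply ha.integrable_of_hasCompactSupport
  exact HasCompactSupport.intro hΩ h0

/-- One integration by parts against `e^{iλg}`. -/
theorem integral_oscExp_eq {Ω : Set (Fin m → ℝ)} (hΩ : IsCompact Ω) {lam : ℝ} (hlam : 0 < lam)
    {g : (Fin m → ℝ) → ℝ} (hg : ContDiff ℝ 2 g) {a : (Fin m → ℝ) → ℂ} (ha : ContDiff ℝ 1 a)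
    (ha0 : ∀ x ∉ Ω, a x = 0) (b : (Fin m → ℝ) → ℂ)
    (hb : b = fun x => ((lam⁻¹ : ℝ) : ℂ) + ∑ i, gradC g i x * gradC g i x) :
    ∫ x, a x * oscExp lam g x = ((lam⁻¹ : ℝ) : ℂ) * ∫ x, (a x * (b x)⁻¹ +
      ∑ i, pderivAt i (fun x => a x * (b x)⁻¹ * gradC g i x) x * Complex.I) * oscExp lam g x := by
  have hG : ∀ i, ContDiff ℝ 1 (gradC g i) := fun i => by
    have h1 : ContDiff ℝ 1 (fderiv ℝ g) := hg.fderiv_right (by norm_num)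
    exact Complex.ofRealCLM.contDiff.comp (h1.clm_apply contDiff_const)
  have hbr : ∀ x, b x = ((lam⁻¹ + ∑ i, (fderiv ℝ g x (Pi.single i 1)) ^ 2 : ℝ) : ℂ) := fun x => by
    rw [hb]; simp [gradC, pow_two]
  have hb0 : ∀ x, b x ≠ 0 := fun x => by
    rw [hbr]
    have : 0 < lam⁻¹ + ∑ i, (fderiv ℝ g x (Pi.single i 1)) ^ 2 := by positivity
    exact_mod_cast this.ne'
  have hbc : ContDiff ℝ 1 b := by
    rw [hb]
    exact contDiff_const.add (ContDiff.sum fun i _ => (hG i).mul (hG i))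
  have he : ContDiff ℝ 1 (oscExp lam g) := contDiff_oscExp (r := 1) lam (hg.of_le (by norm_num))
  have hu : ContDiff ℝ 1 fun x => a x * (b x)⁻¹ := ha.mul (hbc.inv hb0)
  set h : Fin m → (Fin m → ℝ) → ℂ := fun i x => a x * (b x)⁻¹ * gradC g i x with hh
  have hhc : ∀ i, ContDiff ℝ 1 (h i) := fun i => hu.mul (hG i)
  have hh0 : ∀ i, ∀ x ∉ Ω, h i x = 0 := fun i x hx => by simp [hh, ha0 x hx]
  have hdc : ∀ i, Continuous (pderivAt i (h i)) := fun i =>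
    (contDiff_pderivAt (r := 0) (by simpa using hhc i) i).continuous
  have hdec : ∀ i, Continuous (pderivAt i (oscExp lam g)) := fun i =>
    (contDiff_pderivAt (r := 0) (by simpa using he) i).continuous
  have hd0 : ∀ i, ∀ x ∉ Ω, pderivAt i (h i) x = 0 := fun i =>
    pderivAt_eq_zero hΩ.isClosed (hh0 i) i
  have i1 : ∀ i, Integrable fun x => pderivAt i (h i) x * oscExp lam g x := fun i =>
    integrable_of_zero_off hΩ ((hdc i).mul he.continuous) fun x hx => by simp [hd0 i x hx]
  have i2 : ∀ i, Integrable fun x => h i x * pderivAt i (oscExp lam g) x := fun i =>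
    integrable_of_zero_off hΩ ((hhc i).continuous.mul (hdec i)) fun x hx => by simp [hh0 i x hx]
  have i3 : ∀ i, Integrable fun x => h i x * oscExp lam g x := fun i =>
    integrable_of_zero_off hΩ ((hhc i).continuous.mul he.continuous)
      fun x hx => by simp [hh0 i x hx]
  have ibp : ∀ i, ∫ x, h i x * pderivAt i (oscExp lam g) x
      = - ∫ x, pderivAt i (h i) x * oscExp lam g x := fun i =>
    integral_mul_fderiv_eq_neg_fderiv_mul_of_integrable (i1 i) (i2 i) (i3 i)
      (fun x _ => (hhc i).differentiable (by norm_num) x)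
      (fun x _ => he.differentiable (by norm_num) x)
  have i4 : Integrable fun x => a x * (b x)⁻¹ * oscExp lam g x :=
    integrable_of_zero_off hΩ (hu.continuous.mul he.continuous) fun x hx => by simp [ha0 x hx]
  have i5 : Integrable fun x => a x * oscExp lam g x :=
    integrable_of_zero_off hΩ (ha.continuous.mul he.continuous) fun x hx => by simp [ha0 x hx]
  have hl : ((lam : ℝ) : ℂ) ≠ 0 := by exact_mod_cast hlam.ne'
  have e1 : ∑ i, ∫ x, h i x * pderivAt i (oscExp lam g) x =
      Complex.I * lam * (∫ x, a x * oscExp lam g x) -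
        Complex.I * ∫ x, a x * (b x)⁻¹ * oscExp lam g x := by
    rw [← integral_finsetSum _ fun i _ => i2 i, ← integral_const_mul, ← integral_const_mul,
      ← integral_sub (i5.const_mul _) (i4.const_mul _)]
    congr 1
    funext x
    have hd := pderivAt_oscExp lam (hg.differentiable (by norm_num))
    simp only [hd, hh]
    have hs : ∑ i, gradC g i x * gradC g i x = b x - ((lam⁻¹ : ℝ) : ℂ) := by rw [hb]; ring
    have : ∑ i, a x * (b x)⁻¹ * gradC g i x * (Complex.I * lam * gradC g i x * oscExp lam g x)
        = a x * (b x)⁻¹ * Complex.I * lam * oscExp lam g x * ∑ i, gradC g i x * gradC g i x := by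
      rw [Finset.mul_sum]
      exact Finset.sum_congr rfl fun i _ => by ring
    rw [this, hs]
    have := hb0 x
    push_cast
    field_simp
  have e2 : ∫ x, (a x * (b x)⁻¹ + ∑ i, pderivAt i (h i) x * Complex.I) * oscExp lam g x =
      (∫ x, a x * (b x)⁻¹ * oscExp lam g x) +
        Complex.I * ∑ i, ∫ x, pderivAt i (h i) x * oscExp lam g x := by
    rw [← integral_finsetSum _ fun i _ => i1 i, ← integral_const_mul,
      ← integral_add i4 ((integrable_finsetSum _ fun i _ => i1 i).const_mul _)]
    congr 1
    funext x
    rw [add_mul, Finset.sum_mul, Finset.mul_sum]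
    congr 1
    exact Finset.sum_congr rfl fun i _ => by ring
  rw [e2]
  have e3 : ∑ i, ∫ x, pderivAt i (h i) x * oscExp lam g x =
      -∑ i, ∫ x, h i x * pderivAt i (oscExp lam g) x := by
    rw [← Finset.sum_neg_distrib]
    exact Finset.sum_congr rfl fun i _ => by rw [ibp i, neg_neg]
  rw [e3, e1]
  generalize (∫ x, a x * oscExp lam g x) = X
  generalize (∫ x, a x * (b x)⁻¹ * oscExp lam g x) = Y
  push_cast
  field_simp
  linear_combination (lam * X - Y) * Complex.I_sq

/-- Repeated integration by parts gains a factor `λ⁻¹ ρ⁻²` each time. -/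
theorem exists_norm_integral_oscExp_le {P : Type*} {Ω : Set (Fin m → ℝ)} (hΩ : IsCompact Ω)
    {ρ : P → (Fin m → ℝ) → ℝ} (hρ : ∀ p x, 0 < ρ p x) (hρc : ∀ p, Continuous (ρ p))
    {lam : P → ℝ} (hlam : ∀ p, 0 < lam p) {g : P → (Fin m → ℝ) → ℝ}
    (hg : ∀ p, ContDiff ℝ 2 (g p)) (hlρ : ∀ p, ∀ x ∈ Ω, (lam p)⁻¹ ≤ ρ p x ^ 2)
    {c : ℝ} (hc : 0 < c) (hlow : ∀ p, ∀ x ∈ Ω, c * ρ p x ^ 2 ≤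
      (lam p)⁻¹ + ∑ i, (fderiv ℝ (g p) x (Pi.single i 1)) ^ 2)
    (k : ℕ) (hG : ∀ i, IsSymbol Ω ρ k 1 (fun p => gradC (g p) i))
    {s : ℤ} {a : P → (Fin m → ℝ) → ℂ} (ha : IsSymbol Ω ρ k s a) (ha0 : ∀ p, ∀ x ∉ Ω, a p x = 0) :
    ∃ C : ℝ, 0 ≤ C ∧ ∀ p, ‖∫ x, a p x * oscExp (lam p) (g p) x‖ ≤
      C * (lam p)⁻¹ ^ k * ∫ x in Ω, ρ p x ^ (s - 2 * k) := by
  induction k generalizing s a with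
  | zero =>
    obtain ⟨C, hC, h⟩ := ha.2.base
    refine ⟨C, hC, fun p => ?_⟩
    have h1 : ∫ x, a p x * oscExp (lam p) (g p) x = ∫ x in Ω, a p x * oscExp (lam p) (g p) x := by
      rw [setIntegral_eq_integral_of_forall_compl_eq_zero]
      intro x hx
      simp [ha0 p x hx]
    rw [h1]
    have hi : IntegrableOn (fun x => C * ρ p x ^ (s - 2 * (0 : ℕ))) Ω := by
      apply ContinuousOn.integrableOn_compact hΩ
      apply Continuous.continuousOn
      exact continuous_const.mul ((hρc p).zpow₀ _ fun x => Or.inl (hρ p x).ne')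
    have h2 := norm_integral_le_of_norm_le (μ := volume.restrict Ω) hi
      (f := fun x => a p x * oscExp (lam p) (g p) x) (by
        refine (ae_restrict_iff' hΩ.measurableSet).2 (Filter.Eventually.of_forall fun x hx => ?_)
        rw [norm_mul, norm_oscExp, mul_one]
        simpa using h p x hx)
    rw [integral_const_mul] at h2
    simpa using h2
  | succ k ih =>
    have hb : IsSymbol Ω ρ (k + 1) 2 (fun p x => (((lam p)⁻¹ : ℝ) : ℂ) +
        ∑ i, gradC (g p) i x * gradC (g p) i x) := by
      refine IsSymbol.add (IsSymbol.const ⟨1, zero_le_one, fun p x hx => ?_⟩)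
        (IsSymbol.sum _ fun i _ => ?_)
      · rw [Complex.norm_real, Real.norm_of_nonneg (inv_nonneg.2 (hlam p).le), one_mul]
        exact_mod_cast hlρ p x hx
      · exact (hG i).mul hρ (hG i)
    set b : P → (Fin m → ℝ) → ℂ := fun p x => (((lam p)⁻¹ : ℝ) : ℂ) +
        ∑ i, gradC (g p) i x * gradC (g p) i x with hbdef
    have hbr : ∀ p x, b p x =
        (((lam p)⁻¹ + ∑ i, (fderiv ℝ (g p) x (Pi.single i 1)) ^ 2 : ℝ) : ℂ) := fun p x => by
      simp [hbdef, gradC, pow_two]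
    have hpos : ∀ p x, 0 < (lam p)⁻¹ + ∑ i, (fderiv ℝ (g p) x (Pi.single i 1)) ^ 2 :=
      fun p x => by have := hlam p; positivity
    have hinv : IsSymbol Ω ρ (k + 1) (-2) (fun p x => (b p x)⁻¹) := by
      refine hb.inv hρ (fun p x => ?_) hc fun p x hx => ?_
      · rw [hbr]; exact_mod_cast (hpos p x).ne'
      · rw [hbr, Complex.norm_real, Real.norm_of_nonneg (hpos p x).le]
        exact hlow p x hx
    have hu := ha.mul hρ hinv
    have hM : IsSymbol Ω ρ k (s - 2) (fun p x => a p x * (b p x)⁻¹ +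
        ∑ i, pderivAt i (fun x => a p x * (b p x)⁻¹ * gradC (g p) i x) x * Complex.I) := by
      refine IsSymbol.add (by convert hu.of_succ using 1; ring) (IsSymbol.sum _ fun i _ => ?_)
      have h1 := ((hu.mul hρ (hG i)).partial i).mul hρ
        (IsSymbol.const (s := 0) (c := fun _ => Complex.I) ⟨1, zero_le_one, by simp⟩)
      convert h1 using 1
      ring
    obtain ⟨C, hC, h⟩ := ih (fun i => (hG i).of_succ) hM (by
      intro p x hx
      have h1 : ∀ i, pderivAt i (fun x => a p x * (b p x)⁻¹ * gradC (g p) i x) x = 0 := fun i =>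
        pderivAt_eq_zero hΩ.isClosed (fun y hy => by simp [ha0 p y hy]) i x hx
      simp [ha0 p x hx, h1])
    refine ⟨C, hC, fun p => ?_⟩
    rw [integral_oscExp_eq hΩ (hlam p) (hg p) ((ha.1 p).of_le (by norm_cast; omega)) (ha0 p) (b p) rfl,
      norm_mul, Complex.norm_real, Real.norm_of_nonneg (inv_nonneg.2 (hlam p).le)]
    have h3 := mul_le_mul_of_nonneg_left (h p) (inv_nonneg.2 (hlam p).le)
    refine h3.trans (le_of_eq ?_)
    have : s - 2 * ((k + 1 : ℕ) : ℤ) = s - 2 - 2 * k := by push_cast; ring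
    rw [this]
    ring

end Oscillatory

section StationaryPhase

variable {m : ℕ}

theorem IsSymbol.of_contDiff {P : Type*} {Ω : Set (Fin m → ℝ)} (hΩ : IsCompact Ω)
    {ρ : P → (Fin m → ℝ) → ℝ} (hρ : ∀ p x, 0 < ρ p x) {R : ℝ}
    (hR : ∀ p, ∀ x ∈ Ω, ρ p x ≤ R) {r : ℕ} {h : (Fin m → ℝ) → ℂ} (hh : ContDiff ℝ r h)
    {s : ℤ} (hs : s ≤ 0) : IsSymbol Ω ρ r s (fun _ => h) := by
  have key : ∀ {h : (Fin m → ℝ) → ℂ} {s : ℤ}, s ≤ 0 → Continuous h →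
      ∃ C : ℝ, 0 ≤ C ∧ ∀ p, ∀ x ∈ Ω, ‖h x‖ ≤ C * ρ p x ^ s := by
    intro h s hs hc
    obtain ⟨C, hC⟩ := hΩ.exists_bound_of_continuousOn hc.continuousOn
    obtain ⟨n, rfl⟩ : ∃ n : ℕ, s = -(n : ℤ) := ⟨s.natAbs, by omega⟩
    refine ⟨|C| * |R| ^ n, by positivity, fun p x hx => ?_⟩
    have h1 := hρ p x
    have h2 : ρ p x ^ n ≤ |R| ^ n :=
      pow_le_pow_left₀ h1.le ((hR p x hx).trans (le_abs_self R)) n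
    rw [zpow_neg, zpow_natCast, mul_assoc]
    have h3 : 1 ≤ |R| ^ n * (ρ p x ^ n)⁻¹ := by
      rw [← div_eq_mul_inv, one_le_div (by positivity)]; exact h2
    calc ‖h x‖ ≤ |C| := (hC x hx).trans (le_abs_self C)
      _ = |C| * 1 := (mul_one _).symm
      _ ≤ _ := mul_le_mul_of_nonneg_left h3 (abs_nonneg C)
  induction r generalizing h s with
  | zero => exact IsSymbol.mk_zero (fun p => hh.continuous) (key hs hh.continuous)
  | succ r ih =>
    exact IsSymbol.succ_intro (fun p => hh) (key hs hh.continuous) fun i =>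
      ih (contDiff_pderivAt hh i) (by omega)

theorem integral_add_norm_sub_zpow {N : ℕ} (hN : m < N) {ε : ℝ} (hε : 0 < ε) (x₀ : Fin m → ℝ) :
    Integrable (fun x => (ε + ‖x - x₀‖) ^ (-(N : ℤ))) ∧
    ∫ x, (ε + ‖x - x₀‖) ^ (-(N : ℤ)) =
      ε ^ ((m : ℤ) - N) * ∫ z : Fin m → ℝ, (1 + ‖z‖) ^ (-(N : ℤ)) := by
  have h0 : Integrable (fun z : Fin m → ℝ => (1 + ‖z‖) ^ (-(N : ℤ))) := by
    have h1 := integrable_one_add_norm (E := Fin m → ℝ) (μ := volume) (r := (N : ℝ))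
      (by simpa using hN)
    refine h1.congr (Filter.Eventually.of_forall fun z => ?_)
    simp only
    rw [← Real.rpow_intCast]
    simp
  have h2 : ∀ x : Fin m → ℝ, (ε + ‖x - x₀‖) ^ (-(N : ℤ)) =
      ε ^ (-(N : ℤ)) * (fun z : Fin m → ℝ => (1 + ‖z‖) ^ (-(N : ℤ))) (ε⁻¹ • (x - x₀)) := fun x => by
    simp only
    rw [← mul_zpow, norm_smul, norm_inv, Real.norm_of_nonneg hε.le, mul_add, mul_one,
      mul_inv_cancel_left₀ hε.ne']
  simp_rw [h2]
  constructor
  · have h3 := (h0.comp_smul (inv_ne_zero hε.ne')).comp_sub_right x₀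
    exact h3.const_mul _
  · have h4 := Measure.integral_comp_inv_smul_of_nonneg (volume : Measure (Fin m → ℝ))
      (fun z : Fin m → ℝ => (1 + ‖z‖) ^ (-(N : ℤ))) hε.le
    rw [integral_const_mul, integral_sub_right_eq_self
      (fun x => (fun z : Fin m → ℝ => (1 + ‖z‖) ^ (-(N : ℤ))) (ε⁻¹ • x)) x₀]
    beta_reduce at h4 ⊢
    rw [h4, smul_eq_mul, ← mul_assoc, Module.finrank_fin_fun, ← zpow_natCast, ← zpow_add₀ hε.ne']
    congr 2
    ring

/-- The phase `f` recentred so as to vanish to second order at `x₀`. -/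
noncomputable def centredPhase (f : (Fin m → ℝ) → ℝ) (x₀ x : Fin m → ℝ) : ℝ :=
  f x - f x₀ - fderiv ℝ f x₀ (x - x₀)

/-- Parameters of the stationary phase estimates: a frequency and a critical point. -/
abbrev PhaseParam (X : Set (Fin m → ℝ)) : Type := {p : ℝ × (Fin m → ℝ) // 1 ≤ p.1 ∧ p.2 ∈ X}

/-- The natural scale `λ^{-1/2} + |x - x₀|` at distance `|x - x₀|` from the critical point. -/
noncomputable def phaseGauge (X : Set (Fin m → ℝ)) (p : PhaseParam X) (x : Fin m → ℝ) : ℝ :=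
  (√p.1.1)⁻¹ + ‖x - p.1.2‖

theorem phaseGauge_pos (X : Set (Fin m → ℝ)) (p : PhaseParam X) (x : Fin m → ℝ) :
    0 < phaseGauge X p x := by
  have : 0 < √p.1.1 := Real.sqrt_pos.2 (by linarith [p.2.1])
  unfold phaseGauge
  positivity

theorem exists_phaseGauge_le {X Ω : Set (Fin m → ℝ)} (hX : Bornology.IsBounded X)
    (hΩ : IsCompact Ω) : ∃ R : ℝ, ∀ p : PhaseParam X, ∀ x ∈ Ω, phaseGauge X p x ≤ R := by
  obtain ⟨A, hA⟩ := hX.exists_norm_le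
  obtain ⟨B, hB⟩ := hΩ.isBounded.exists_norm_le
  refine ⟨1 + (B + A), fun p x hx => ?_⟩
  unfold phaseGauge
  have h1 : (√p.1.1)⁻¹ ≤ 1 := inv_le_one_of_one_le₀ (Real.one_le_sqrt.2 p.2.1)
  have h2 := norm_sub_le x p.1.2
  linarith [hA _ p.2.2, hB x hx]

theorem fderiv_centredPhase {f : (Fin m → ℝ) → ℝ} (hf : Differentiable ℝ f)
    (x₀ x : Fin m → ℝ) :
    fderiv ℝ (centredPhase f x₀) x = fderiv ℝ f x - fderiv ℝ f x₀ := by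
  have h1 : HasFDerivAt (centredPhase f x₀) (fderiv ℝ f x - fderiv ℝ f x₀) x := by
    unfold centredPhase
    have h2 : HasFDerivAt (fun x => fderiv ℝ f x₀ (x - x₀)) (fderiv ℝ f x₀) x :=
      (fderiv ℝ f x₀).hasFDerivAt.comp x ((hasFDerivAt_id x).sub_const x₀)
    exact ((hf x).hasFDerivAt.sub_const _).sub h2
  exact h1.fderiv

theorem contDiff_centredPhase {r : WithTop ℕ∞} {f : (Fin m → ℝ) → ℝ} (hf : ContDiff ℝ r f)
    (x₀ : Fin m → ℝ) : ContDiff ℝ r (centredPhase f x₀) := by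
  unfold centredPhase
  exact (hf.sub contDiff_const).sub
    ((fderiv ℝ f x₀).contDiff.comp (contDiff_id.sub contDiff_const))

theorem pderivAt_gradC_centredPhase {f : (Fin m → ℝ) → ℝ} (hf : ContDiff ℝ 2 f)
    (x₀ : Fin m → ℝ) (i j : Fin m) :
    pderivAt j (gradC (centredPhase f x₀) i) = pderivAt j (gradC f i) := by
  have hd : Differentiable ℝ f := hf.differentiable (by norm_num)
  have h1 : gradC (centredPhase f x₀) i = fun x => gradC f i x - gradC f i x₀ := by
    funext x
    simp [gradC, fderiv_centredPhase hd]
  rw [h1]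
  funext x
  unfold pderivAt
  rw [fderiv_sub_const]

theorem contDiff_gradC {r : ℕ} {f : (Fin m → ℝ) → ℝ} (hf : ContDiff ℝ (r + 1 : ℕ) f)
    (i : Fin m) : ContDiff ℝ r (gradC f i) := by
  have h1 : ContDiff ℝ r (fderiv ℝ f) := hf.fderiv_right (by norm_cast)
  exact Complex.ofRealCLM.contDiff.comp (h1.clm_apply contDiff_const)

/-- A compactly supported `C²` function has Lipschitz gradient. -/
theorem exists_lipschitz_fderiv {f : (Fin m → ℝ) → ℝ} (hf : ContDiff ℝ 2 f)
    (hfc : HasCompactSupport f) :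
    ∃ L : ℝ, 0 ≤ L ∧ ∀ x y, ‖fderiv ℝ f x - fderiv ℝ f y‖ ≤ L * ‖x - y‖ := by
  have h1 : ContDiff ℝ 1 (fderiv ℝ f) := hf.fderiv_right (by norm_num)
  obtain ⟨L, hL⟩ := h1.lipschitzWith_of_hasCompactSupport (hfc.fderiv ℝ) (by norm_num)
  exact ⟨L, L.2, fun x y => hL.norm_sub_le x y⟩

theorem exists_abs_centredPhase_le {f : (Fin m → ℝ) → ℝ} (hf : ContDiff ℝ 2 f)
    (hfc : HasCompactSupport f) :
    ∃ L : ℝ, 0 ≤ L ∧ ∀ x₀ x, |centredPhase f x₀ x| ≤ L * ‖x - x₀‖ ^ 2 := by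
  obtain ⟨L, hL, h⟩ := exists_lipschitz_fderiv hf hfc
  refine ⟨L, hL, fun x₀ x => ?_⟩
  have hd : Differentiable ℝ f := hf.differentiable (by norm_num)
  have h2 := (convex_closedBall x₀ ‖x - x₀‖).norm_image_sub_le_of_norm_fderiv_le (𝕜 := ℝ)
    (f := centredPhase f x₀) (C := L * ‖x - x₀‖) (x := x₀) (y := x)
    (fun y _ => (contDiff_centredPhase hf x₀).differentiable (by norm_num) y)
    (fun y hy => by
      rw [fderiv_centredPhase hd]
      refine (h y x₀).trans (mul_le_mul_of_nonneg_left ?_ hL)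
      simpa [dist_eq_norm] using hy) (by simp) (by simp [dist_eq_norm])
  have h3 : centredPhase f x₀ x₀ = 0 := by simp [centredPhase]
  rw [h3, sub_zero, Real.norm_eq_abs] at h2
  linarith [h2, sq ‖x - x₀‖, mul_assoc L ‖x - x₀‖ ‖x - x₀‖]

theorem exists_isSymbol_gradC {f : (Fin m → ℝ) → ℝ} {k : ℕ}
    (hf : ContDiff ℝ (k + 2 : ℕ) f) (hfc : HasCompactSupport f) {X Ω : Set (Fin m → ℝ)}
    (hX : Bornology.IsBounded X) (hΩ : IsCompact Ω) (i : Fin m) :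
    IsSymbol Ω (phaseGauge X) (k + 1) 1 (fun p => gradC (centredPhase f p.1.2) i) := by
  have hf2 : ContDiff ℝ 2 f := hf.of_le (by norm_cast; omega)
  have hd : Differentiable ℝ f := hf2.differentiable (by norm_num)
  obtain ⟨L, hL, h⟩ := exists_lipschitz_fderiv hf2 hfc
  obtain ⟨R, hR⟩ := exists_phaseGauge_le hX hΩ
  refine IsSymbol.succ_intro (fun p => contDiff_gradC (contDiff_centredPhase hf _) i)
    ⟨L, hL, fun p x hx => ?_⟩ fun j => ?_
  · have h1 : 0 ≤ (√p.1.1)⁻¹ := by positivity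
    simp only [gradC, zpow_one, Complex.norm_real, phaseGauge]
    rw [fderiv_centredPhase hd]
    calc _ ≤ ‖fderiv ℝ f x - fderiv ℝ f p.1.2‖ * ‖(Pi.single i 1 : Fin m → ℝ)‖ :=
          ContinuousLinearMap.le_opNorm _ _
      _ = ‖fderiv ℝ f x - fderiv ℝ f p.1.2‖ := by rw [Pi.norm_single, norm_one, mul_one]
      _ ≤ L * ‖x - p.1.2‖ := h _ _
      _ ≤ _ := mul_le_mul_of_nonneg_left (by linarith) hL
  · have h2 := IsSymbol.of_contDiff hΩ (phaseGauge_pos X) hR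
      (contDiff_pderivAt (contDiff_gradC hf i) j) (s := 1 - 1) (by norm_num)
    simpa only [pderivAt_gradC_centredPhase hf2] using h2

theorem exists_isSymbol_centredPhase {f : (Fin m → ℝ) → ℝ} {k : ℕ}
    (hf : ContDiff ℝ (k + 2 : ℕ) f) (hfc : HasCompactSupport f) {X Ω : Set (Fin m → ℝ)}
    (hX : Bornology.IsBounded X) (hΩ : IsCompact Ω) :
    IsSymbol Ω (phaseGauge X) (k + 1) 2 (fun p x => ((centredPhase f p.1.2 x : ℝ) : ℂ)) := by
  have hf2 : ContDiff ℝ 2 f := hf.of_le (by norm_cast; omega)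
  obtain ⟨L, hL, h⟩ := exists_abs_centredPhase_le hf2 hfc
  refine IsSymbol.succ_intro (fun p => Complex.ofRealCLM.contDiff.comp
    ((contDiff_centredPhase hf _).of_le (by norm_cast; omega)))
    ⟨L, hL, fun p x hx => ?_⟩ fun j => ?_
  · have h1 : 0 ≤ (√p.1.1)⁻¹ := by positivity
    rw [Complex.norm_real, Real.norm_eq_abs]
    refine (h _ _).trans (mul_le_mul_of_nonneg_left ?_ hL)
    exact_mod_cast pow_le_pow_left₀ (norm_nonneg _) (by unfold phaseGauge; linarith) 2
  · have h2 := (exists_isSymbol_gradC hf hfc hX hΩ j).of_succ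
    rw [show (2 : ℤ) - 1 = 1 by norm_num]
    convert h2 using 1
    funext p x
    have h3 : HasFDerivAt (fun x => ((centredPhase f p.1.2 x : ℝ) : ℂ))
      (Complex.ofRealCLM.comp (fderiv ℝ (centredPhase f p.1.2) x)) x :=
      Complex.ofRealCLM.hasFDerivAt.comp x
        (((contDiff_centredPhase hf2 _).differentiable (by norm_num) x).hasFDerivAt)
    simp only [pderivAt, gradC]
    rw [h3.fderiv]
    rfl

/-- Upper bounds for stationary phase integrals whose amplitude is a symbol of order `s`. -/
theorem exists_stationary_bound {f : (Fin m → ℝ) → ℝ} {k : ℕ}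
    (hf : ContDiff ℝ (k + 2 : ℕ) f) (hfc : HasCompactSupport f) {X Ω : Set (Fin m → ℝ)}
    (hX : Bornology.IsBounded X) (hΩ : IsCompact Ω) {c : ℝ} (hc : 0 < c)
    (hlow : ∀ x₀ ∈ X, ∀ x ∈ Ω, c * ‖x - x₀‖ ^ 2 ≤
      ∑ i, (fderiv ℝ f x (Pi.single i 1) - fderiv ℝ f x₀ (Pi.single i 1)) ^ 2)
    {s : ℕ} (hs : m + s < 2 * (k + 1)) {a : PhaseParam X → (Fin m → ℝ) → ℂ}
    (ha : IsSymbol Ω (phaseGauge X) (k + 1) s a) (ha0 : ∀ p, ∀ x ∉ Ω, a p x = 0) :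
    ∃ C : ℝ, 0 ≤ C ∧ ∀ p : PhaseParam X,
      ‖∫ x, a p x * oscExp p.1.1 (centredPhase f p.1.2) x‖ ≤ C * (√p.1.1)⁻¹ ^ (m + s) := by
  have hf2 : ContDiff ℝ 2 f := hf.of_le (by norm_cast; omega)
  have hd : Differentiable ℝ f := hf2.differentiable (by norm_num)
  have hsq : ∀ p : PhaseParam X, (p.1.1)⁻¹ = (√p.1.1)⁻¹ ^ 2 := fun p => by
    rw [inv_pow, Real.sq_sqrt (by linarith [p.2.1])]
  obtain ⟨C, hC, h⟩ := exists_norm_integral_oscExp_le hΩ (phaseGauge_pos X)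
    (fun p => by unfold phaseGauge; fun_prop) (lam := fun p : PhaseParam X => p.1.1)
    (fun p => by linarith [p.2.1]) (g := fun p => centredPhase f p.1.2)
    (fun p => contDiff_centredPhase hf2 _)
    (fun p x hx => by
      rw [hsq]
      exact pow_le_pow_left₀ (by positivity) (by unfold phaseGauge; linarith [norm_nonneg (x - p.1.2)]) 2)
    (c := min c 1 / 2) (by positivity)
    (fun p x hx => by
      rw [hsq]
      simp only [fderiv_centredPhase hd]
      have h1 := hlow p.1.2 p.2.2 x hx
      refine le_trans ?_ (add_le_add_right h1 _)
      unfold phaseGauge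
      have h2 : min c 1 ≤ c := min_le_left _ _
      have h3 : min c 1 ≤ 1 := min_le_right _ _
      have h4 : 0 < min c 1 := by positivity
      generalize (√p.1.1)⁻¹ = e
      generalize ‖x - p.1.2‖ = d
      nlinarith [mul_nonneg h4.le (sq_nonneg (e - d)), mul_le_mul_of_nonneg_right h2 (sq_nonneg d),
        mul_le_mul_of_nonneg_right h3 (sq_nonneg e)])
    (k + 1) (exists_isSymbol_gradC hf hfc hX hΩ) ha ha0
  set N : ℕ := 2 * (k + 1) - s with hN
  set I : ℝ := ∫ z : Fin m → ℝ, (1 + ‖z‖) ^ (-(N : ℤ)) with hI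
  have hI0 : 0 ≤ I := integral_nonneg fun z => by positivity
  refine ⟨C * I, by positivity, fun p => (h p).trans ?_⟩
  have he : 0 < (√p.1.1)⁻¹ := inv_pos.2 (Real.sqrt_pos.2 (by linarith [p.2.1]))
  obtain ⟨hi, hv⟩ := integral_add_norm_sub_zpow (m := m) (N := N) (by omega) he p.1.2
  have e1 : (s : ℤ) - 2 * ((k + 1 : ℕ) : ℤ) = -(N : ℤ) := by omega
  rw [e1]
  have h5 : ∫ x in Ω, phaseGauge X p x ^ (-(N : ℤ)) ≤ (√p.1.1)⁻¹ ^ ((m : ℤ) - N) * I := by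
    rw [← hv]
    exact setIntegral_le_integral hi (Filter.Eventually.of_forall fun x =>
      zpow_nonneg (phaseGauge_pos X p x).le _)
  calc _ ≤ C * (p.1.1)⁻¹ ^ (k + 1) * ((√p.1.1)⁻¹ ^ ((m : ℤ) - N) * I) :=
        mul_le_mul_of_nonneg_left h5 (by have := p.2.1; positivity)
    _ = C * I * ((√p.1.1)⁻¹ ^ (2 * (k + 1)) * (√p.1.1)⁻¹ ^ ((m : ℤ) - N)) := by
        rw [hsq, ← pow_mul]; ring
    _ = _ := by
        rw [← zpow_natCast, ← zpow_natCast, ← zpow_add₀ he.ne']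
        congr 2
        push_cast
        omega

end StationaryPhase

section Legendre

variable {m : ℕ}

theorem contDiff_of_contDiffOn_tsupport {E F : Type*} [NormedAddCommGroup E] [NormedSpace ℝ E]
    [NormedAddCommGroup F] [NormedSpace ℝ F] {r : ℕ} {U : Set E} (hU : IsOpen U) {g : E → F}
    (hg : ContDiffOn ℝ r g U) {K : Set E} (hK : IsClosed K) (hKU : K ⊆ U)
    (h0 : ∀ x ∉ K, g x = 0) : ContDiff ℝ r g := by
  rw [contDiff_iff_contDiffAt]
  intro x
  by_cases hx : x ∈ U
  · exact hg.contDiffAt (hU.mem_nhds hx)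
  · have h1 : g =ᶠ[nhds x] fun _ => 0 := by
      filter_upwards [hK.isOpen_compl.mem_nhds fun h => hx (hKU h)] with y hy using h0 y hy
    exact contDiffAt_const.congr_of_eventuallyEq h1

/-- Smooth cutoffs: a `C^r` function on an open set agrees near a given compact subset with a
compactly supported `C^r` function. -/
theorem exists_contDiff_extension {r : ℕ} {U K : Set (Fin m → ℝ)} (hU : IsOpen U)
    (hK : IsCompact K) (hKU : K ⊆ U) {f : (Fin m → ℝ) → ℝ} (hf : ContDiffOn ℝ r f U) :
    ∃ g : (Fin m → ℝ) → ℝ, ContDiff ℝ r g ∧ HasCompactSupport g ∧ tsupport g ⊆ U ∧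
      ∀ x ∈ K, g =ᶠ[nhds x] f := by
  obtain ⟨L, hL, hKL, hLU⟩ := exists_compact_between hK hU hKU
  obtain ⟨χ, h1, h0, -⟩ := exists_contMDiffMap_one_nhds_of_subset_interior
    (n := r) (modelWithCornersSelf ℝ (Fin m → ℝ)) hK.isClosed hKL
  have hχ : ContDiff ℝ r χ := χ.contMDiff.contDiff
  have hz : ∀ x ∉ L, χ x * f x = 0 := fun x hx => by rw [h0 x hx, zero_mul]
  refine ⟨fun x => χ x * f x, contDiff_of_contDiffOn_tsupport hU (hχ.contDiffOn.mul hf)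
    hL.isClosed hLU hz, HasCompactSupport.intro hL hz, ?_, fun x hx => ?_⟩
  · refine (closure_minimal (fun x hx => ?_) hL.isClosed).trans hLU
    by_contra h
    exact hx (hz x h)
  · have h2 : ∀ᶠ y in nhds x, χ y = 1 := (eventually_nhdsSet_iff_forall.1 h1) x hx
    filter_upwards [h2] with y hy
    rw [hy, one_mul]

/-- A pair of functions on open sets which are Legendre transforms of each other. -/
structure IsLegendrePair (D : Set (Fin m → ℝ)) (f : (Fin m → ℝ) → ℝ)
    (D' : Set (Fin m → ℝ)) (f' : (Fin m → ℝ) → ℝ) : Prop where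
  isOpen : IsOpen D
  isOpen' : IsOpen D'
  contDiffOn : ContDiffOn ℝ (m + 2 : ℕ) f D
  contDiffOn' : ContDiffOn ℝ (m + 2 : ℕ) f' D'
  mapsTo : ∀ x ∈ D, gradv f x ∈ D'
  mapsTo' : ∀ y ∈ D', gradv f' y ∈ D
  left_inv : ∀ x ∈ D, gradv f' (gradv f x) = x
  right_inv : ∀ y ∈ D', gradv f (gradv f' y) = y
  add_eq : ∀ x ∈ D, f x + f' (gradv f x) = ∑ i, x i * gradv f x i

theorem IsLegendrePair.symm {D D' : Set (Fin m → ℝ)} {f f' : (Fin m → ℝ) → ℝ}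
    (h : IsLegendrePair D f D' f') : IsLegendrePair D' f' D f where
  isOpen := h.isOpen'
  isOpen' := h.isOpen
  contDiffOn := h.contDiffOn'
  contDiffOn' := h.contDiffOn
  mapsTo := h.mapsTo'
  mapsTo' := h.mapsTo
  left_inv := h.right_inv
  right_inv := h.left_inv
  add_eq := fun y hy => by
    have h1 := h.add_eq _ (h.mapsTo' y hy)
    rw [h.right_inv y hy] at h1
    rw [add_comm, h1]
    exact Finset.sum_congr rfl fun i _ => mul_comm _ _

theorem contDiffOn_gradv {r : ℕ} {D : Set (Fin m → ℝ)} (hD : IsOpen D) {f : (Fin m → ℝ) → ℝ}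
    (hf : ContDiffOn ℝ (r + 1 : ℕ) f D) : ContDiffOn ℝ r (gradv f) D := by
  have h1 : ContDiffOn ℝ r (fderiv ℝ f) D := hf.fderiv_of_isOpen hD (by norm_cast)
  exact contDiffOn_pi.2 fun i => h1.clm_apply contDiffOn_const

theorem fderiv_apply_eq_sum (f : (Fin m → ℝ) → ℝ) (x v : Fin m → ℝ) :
    fderiv ℝ f x v = ∑ i, v i * gradv f x i := by
  conv_lhs => rw [← Finset.univ_sum_single v]
  rw [map_sum]
  refine Finset.sum_congr rfl fun i _ => ?_
  have : (Pi.single i (v i) : Fin m → ℝ) = v i • Pi.single i 1 := by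
    rw [← Pi.single_smul', smul_eq_mul, mul_one]
  rw [this, map_smul, smul_eq_mul, gradv]

theorem gradv_congr {f g : (Fin m → ℝ) → ℝ} {x : Fin m → ℝ} (h : f =ᶠ[nhds x] g) :
    gradv f x = gradv g x := by
  funext i
  simp only [gradv, h.fderiv_eq]

/-- Transport of a weight on `D` to the Legendre dual side. -/
noncomputable def dualWeight (D' : Set (Fin m → ℝ)) (f' w : (Fin m → ℝ) → ℝ) :
    (Fin m → ℝ) → ℝ :=
  D'.indicator fun y => w (gradv f' y)

/-- Admissible weights: compactly supported in `D`, of class `C^{m+1}`. -/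
structure IsWeight (D : Set (Fin m → ℝ)) (w : (Fin m → ℝ) → ℝ) : Prop where
  contDiff : ContDiff ℝ (m + 1 : ℕ) w
  hasCompactSupport : HasCompactSupport w
  subset : tsupport w ⊆ D

namespace IsLegendrePair

variable {D D' : Set (Fin m → ℝ)} {f f' w : (Fin m → ℝ) → ℝ}

theorem isCompact_image (h : IsLegendrePair D f D' f') {K : Set (Fin m → ℝ)} (hK : IsCompact K)
    (hKD : K ⊆ D) : IsCompact (gradv f '' K) :=
  hK.image_of_continuousOn (((contDiffOn_gradv (r := m + 1) h.isOpen h.contDiffOn).continuousOn).mono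
    hKD)

theorem isCompact_image_tsupport (h : IsLegendrePair D f D' f') (hw : IsWeight D w) :
    IsCompact (gradv f '' tsupport w) :=
  h.isCompact_image hw.hasCompactSupport hw.subset

theorem image_tsupport_subset (h : IsLegendrePair D f D' f') (hw : IsWeight D w) :
    gradv f '' tsupport w ⊆ D' := by
  rintro _ ⟨x, hx, rfl⟩
  exact h.mapsTo x (hw.subset hx)

theorem dualWeight_eq_zero (h : IsLegendrePair D f D' f') :
    ∀ y ∉ gradv f '' tsupport w, dualWeight D' f' w y = 0 := by
  intro y hy
  unfold dualWeight
  by_cases hyD : y ∈ D'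
  · rw [Set.indicator_of_mem hyD]
    by_contra h1
    exact hy ⟨_, subset_tsupport w h1, h.right_inv y hyD⟩
  · exact Set.indicator_of_notMem hyD _

theorem isWeight_dualWeight (h : IsLegendrePair D f D' f') (hw : IsWeight D w) :
    IsWeight D' (dualWeight D' f' w) := by
  have hK := h.isCompact_image_tsupport hw
  refine ⟨?_, HasCompactSupport.intro hK h.dualWeight_eq_zero, ?_⟩
  · refine contDiff_of_contDiffOn_tsupport h.isOpen' ?_ hK.isClosed (h.image_tsupport_subset hw)
      h.dualWeight_eq_zero
    have h1 := hw.contDiff.comp_contDiffOn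
      (contDiffOn_gradv (r := m + 1) h.isOpen' h.contDiffOn')
    exact h1.congr fun y hy => by simp [dualWeight, Set.indicator_of_mem hy]
  · refine (closure_minimal (fun y hy => ?_) hK.isClosed).trans (h.image_tsupport_subset hw)
    by_contra h1
    exact hy (h.dualWeight_eq_zero y h1)

theorem dualWeight_dualWeight (h : IsLegendrePair D f D' f') (hw : IsWeight D w) :
    dualWeight D f (dualWeight D' f' w) = w := by
  funext x
  unfold dualWeight
  by_cases hx : x ∈ D
  · rw [Set.indicator_of_mem hx, Set.indicator_of_mem (h.mapsTo x hx), h.left_inv x hx]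
  · rw [Set.indicator_of_notMem hx]
    by_contra h1
    exact hx (hw.subset (subset_tsupport w (Ne.symm h1)))

theorem dualWeight_nonneg (hw : ∀ x, 0 ≤ w x) (y : Fin m → ℝ) : 0 ≤ dualWeight D' f' w y :=
  Set.indicator_nonneg (fun _ _ => hw _) y

/-- On compact subsets of `D` the gradient map is expanding up to a constant. -/
theorem exists_norm_sub_le (h : IsLegendrePair D f D' f') {K : Set (Fin m → ℝ)} (hK : IsCompact K)
    (hKD : K ⊆ D) : ∃ L : ℝ, 0 ≤ L ∧ ∀ x ∈ K, ∀ y ∈ K,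
      ‖x - y‖ ≤ L * ‖gradv f x - gradv f y‖ := by
  obtain ⟨g, hg, hgc, -, hgf⟩ := exists_contDiff_extension h.isOpen' (h.isCompact_image hK hKD)
    (by rintro _ ⟨x, hx, rfl⟩; exact h.mapsTo x (hKD hx)) h.contDiffOn'
  obtain ⟨L, hL, hl⟩ := exists_lipschitz_fderiv (hg.of_le (by norm_cast; omega)) hgc
  refine ⟨L, hL, fun x hx y hy => ?_⟩
  have e : ∀ x ∈ K, x = gradv g (gradv f x) := fun x hx => by
    rw [gradv_congr (hgf _ ⟨x, hx, rfl⟩), h.left_inv x (hKD hx)]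
  refine (pi_norm_le_iff_of_nonneg (by positivity)).2 fun i => ?_
  rw [Pi.sub_apply, congrFun (e x hx) i, congrFun (e y hy) i]
  unfold gradv
  rw [← sub_apply]
  refine (ContinuousLinearMap.le_opNorm _ _).trans ?_
  rw [Pi.norm_single, norm_one, mul_one]
  exact hl _ _

end IsLegendrePair

end Legendre

section StationaryLegendre

variable {m : ℕ}

theorem norm_sq_le_sum_sq (v : Fin m → ℝ) : ‖v‖ ^ 2 ≤ ∑ i, v i ^ 2 := by
  have h1 : ‖v‖ ≤ √(∑ i, v i ^ 2) := by
    refine (pi_norm_le_iff_of_nonneg (Real.sqrt_nonneg _)).2 fun i => ?_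
    rw [Real.norm_eq_abs]
    refine Real.abs_le_sqrt ?_
    exact Finset.single_le_sum (f := fun i => v i ^ 2) (fun i _ => sq_nonneg _) (Finset.mem_univ i)
  calc ‖v‖ ^ 2 ≤ √(∑ i, v i ^ 2) ^ 2 := pow_le_pow_left₀ (norm_nonneg _) h1 2
    _ = _ := Real.sq_sqrt (Finset.sum_nonneg fun i _ => sq_nonneg _)

/-- The phase `f(x) + f'(y) - x·y`. -/
noncomputable def legPhase (f f' : (Fin m → ℝ) → ℝ) (y x : Fin m → ℝ) : ℝ :=
  f x + f' y - ∑ i, x i * y i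

theorem norm_oscInt_sub_le {a : (Fin m → ℝ) → ℂ} {g : (Fin m → ℝ) → ℝ} (ha : Continuous a)
    (hac : HasCompactSupport a) (hg : Continuous g) {lam mu B : ℝ} (hlm : lam ≤ mu)
    (hB : ∀ t, lam ≤ t → ‖∫ x, a x * (g x : ℂ) * oscExp t g x‖ ≤ B) :
    ‖(∫ x, a x * oscExp mu g x) - ∫ x, a x * oscExp lam g x‖ ≤ B * (mu - lam) := by
  have hc : ∀ t, Continuous (oscExp t g) := fun t => by unfold oscExp; fun_prop
  have hga : Continuous fun x => a x * (g x : ℂ) := by fun_prop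
  have hgac : HasCompactSupport fun x => a x * (g x : ℂ) := hac.mul_right
  have hi : Integrable fun x => a x * (g x : ℂ) := hga.integrable_of_hasCompactSupport hgac
  have hd : ∀ t, HasDerivAt (fun t => ∫ x, a x * oscExp t g x)
      (∫ x, Complex.I * (a x * (g x : ℂ) * oscExp t g x)) t := fun t => by
    refine (hasDerivAt_integral_of_dominated_loc_of_deriv_le (s := Set.univ)
      (F := fun t x => a x * oscExp t g x)
      (F' := fun t x => Complex.I * (a x * (g x : ℂ) * oscExp t g x))
      (bound := fun x => ‖a x * (g x : ℂ)‖) Filter.univ_mem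
      (Filter.Eventually.of_forall fun t => (ha.mul (hc t)).aestronglyMeasurable)
      ?_ ?_ ?_ hi.norm ?_).2
    · exact (ha.mul (hc t)).integrable_of_hasCompactSupport hac.mul_right
    · exact (continuous_const.mul (hga.mul (hc t))).aestronglyMeasurable
    · refine Filter.Eventually.of_forall fun x t _ => ?_
      rw [norm_mul, norm_mul, norm_oscExp, Complex.norm_I, one_mul, mul_one]
    · refine Filter.Eventually.of_forall fun x t _ => ?_
      have h1 : HasDerivAt (fun t : ℝ => (((t * g x : ℝ) : ℂ)) * Complex.I)
          ((g x : ℂ) * Complex.I) t := by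
        have h2 := (((hasDerivAt_id t).mul_const (g x)).ofReal_comp).mul_const Complex.I
        simpa using h2
      have h3 := (h1.cexp).const_mul (a x)
      unfold oscExp
      exact h3.congr_deriv (by ring)
  have h1 := (convex_Ici lam).norm_image_sub_le_of_norm_hasDerivWithin_le
    (f := fun t => ∫ x, a x * oscExp t g x)
    (f' := fun t => ∫ x, Complex.I * (a x * (g x : ℂ) * oscExp t g x))
    (C := B) (x := lam) (y := mu) (fun t _ => (hd t).hasDerivWithinAt)
    (fun t ht => by
      rw [integral_const_mul, norm_mul, Complex.norm_I, one_mul]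
      exact hB t ht) Set.self_mem_Ici hlm
  rwa [Real.norm_of_nonneg (by linarith)] at h1

variable {D D' : Set (Fin m → ℝ)} {f f' w : (Fin m → ℝ) → ℝ}

/-- Stationary phase estimates near the dual points, uniform in the dual variable. The
frequency integral of `w` is that of a fixed cutoff `χ` times the dual weight, up to a
gain of `λ^{-1/2}`. -/
theorem IsLegendrePair.exists_stationary (h : IsLegendrePair D f D' f') (hw : IsWeight D w)
    (hm : 0 < m) : ∃ χ : (Fin m → ℝ) → ℝ, ∃ V : Set (Fin m → ℝ), ∃ C : ℝ,
      IsWeight D χ ∧ IsCompact V ∧ V ⊆ D' ∧ gradv f '' tsupport w ⊆ interior V ∧ 0 ≤ C ∧ ∀ y ∈ V,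
      (∀ lam : ℝ, 1 ≤ lam →
        ‖∫ x, (χ x : ℂ) * oscExp lam (legPhase f f' y) x‖ ≤ C * (√lam)⁻¹ ^ m) ∧
      (∀ lam mu : ℝ, 1 ≤ lam → lam ≤ mu →
        ‖(∫ x, (χ x : ℂ) * oscExp mu (legPhase f f' y) x) -
          ∫ x, (χ x : ℂ) * oscExp lam (legPhase f f' y) x‖ ≤
          C * (√lam)⁻¹ ^ (m + 2) * (mu - lam)) ∧
      (∀ lam : ℝ, 1 ≤ lam →
        ‖∫ x, ((w x : ℂ) - (dualWeight D' f' w y : ℂ) * (χ x : ℂ)) *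
          oscExp lam (legPhase f f' y) x‖ ≤ C * (√lam)⁻¹ ^ (m + 1)) := by
  obtain ⟨V, hV, hKV, hVD⟩ := exists_compact_between (h.isCompact_image_tsupport hw) h.isOpen'
    (h.image_tsupport_subset hw)
  set X := gradv f' '' V with hXdef
  have hX : IsCompact X := h.symm.isCompact_image hV hVD
  have hXD : X ⊆ D := by
    rintro _ ⟨y, hy, rfl⟩
    exact h.mapsTo' y (hVD hy)
  obtain ⟨χ, hχ, hχc, hχD, hχ1⟩ := exists_contDiff_extension (r := m + 1) (f := fun _ => (1 : ℝ))
    h.isOpen hX hXD contDiffOn_const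
  have hχ1' : ∀ x ∈ X, χ x = 1 := fun x hx => (hχ1 x hx).self_of_nhds
  set Ω := tsupport χ with hΩdef
  have hΩ : IsCompact Ω := hχc
  have hXΩ : X ⊆ Ω := fun x hx => subset_tsupport χ (by
    rw [Function.mem_support, hχ1' x hx]; exact one_ne_zero)
  have hwX : tsupport w ⊆ X := fun x hx =>
    ⟨gradv f x, interior_subset (hKV ⟨x, hx, rfl⟩), h.left_inv x (hw.subset hx)⟩
  obtain ⟨F, hF, hFc, -, hFf⟩ := exists_contDiff_extension h.isOpen hΩ hχD h.contDiffOn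
  have hFv : ∀ x ∈ Ω, F x = f x := fun x hx => (hFf x hx).self_of_nhds
  have hFg : ∀ x ∈ Ω, gradv F x = gradv f x := fun x hx => gradv_congr (hFf x hx)
  obtain ⟨L, hL, hl⟩ := h.exists_norm_sub_le hΩ hχD
  have hlow : ∀ x₀ ∈ X, ∀ x ∈ Ω, (L ^ 2 + 1)⁻¹ * ‖x - x₀‖ ^ 2 ≤
      ∑ i, (fderiv ℝ F x (Pi.single i 1) - fderiv ℝ F x₀ (Pi.single i 1)) ^ 2 := by
    intro x₀ hx₀ x hx
    have h1 := hl x hx x₀ (hXΩ hx₀)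
    rw [← hFg x hx, ← hFg x₀ (hXΩ hx₀)] at h1
    have h2 := norm_sq_le_sum_sq (gradv F x - gradv F x₀)
    have h3 : ‖x - x₀‖ ^ 2 ≤ (L ^ 2 + 1) * ‖gradv F x - gradv F x₀‖ ^ 2 := by
      have := pow_le_pow_left₀ (norm_nonneg _) h1 2
      nlinarith [sq_nonneg ‖gradv F x - gradv F x₀‖]
    rw [inv_mul_le_iff₀ (by positivity)]
    exact h3.trans (mul_le_mul_of_nonneg_left h2 (by positivity))
  have hF2 : ContDiff ℝ 2 F := hF.of_le (by norm_cast; omega)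
  obtain ⟨R, hR⟩ := exists_phaseGauge_le hX.isBounded hΩ
  have hcC : ContDiff ℝ (m + 1 : ℕ) fun x => (χ x : ℂ) := Complex.ofRealCLM.contDiff.comp hχ
  have hwC : ContDiff ℝ (m + 1 : ℕ) fun x => (w x : ℂ) :=
    Complex.ofRealCLM.contDiff.comp hw.contDiff
  have hχ0 : ∀ x ∉ Ω, χ x = 0 := fun x hx => image_eq_zero_of_notMem_tsupport hx
  have hw0 : ∀ x ∉ Ω, w x = 0 := fun x hx =>
    image_eq_zero_of_notMem_tsupport fun hx' => hx (hXΩ (hwX hx'))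
  have sχ : ∀ {r : ℕ}, r ≤ m + 1 → IsSymbol Ω (phaseGauge X) r 0 (fun _ x => (χ x : ℂ)) :=
    fun hr => IsSymbol.of_contDiff hΩ (phaseGauge_pos X) hR (hcC.of_le (by exact_mod_cast hr)) le_rfl
  obtain ⟨C₁, hC₁, e₁⟩ := exists_stationary_bound hF hFc hX.isBounded hΩ (by positivity) hlow
    (s := 0) (by omega) (sχ le_rfl) (fun p x hx => by simp [hχ0 x hx])
  have s2 : IsSymbol Ω (phaseGauge X) (m + 1) ((2 : ℕ) : ℤ)
      (fun p x => (χ x : ℂ) * (centredPhase F p.1.2 x : ℂ)) := by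
    have := (sχ le_rfl).mul (phaseGauge_pos X) (exists_isSymbol_centredPhase hF hFc hX.isBounded hΩ)
    simpa using this
  obtain ⟨C₂, hC₂, e₂⟩ := exists_stationary_bound hF hFc hX.isBounded hΩ (by positivity) hlow
    (s := 2) (by omega) s2 (fun p x hx => by simp [hχ0 x hx])
  obtain ⟨Lw, hLw⟩ := (hw.contDiff.of_le (by norm_cast; omega) :
    ContDiff ℝ 1 w).lipschitzWith_of_hasCompactSupport hw.hasCompactSupport (by norm_num)
  obtain ⟨Lχ, hLχ⟩ := (hχ.of_le (by norm_cast; omega) :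
    ContDiff ℝ 1 χ).lipschitzWith_of_hasCompactSupport hχc (by norm_num)
  obtain ⟨B, hB⟩ := hw.hasCompactSupport.exists_bound_of_continuous hw.contDiff.continuous
  have hB0 : 0 ≤ B := (norm_nonneg _).trans (hB 0)
  have s1 : IsSymbol Ω (phaseGauge X) (m + 1) ((1 : ℕ) : ℤ)
      (fun p x => (w x : ℂ) - (w p.1.2 : ℂ) * (χ x : ℂ)) := by
    refine IsSymbol.succ_intro (fun p => hwC.sub (contDiff_const.mul hcC))
      ⟨Lw + B * Lχ, by positivity, fun p x hx => ?_⟩ fun i => ?_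
    · have h1 := hLw.norm_sub_le x p.1.2
      have h2 := hLχ.norm_sub_le p.1.2 x
      rw [norm_sub_rev p.1.2 x] at h2
      have h3 : 0 ≤ (√p.1.1)⁻¹ := by positivity
      have h4 : (w x : ℂ) - (w p.1.2 : ℂ) * (χ x : ℂ) =
          (((w x - w p.1.2) + w p.1.2 * (χ p.1.2 - χ x) : ℝ) : ℂ) := by
        rw [hχ1' _ p.2.2]; push_cast; ring
      rw [h4, Complex.norm_real]
      refine (norm_add_le _ _).trans ?_
      rw [norm_mul, Nat.cast_one, zpow_one, phaseGauge, add_mul]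
      have h5 : (Lw : ℝ) * ‖x - p.1.2‖ ≤ Lw * ((√p.1.1)⁻¹ + ‖x - p.1.2‖) :=
        mul_le_mul_of_nonneg_left (by linarith) Lw.2
      have h6 : (Lχ : ℝ) * ‖x - p.1.2‖ ≤ Lχ * ((√p.1.1)⁻¹ + ‖x - p.1.2‖) :=
        mul_le_mul_of_nonneg_left (by linarith) Lχ.2
      have h7 : ‖w p.1.2‖ * ‖χ p.1.2 - χ x‖ ≤ B * (Lχ * ((√p.1.1)⁻¹ + ‖x - p.1.2‖)) :=
        mul_le_mul (hB _) (h2.trans h6) (norm_nonneg _) hB0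
      linarith
    · rw [show ((1 : ℕ) : ℤ) - 1 = 0 by norm_num]
      have t1 : IsSymbol Ω (phaseGauge X) m 0 (fun _ => pderivAt i fun x => (w x : ℂ)) :=
        IsSymbol.of_contDiff hΩ (phaseGauge_pos X) hR (contDiff_pderivAt hwC i) le_rfl
      have t2 : IsSymbol Ω (phaseGauge X) m 0 (fun _ => pderivAt i fun x => (χ x : ℂ)) :=
        IsSymbol.of_contDiff hΩ (phaseGauge_pos X) hR (contDiff_pderivAt hcC i) le_rfl
      have t3 : IsSymbol Ω (phaseGauge X) m 0 (fun p _ => (-(w p.1.2) : ℂ)) :=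
        IsSymbol.const ⟨B, hB0, fun p x hx => by
          rw [norm_neg, Complex.norm_real, zpow_zero, mul_one]; exact hB _⟩
      have t4 := t1.add (by simpa using t3.mul (phaseGauge_pos X) t2)
      convert t4 using 1
      funext p x
      have d1 : DifferentiableAt ℝ (fun x => (w x : ℂ)) x :=
        hwC.differentiable (by norm_cast) x
      have d2 : DifferentiableAt ℝ (fun x => (χ x : ℂ)) x :=
        hcC.differentiable (by norm_cast) x
      simp only [pderivAt]
      rw [fderiv_fun_sub d1 (d2.const_mul _), fderiv_const_mul d2]
      simp [sub_eq_add_neg]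
  obtain ⟨C₃, hC₃, e₃⟩ := exists_stationary_bound hF hFc hX.isBounded hΩ (by positivity) hlow
    (s := 1) (by omega) s1 (fun p x hx => by simp [hχ0 x hx, hw0 x hx])
  have hph : ∀ y ∈ V, ∀ x ∈ Ω, legPhase f f' y x = centredPhase F (gradv f' y) x := by
    intro y hy x hx
    have hxy : gradv f' y ∈ Ω := hXΩ ⟨y, hy, rfl⟩
    have h1 := h.add_eq _ (h.mapsTo' y (hVD hy))
    rw [h.right_inv y (hVD hy)] at h1
    rw [legPhase, centredPhase, fderiv_apply_eq_sum, hFg _ hxy, hFv _ hxy, hFv _ hx,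
      h.right_inv y (hVD hy)]
    simp only [Pi.sub_apply, sub_mul, Finset.sum_sub_distrib]
    linarith
  have hintegral : ∀ y ∈ V, ∀ lam : ℝ, ∀ a : (Fin m → ℝ) → ℂ, (∀ x ∉ Ω, a x = 0) →
      ∫ x, a x * oscExp lam (legPhase f f' y) x =
      ∫ x, a x * oscExp lam (centredPhase F (gradv f' y)) x := by
    intro y hy lam a ha
    congr 1
    funext x
    by_cases hx : x ∈ Ω
    · simp only [oscExp, hph y hy x hx]
    · simp [ha x hx]
  refine ⟨χ, V, C₁ + C₂ + C₃, ⟨hχ, hχc, hχD⟩, hV, hVD, hKV, by positivity, fun y hy =>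
    ⟨fun lam hlam => ?_, fun lam mu hlam hlm => ?_, fun lam hlam => ?_⟩⟩
  · rw [hintegral y hy lam _ fun x hx => by simp [hχ0 x hx]]
    refine (e₁ ⟨(lam, gradv f' y), hlam, y, hy, rfl⟩).trans ?_
    exact mul_le_mul_of_nonneg_right (by linarith) (by positivity)
  · rw [hintegral y hy lam _ fun x hx => by simp [hχ0 x hx],
      hintegral y hy mu _ fun x hx => by simp [hχ0 x hx]]
    refine norm_oscInt_sub_le hcC.continuous (HasCompactSupport.intro hΩ fun x hx => by
      simp [hχ0 x hx]) (contDiff_centredPhase hF2 _).continuous hlm fun t ht => ?_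
    refine (e₂ ⟨(t, gradv f' y), hlam.trans ht, y, hy, rfl⟩).trans ?_
    have h0 : 0 < √lam := Real.sqrt_pos.2 (by linarith)
    exact mul_le_mul (by linarith) (pow_le_pow_left₀ (by positivity)
      (inv_anti₀ h0 (Real.sqrt_le_sqrt ht)) _) (by positivity) (by positivity)
  · rw [hintegral y hy lam _ fun x hx => by simp [hχ0 x hx, hw0 x hx]]
    have h1 : dualWeight D' f' w y = w (gradv f' y) := Set.indicator_of_mem (hVD hy) _
    rw [h1]
    refine (e₃ ⟨(lam, gradv f' y), hlam, y, hy, rfl⟩).trans ?_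
    exact mul_le_mul_of_nonneg_right (by linarith) (by positivity)

end StationaryLegendre

section NonStationary

variable {m : ℕ}

theorem SymbolBound.change_order {P : Type*} {Ω : Set (Fin m → ℝ)} {r : ℕ} {s t : ℤ}
    {a : P → (Fin m → ℝ) → ℂ} (h : SymbolBound Ω (fun _ _ => 1) r s a) :
    SymbolBound Ω (fun _ _ => 1) r t a := by
  induction r generalizing s t a with
  | zero => simpa [SymbolBound] using h
  | succ r ih => exact ⟨by simpa using h.1, fun i => ih (h.2 i)⟩

theorem IsSymbol.change_order {P : Type*} {Ω : Set (Fin m → ℝ)} {r : ℕ} {s t : ℤ}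
    {a : P → (Fin m → ℝ) → ℂ} (h : IsSymbol Ω (fun _ _ => 1) r s a) :
    IsSymbol Ω (fun _ _ => 1) r t a := ⟨h.1, h.2.change_order⟩

variable {D D' : Set (Fin m → ℝ)} {f f' w : (Fin m → ℝ) → ℝ}

/-- Nonstationary phase with phase `s f(x) - v·x`. -/
theorem IsLegendrePair.exists_nonstationary_symbol (h : IsLegendrePair D f D' f') (hw : IsWeight D w)
    {c : ℝ} (hc : 0 < c) : ∃ C : ℝ, 0 ≤ C ∧ ∀ (lam s : ℝ) (v : Fin m → ℝ), 1 ≤ lam → |s| ≤ 1 →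
      ‖v‖ ≤ 1 → (∀ x ∈ tsupport w, c ≤ ‖s • gradv f x - v‖) →
      ‖∫ x, (w x : ℂ) * oscExp lam (fun x => s * f x - ∑ i, x i * v i) x‖ ≤
        C * lam⁻¹ ^ (m + 1) := by
  set Ω := tsupport w with hΩdef
  have hΩ : IsCompact Ω := hw.hasCompactSupport
  obtain ⟨F, hF, hFc, -, hFf⟩ := exists_contDiff_extension h.isOpen hΩ hw.subset h.contDiffOn
  have hFv : ∀ x ∈ Ω, F x = f x := fun x hx => (hFf x hx).self_of_nhds
  have hFg : ∀ x ∈ Ω, gradv F x = gradv f x := fun x hx => gradv_congr (hFf x hx)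
  have hd : Differentiable ℝ F := hF.differentiable (by norm_cast)
  let P : Type := {p : ℝ × ℝ × (Fin m → ℝ) // 1 ≤ p.1 ∧ |p.2.1| ≤ 1 ∧ ‖p.2.2‖ ≤ 1 ∧
    ∀ x ∈ Ω, c ≤ ‖p.2.1 • gradv f x - p.2.2‖}
  let g : P → (Fin m → ℝ) → ℝ := fun p x => p.1.2.1 * F x - ∑ i, x i * p.1.2.2 i
  have hg : ∀ p, ContDiff ℝ (m + 2 : ℕ) (g p) := fun p => by
    refine (contDiff_const.mul hF).sub (ContDiff.sum fun i _ => ?_)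
    exact (contDiff_apply ℝ ℝ i).mul contDiff_const
  have hgd : ∀ (p : P) (x : Fin m → ℝ) (i : Fin m), fderiv ℝ (g p) x (Pi.single i 1) =
      p.1.2.1 * gradv F x i - p.1.2.2 i := fun p x i => by
    have h1 : HasFDerivAt (fun x : Fin m → ℝ => ∑ i, x i * p.1.2.2 i)
        (∑ i, p.1.2.2 i • ContinuousLinearMap.proj (R := ℝ) (φ := fun _ : Fin m => ℝ) i) x :=
      HasFDerivAt.fun_sum fun i _ => (hasFDerivAt_apply i x).mul_const _
    have h2 : HasFDerivAt (g p) _ x := ((hd x).hasFDerivAt.const_mul p.1.2.1).sub h1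
    rw [h2.fderiv]
    simp [gradv, Pi.single_apply]
  have hFC : ∀ i, ContDiff ℝ (m + 1 : ℕ) (gradC F i) := fun i => contDiff_gradC hF i
  have hwC : ContDiff ℝ (m + 1 : ℕ) fun x => (w x : ℂ) :=
    Complex.ofRealCLM.contDiff.comp hw.contDiff
  have s0 : ∀ {r : ℕ} {H : (Fin m → ℝ) → ℂ}, ContDiff ℝ r H →
      IsSymbol Ω (fun (_ : P) _ => 1) r 0 (fun _ => H) := fun hH =>
    IsSymbol.of_contDiff hΩ (fun _ _ => one_pos) (R := 1) (fun _ _ _ => le_rfl) hH le_rfl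
  have sG : ∀ i, IsSymbol Ω (fun (_ : P) _ => 1) (m + 1) 1 (fun p => gradC (g p) i) := by
    intro i
    have t1 : IsSymbol Ω (fun (_ : P) _ => 1) (m + 1) 0 (fun p _ => (p.1.2.1 : ℂ)) :=
      IsSymbol.const ⟨1, zero_le_one, fun p x hx => by simpa using p.2.2.1⟩
    have t2 : IsSymbol Ω (fun (_ : P) _ => 1) (m + 1) 0 (fun p _ => (-(p.1.2.2 i : ℂ))) :=
      IsSymbol.const ⟨1, zero_le_one, fun p x hx => by
        have := (norm_le_pi_norm p.1.2.2 i).trans p.2.2.2.1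
        simpa using this⟩
    have t3 := ((t1.mul (fun _ _ => one_pos) (s0 (hFC i))).change_order (t := 0)).add t2
    convert t3.change_order (t := 1) using 1
    funext p x
    simp only [gradC]
    rw [hgd]
    push_cast [gradv]
    ring
  obtain ⟨C, hC, hb⟩ := exists_norm_integral_oscExp_le hΩ (P := P) (ρ := fun _ _ => 1)
    (fun _ _ => one_pos) (fun _ => continuous_const) (lam := fun p => p.1.1)
    (fun p => by linarith [p.2.1]) (g := g) (fun p => (hg p).of_le (by norm_cast; omega))
    (fun p x _ => by rw [one_pow]; exact inv_le_one_of_one_le₀ p.2.1) (c := c ^ 2) (by positivity)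
    (fun p x hx => by
      have h1 := p.2.2.2.2 x hx
      rw [← hFg x hx] at h1
      have h2 := norm_sq_le_sum_sq (p.1.2.1 • gradv F x - p.1.2.2)
      have h3 := pow_le_pow_left₀ hc.le h1 2
      have h4 : 0 < (p.1.1)⁻¹ := inv_pos.2 (by linarith [p.2.1])
      simp only [hgd]
      simp only [Pi.sub_apply, Pi.smul_apply, smul_eq_mul] at h2
      linarith) (m + 1) sG (s0 hwC)
      (fun p x hx => by
        have : w x = 0 := image_eq_zero_of_notMem_tsupport hx
        simp [this])
  refine ⟨C * ∫ x in Ω, (1 : ℝ), mul_nonneg hC (integral_nonneg fun x => zero_le_one),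
    fun lam s v hlam hs hv hlow => ?_⟩
  have h1 := hb ⟨(lam, s, v), hlam, hs, hv, hlow⟩
  simp only [one_zpow] at h1
  calc _ = ‖∫ x, (w x : ℂ) * oscExp lam (g ⟨(lam, s, v), hlam, hs, hv, hlow⟩) x‖ := by
        congr 2
        funext x
        by_cases hx : x ∈ Ω
        · simp only [oscExp, g, hFv x hx]
        · simp [image_eq_zero_of_notMem_tsupport hx]
    _ ≤ _ := h1
    _ = _ := by ring

/-- Decay of the Fourier coefficients away from the stationary range. -/
theorem IsLegendrePair.exists_nonstationary (h : IsLegendrePair D f D' f') (hw : IsWeight D w)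
    {V : Set (Fin m → ℝ)} (hV : gradv f '' tsupport w ⊆ interior V) :
    ∃ C : ℝ, 0 ≤ C ∧ ∀ (q j : ℝ) (k : Fin m → ℝ), 1 ≤ q →
      ((j = 0 ∧ 1 ≤ ‖k‖) ∨ (1 ≤ j ∧ j⁻¹ • k ∉ V)) →
      ‖∫ x, (w x : ℂ) * oscExp (2 * Real.pi * q) (fun x => j * f x - ∑ i, x i * k i) x‖ ≤
        C * (q * (j + ‖k‖))⁻¹ ^ (m + 1) := by
  have hK := h.isCompact_image_tsupport hw
  obtain ⟨B, hB⟩ := hK.isBounded.exists_norm_le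
  obtain ⟨c₀, hc₀, hthick⟩ := hK.exists_thickening_subset_open isOpen_interior hV
  have hdist : ∀ x ∈ tsupport w, ∀ y ∉ V, c₀ ≤ ‖gradv f x - y‖ := by
    intro x hx y hy
    by_contra! hlt
    refine hy (interior_subset (hthick ?_))
    exact Metric.mem_thickening_iff.2 ⟨_, ⟨x, hx, rfl⟩, by rwa [dist_comm, dist_eq_norm]⟩
  have hB' : ∀ x ∈ tsupport w, ‖gradv f x‖ ≤ |B| := fun x hx =>
    (hB _ ⟨x, hx, rfl⟩).trans (le_abs_self B)
  set c : ℝ := min (1 / 2) (c₀ / (2 * (1 + |B|))) with hcdef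
  have hc : 0 < c := by positivity
  have hc1 : c ≤ 1 / 2 := min_le_left _ _
  have hc2 : c * (1 + |B|) ≤ c₀ / 2 := by
    have : c ≤ c₀ / (2 * (1 + |B|)) := min_le_right _ _
    rw [le_div_iff₀ (by positivity)] at this
    linarith
  obtain ⟨C, hC, hb⟩ := h.exists_nonstationary_symbol hw hc
  refine ⟨C, hC, fun q j k hq hjk => ?_⟩
  have hj : 0 ≤ j := by rcases hjk with h | h <;> linarith [h.1]
  set S := j + ‖k‖ with hS
  have hS1 : 1 ≤ S := by
    rcases hjk with h | h
    · rw [hS]; linarith [h.1, h.2]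
    · linarith [h.1, norm_nonneg k]
  have hpi := Real.pi_gt_three
  have hqS : 1 ≤ q * S := one_le_mul_of_one_le_of_one_le hq hS1
  have hlam : 1 ≤ 2 * Real.pi * (q * S) := by nlinarith
  have key := hb (2 * Real.pi * (q * S)) (j / S) (S⁻¹ • k) hlam
    (by
      rw [abs_of_nonneg (by positivity), div_le_one (by linarith)]
      linarith [norm_nonneg k])
    (by
      rw [norm_smul, norm_inv, Real.norm_of_nonneg (by linarith), inv_mul_le_iff₀ (by linarith)]
      linarith)
    (fun x hx => by
      rcases hjk with ⟨h0, h1⟩ | ⟨h0, h1⟩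
      · have e : j / S = 0 := by rw [h0, zero_div]
        have e2 : S = ‖k‖ := by rw [hS, h0, zero_add]
        rw [e, zero_smul, zero_sub, norm_neg, norm_smul, norm_inv, e2, norm_norm,
          inv_mul_cancel₀ (by linarith)]
        linarith
      · have hj0 : 0 < j := by linarith
        have e : (j / S) • gradv f x - S⁻¹ • k = (j / S) • (gradv f x - j⁻¹ • k) := by
          rw [smul_sub, smul_smul]
          congr 2
          field_simp
        rw [e, norm_smul, Real.norm_of_nonneg (by positivity), div_mul_eq_mul_div,
          le_div_iff₀ (by linarith)]
        have h2 := hdist x hx _ h1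
        have h3 : ‖j⁻¹ • k‖ ≤ ‖gradv f x - j⁻¹ • k‖ + |B| := by
          have h4 := norm_sub_norm_le (j⁻¹ • k) (gradv f x)
          rw [norm_sub_rev] at h4
          linarith [hB' x hx]
        have h5 : S = j * (1 + ‖j⁻¹ • k‖) := by
          rw [norm_smul, norm_inv, Real.norm_of_nonneg hj, hS]
          field_simp
        rw [h5, mul_left_comm]
        refine mul_le_mul_of_nonneg_left ?_ hj
        nlinarith)
  refine le_trans (le_of_eq ?_) (key.trans ?_)
  · congr 2
    funext x
    congr 1
    simp only [oscExp]
    congr 3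
    simp only [Pi.smul_apply, smul_eq_mul, mul_left_comm _ S⁻¹, ← Finset.mul_sum]
    field_simp
  · refine mul_le_mul_of_nonneg_left (pow_le_pow_left₀ (by positivity) ?_ _) hC
    refine inv_anti₀ (by linarith) ?_
    nlinarith

end NonStationary

section Poisson

variable {m : ℕ}

/-- Integer points viewed in real space. -/
def intVec (a : Fin m → ℤ) : Fin m → ℝ := fun i => (a i : ℝ)

/-- The integer points of the cube `[-R, R]^m`. -/
noncomputable def intBox (m : ℕ) (R : ℕ) : Finset (Fin m → ℤ) :=
  Fintype.piFinset fun _ => Finset.Icc (-(R : ℤ)) R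

theorem lt_norm_of_notMem_intBox {R : ℕ} {a : Fin m → ℤ} (h : a ∉ intBox m R) :
    (R : ℝ) < ‖intVec a‖ := by
  simp only [intBox, Fintype.mem_piFinset, Finset.mem_Icc, not_forall] at h
  obtain ⟨i, hi⟩ := h
  have h1 : (R : ℤ) < |a i| := by
    rw [lt_abs]
    by_contra! h2
    exact hi ⟨by omega, by omega⟩
  calc (R : ℝ) < ((|a i| : ℤ) : ℝ) := by exact_mod_cast h1
    _ = ‖intVec a i‖ := by rw [Int.cast_abs, Real.norm_eq_abs]; rfl
    _ ≤ _ := norm_le_pi_norm _ i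

theorem mFourier_coe (k : Fin m → ℤ) (x : Fin m → ℝ) :
    UnitAddTorus.mFourier (-k) (fun i => (x i : UnitAddCircle)) =
      oscExp (2 * Real.pi) (fun x => -∑ i, x i * intVec k i) x := by
  simp only [UnitAddTorus.mFourier, ContinuousMap.coe_mk, oscExp, fourier_coe_apply, intVec]
  rw [← Complex.exp_sum]
  congr 1
  push_cast
  simp only [Pi.neg_apply, Int.cast_neg, div_one, mul_neg, neg_mul,
    Finset.mul_sum, Finset.sum_mul, Finset.sum_neg_distrib]
  congr 1
  exact Finset.sum_congr rfl fun i _ => by ring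

theorem oscExp_add_intVec (k a : Fin m → ℤ) (x : Fin m → ℝ) :
    oscExp (2 * Real.pi) (fun x => -∑ i, x i * intVec k i) (x + intVec a) =
      oscExp (2 * Real.pi) (fun x => -∑ i, x i * intVec k i) x := by
  rw [← mFourier_coe, ← mFourier_coe]
  congr 1
  funext i
  rw [Pi.add_apply, AddCircle.coe_add, intVec]
  have : ((a i : ℝ) : UnitAddCircle) = 0 := by
    rw [AddCircle.coe_eq_zero_iff]
    exact ⟨a i, by simp⟩
  rw [this, add_zero]

theorem integral_eq_sum_cube {H : (Fin m → ℝ) → ℂ} (hH : Integrable H) :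
    HasSum (fun a : Fin m → ℤ => ∫ x in {x : Fin m → ℝ | ∀ i, x i ∈ Set.Ioc (0 : ℝ) (0 + 1)},
      H (x + intVec a)) (∫ x, H x) := by
  set C : (Fin m → ℤ) → Set (Fin m → ℝ) := fun a =>
    {x | ∀ i, x i ∈ Set.Ioc (a i : ℝ) (a i + 1)} with hC
  have hCm : ∀ a, MeasurableSet (C a) := fun a => by
    have : C a = Set.univ.pi fun i => Set.Ioc (a i : ℝ) (a i + 1) := by
      ext x; simp [hC]
    rw [this]
    exact MeasurableSet.univ_pi fun i => measurableSet_Ioc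
  have hCd : Pairwise (Function.onFun Disjoint C) := by
    intro a b hab
    refine Set.disjoint_left.2 fun x hxa hxb => hab (funext fun i => ?_)
    have h1 := hxa i
    have h2 := hxb i
    have h3 : (a i : ℝ) < b i + 1 := h1.1.trans_le h2.2
    have h4 : (b i : ℝ) < a i + 1 := h2.1.trans_le h1.2
    have h3' : a i < b i + 1 := by exact_mod_cast h3
    have h4' : b i < a i + 1 := by exact_mod_cast h4
    omega
  have hCu : (⋃ a, C a) = Set.univ := by
    refine Set.eq_univ_of_forall fun x => Set.mem_iUnion.2 ⟨fun i => ⌈x i⌉ - 1, fun i => ?_⟩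
    push_cast
    exact ⟨by linarith [Int.ceil_lt_add_one (x i)], by linarith [Int.le_ceil (x i)]⟩
  have h1 := hasSum_integral_iUnion hCm hCd (f := H) (μ := volume) hH.integrableOn
  rw [hCu, setIntegral_univ] at h1
  refine h1.congr_fun fun a => ?_
  rw [← integral_indicator (hCm a), ← integral_indicator
    (by
      have : {x : Fin m → ℝ | ∀ i, x i ∈ Set.Ioc (0 : ℝ) (0 + 1)} = C 0 := by
        ext x; simp [hC]
      rw [this]
      exact hCm 0), ← integral_add_right_eq_self ((C a).indicator fun x => H x) (intVec a)]
  congr 1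
  funext x
  have : x + intVec a ∈ C a ↔ x ∈ {x : Fin m → ℝ | ∀ i, x i ∈ Set.Ioc (0 : ℝ) (0 + 1)} := by
    simp only [hC, Set.mem_ofPred_eq, Pi.add_apply, intVec, Set.mem_Ioc]
    refine forall_congr' fun i => ?_
    constructor <;> rintro ⟨h1, h2⟩ <;> exact ⟨by linarith, by linarith⟩
  by_cases hx : x ∈ {x : Fin m → ℝ | ∀ i, x i ∈ Set.Ioc (0 : ℝ) (0 + 1)}
  · rw [Set.indicator_of_mem hx, Set.indicator_of_mem (this.2 hx)]
  · rw [Set.indicator_of_notMem hx, Set.indicator_of_notMem (mt this.1 hx)]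

/-- Poisson summation on `ℤ^m` for continuous functions of bounded support. -/
theorem sum_intBox_eq_tsum_fourier {F : (Fin m → ℝ) → ℂ} (hF : Continuous F) {M : ℕ}
    (hM : ∀ x, (M : ℝ) < ‖x‖ → F x = 0)
    (hs : Summable fun k : Fin m → ℤ =>
      ∫ x, F x * oscExp (2 * Real.pi) (fun x => -∑ i, x i * intVec k i) x) :
    ∑ a ∈ intBox m M, F (intVec a) = ∑' k : Fin m → ℤ,
      ∫ x, F x * oscExp (2 * Real.pi) (fun x => -∑ i, x i * intVec k i) x := by
  have hFc : HasCompactSupport F := HasCompactSupport.intro (isCompact_closedBall 0 M)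
    fun x hx => hM x (by simpa [mem_closedBall_iff_norm] using hx)
  have hfin : ∀ (N : ℕ) (x : Fin m → ℝ), ‖x‖ ≤ N → ∀ a ∉ intBox m (M + N),
      F (x + intVec a) = 0 := by
    intro N x hx a ha
    refine hM _ ?_
    have h1 := lt_norm_of_notMem_intBox ha
    have h2 := norm_sub_le (x + intVec a) x
    rw [add_sub_cancel_left] at h2
    push_cast at h1
    linarith
  set p : (Fin m → ℝ) → ℂ := fun x => ∑' a : Fin m → ℤ, F (x + intVec a) with hp
  have hpN : ∀ (N : ℕ) (x : Fin m → ℝ), ‖x‖ ≤ N →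
      p x = ∑ a ∈ intBox m (M + N), F (x + intVec a) := fun N x hx =>
    tsum_eq_sum (hfin N x hx)
  have hpc : Continuous p := by
    rw [continuous_iff_continuousAt]
    intro x
    obtain ⟨N, hN⟩ := exists_nat_gt ‖x‖
    have h1 : p =ᶠ[nhds x] fun x => ∑ a ∈ intBox m (M + N), F (x + intVec a) := by
      have : ∀ᶠ y in nhds x, ‖y‖ < N := continuous_norm.continuousAt.eventually_lt_const hN
      filter_upwards [this] with y hy using hpN N y hy.le
    refine ContinuousAt.congr ?_ h1.symm
    exact (continuous_finsetSum _ fun a _ =>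
      hF.comp (continuous_id.add continuous_const)).continuousAt
  have hpp : ∀ x (b : Fin m → ℤ), p (x + intVec b) = p x := by
    intro x b
    simp only [hp]
    rw [← (Equiv.addLeft b).tsum_eq fun a => F (x + intVec a)]
    refine tsum_congr fun a => ?_
    congr 1
    funext i
    simp [intVec]
    ring
  let π : (Fin m → ℝ) → UnitAddTorus (Fin m) := Pi.map fun _ x => (x : UnitAddCircle)
  have hπ : IsOpenQuotientMap π := IsOpenQuotientMap.piMap fun _ =>
    QuotientAddGroup.isOpenQuotientMap_mk
  have hlift : ∀ x y, π x = π y → p x = p y := by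
    intro x y hxy
    have h1 : ∀ i, ∃ n : ℤ, x i - y i = n := fun i => by
      have h2 : ((x i : ℝ) : UnitAddCircle) = (y i : UnitAddCircle) := congrFun hxy i
      rw [← sub_eq_zero, ← AddCircle.coe_sub, AddCircle.coe_eq_zero_iff] at h2
      obtain ⟨n, hn⟩ := h2
      exact ⟨n, by simpa using hn.symm⟩
    choose n hn using h1
    have h3 : x = y + intVec n := by
      funext i
      have := hn i
      simp only [Pi.add_apply, intVec]
      linarith
    rw [h3, hpp]
  let π' : C((Fin m → ℝ), UnitAddTorus (Fin m)) := ⟨π, hπ.continuous⟩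
  have hq : Topology.IsQuotientMap π' := hπ.isQuotientMap
  have hlift' : Function.FactorsThrough (⟨p, hpc⟩ : C((Fin m → ℝ), ℂ)) π' :=
    fun x y hxy => hlift x y hxy
  let P : C(UnitAddTorus (Fin m), ℂ) := hq.lift ⟨p, hpc⟩ hlift'
  have hPπ : ∀ x, P (π x) = p x := fun x =>
    congrArg (fun f => f x) (hq.lift_comp ⟨p, hpc⟩ hlift')
  have hcoeff : ∀ k, UnitAddTorus.mFourierCoeff P k =
      ∫ x, F x * oscExp (2 * Real.pi) (fun x => -∑ i, x i * intVec k i) x := by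
    intro k
    have hoc : Continuous (oscExp (m := m) (2 * Real.pi) (fun x => -∑ i, x i * intVec k i)) := by
      unfold oscExp; fun_prop
    have hH : Integrable fun x =>
        F x * oscExp (2 * Real.pi) (fun x => -∑ i, x i * intVec k i) x :=
      (hF.mul hoc).integrable_of_hasCompactSupport hFc.mul_right
    rw [UnitAddTorus.mFourierCoeff_eq_integral P k 0, ← (integral_eq_sum_cube hH).tsum_eq]
    have hQm : MeasurableSet {x : Fin m → ℝ | ∀ i, x i ∈ Set.Ioc (0 : ℝ) (0 + 1)} := by
      have : {x : Fin m → ℝ | ∀ i, x i ∈ Set.Ioc (0 : ℝ) (0 + 1)} =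
          Set.univ.pi fun i => Set.Ioc (0 : ℝ) (0 + 1) := by
        ext x; simp
      rw [this]
      exact MeasurableSet.univ_pi fun i => measurableSet_Ioc
    have hQ1 : ∀ x ∈ {x : Fin m → ℝ | ∀ i, x i ∈ Set.Ioc (0 : ℝ) (0 + 1)}, ‖x‖ ≤ (1 : ℕ) := by
      intro x hx
      rw [Nat.cast_one]
      refine (pi_norm_le_iff_of_nonneg zero_le_one).2 fun i => ?_
      rw [Real.norm_eq_abs, abs_le]
      have := hx i
      exact ⟨by linarith [this.1], by linarith [this.2]⟩
    rw [tsum_eq_sum (s := intBox m (M + 1)), ← integral_finsetSum]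
    · refine setIntegral_congr_fun hQm fun x hx => ?_
      have e1 : P (fun i => (x i : UnitAddCircle)) = p x := hPπ x
      simp only [oscExp_add_intVec]
      rw [mFourier_coe, e1, hpN 1 x (hQ1 x hx), smul_eq_mul, Finset.mul_sum]
      exact Finset.sum_congr rfl fun a _ => mul_comm _ _
    · intro a _
      exact (hH.comp_add_right (intVec a)).integrableOn
    · intro a ha
      refine setIntegral_eq_zero_of_forall_eq_zero fun x hx => ?_
      rw [hfin 1 x (hQ1 x hx) a ha, zero_mul]
  have h1 := UnitAddTorus.hasSum_mFourier_series_apply_of_summable (f := P)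
    (by simpa only [← hcoeff] using hs) (π 0)
  rw [hPπ 0] at h1
  have h2 : p 0 = ∑ a ∈ intBox m M, F (intVec a) := by
    rw [hpN 0 0 (by simp)]
    simp
  rw [← h2, ← h1.tsum_eq]
  refine tsum_congr fun k => ?_
  have h3 : UnitAddTorus.mFourier k (π 0) = 1 := by
    have : π 0 = fun _ => 0 := by
      funext i
      rfl
    rw [this]
    simp [UnitAddTorus.mFourier]
  rw [h3, smul_eq_mul, mul_one, hcoeff]

end Poisson

section Turn

/-- The additive character `θ ↦ exp (2πiθ)` of `ℝ`. -/
noncomputable def turn (θ : ℝ) : ℂ := Complex.exp ((2 * Real.pi * θ : ℝ) * Complex.I)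

theorem norm_turn (θ : ℝ) : ‖turn θ‖ = 1 := Complex.norm_exp_ofReal_mul_I _

theorem turn_add (x y : ℝ) : turn (x + y) = turn x * turn y := by
  rw [turn, turn, turn, ← Complex.exp_add]
  congr 1
  push_cast
  ring

theorem turn_zero : turn 0 = 1 := by simp [turn]

theorem turn_neg (x : ℝ) : turn (-x) = (starRingEnd ℂ) (turn x) := by
  rw [turn, turn, ← Complex.exp_conj, map_mul, Complex.conj_ofReal, Complex.conj_I]
  congr 1
  push_cast
  ring

theorem turn_intCast (k : ℤ) : turn k = 1 := by
  rw [turn, Complex.exp_eq_one_iff]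
  exact ⟨k, by push_cast; ring⟩

theorem continuous_turn : Continuous turn := by
  unfold turn
  fun_prop

theorem nint_eq_norm (θ : ℝ) : nint θ = ‖(θ : UnitAddCircle)‖ := (UnitAddCircle.norm_eq).symm

theorem nint_nonneg (θ : ℝ) : 0 ≤ nint θ := abs_nonneg _

theorem nint_le_half (θ : ℝ) : nint θ ≤ 1 / 2 := abs_sub_round θ

theorem nint_neg (θ : ℝ) : nint (-θ) = nint θ := by
  rw [nint_eq_norm, nint_eq_norm, AddCircle.coe_neg, norm_neg]

theorem nint_le_abs (x : ℝ) : nint x ≤ |x| := by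
  have := round_le x 0
  simpa [nint] using this

theorem nint_eq_self {x : ℝ} (h0 : 0 ≤ x) (h : x ≤ 1 / 2) : nint x = x := by
  rw [nint_eq_norm, (AddCircle.norm_coe_eq_abs_iff 1 one_ne_zero).2, abs_of_nonneg h0]
  rwa [abs_one, abs_of_nonneg h0]

theorem four_mul_nint_le_norm_turn_sub_one (θ : ℝ) : 4 * nint θ ≤ ‖turn θ - 1‖ := by
  have h1 : turn θ = turn (θ - round θ) := by
    conv_lhs => rw [show θ = (θ - round θ) + (round θ : ℤ) by ring, turn_add, turn_intCast, mul_one]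
  have h2 : ‖turn θ - 1‖ = 2 * |Real.sin (Real.pi * (θ - round θ))| := by
    rw [h1, turn, mul_comm, Complex.norm_exp_I_mul_ofReal_sub_one, norm_mul, Real.norm_eq_abs,
      Real.norm_eq_abs, abs_two]
    congr 3
    ring
  have h3 : |Real.pi * (θ - round θ)| = Real.pi * nint θ := by
    rw [abs_mul, abs_of_pos Real.pi_pos, nint]
  have h4 := Real.mul_abs_le_abs_sin (x := Real.pi * (θ - round θ))
    (by rw [h3]; nlinarith [nint_le_half θ, Real.pi_pos])
  rw [h3, ← mul_assoc, div_mul_cancel₀ _ Real.pi_ne_zero] at h4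
  linarith

theorem nint_mul_norm_sum_turn_le (α : ℝ) (n : ℕ) :
    nint α * ‖∑ q ∈ Finset.range n, turn (q * α)‖ ≤ 1 := by
  have h1 : ∀ n : ℕ, (turn α - 1) * ∑ q ∈ Finset.range n, turn (q * α) = turn (n * α) - 1 := by
    intro n
    induction n with
    | zero => simp [turn_zero]
    | succ n ih =>
      rw [Finset.sum_range_succ, mul_add, ih]
      push_cast
      rw [add_mul, one_mul, turn_add]
      ring
  have h2 : ‖turn α - 1‖ * ‖∑ q ∈ Finset.range n, turn (q * α)‖ ≤ 2 := by
    rw [← norm_mul, h1]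
    exact (norm_sub_le _ _).trans (by rw [norm_turn, norm_one]; norm_num)
  have h3 := mul_le_mul_of_nonneg_right (four_mul_nint_le_norm_turn_sub_one α)
    (norm_nonneg (∑ q ∈ Finset.range n, turn (q * α)))
  linarith

/-- The truncated reciprocal `min (Q, 1 / ‖α‖)`. -/
noncomputable def kern (Q α : ℝ) : ℝ := (max Q⁻¹ (nint α))⁻¹

theorem kern_nonneg (Q α : ℝ) : 0 ≤ kern Q α :=
  inv_nonneg.2 ((nint_nonneg α).trans (le_max_right _ _))

theorem kern_neg (Q α : ℝ) : kern Q (-α) = kern Q α := by rw [kern, kern, nint_neg]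

theorem norm_sum_range_turn_le_kern {Q : ℝ} (hQ : 0 < Q) (α : ℝ) {n : ℕ} (hn : n ≤ Q) :
    ‖∑ q ∈ Finset.range n, turn (q * α)‖ ≤ kern Q α := by
  have h0 : 0 < max Q⁻¹ (nint α) := lt_max_of_lt_left (inv_pos.2 hQ)
  have h1 : ‖∑ q ∈ Finset.range n, turn (q * α)‖ ≤ Q := by
    refine (norm_sum_le _ _).trans ?_
    simpa [norm_turn] using hn
  rw [kern, ← one_div, le_div_iff₀ h0]
  rcases max_choice Q⁻¹ (nint α) with h | h
  · rw [h]
    exact mul_inv_le_one_of_le₀ h1 hQ.le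
  · rw [h, mul_comm]
    exact nint_mul_norm_sum_turn_le α n

theorem norm_sum_Icc_turn_le_kern {Q : ℝ} (hQ : 0 < Q) (α : ℝ) {n : ℕ} (hn : n ≤ Q) :
    ‖∑ q ∈ Finset.Icc 1 n, turn (q * α)‖ ≤ kern Q α := by
  have h1 : ∑ q ∈ Finset.Icc 1 n, turn (q * α) = turn α * ∑ q ∈ Finset.range n, turn (q * α) := by
    rw [Finset.range_eq_Ico, Finset.mul_sum, ← Finset.Ico_add_one_right_eq_Icc,
      ← Finset.sum_Ico_add' (fun q : ℕ => turn (q * α)) 0 n 1]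
    refine Finset.sum_congr (by simp) fun q _ => ?_
    rw [← turn_add]
    congr 1
    push_cast
    ring
  rw [h1, norm_mul, norm_turn, one_mul]
  exact norm_sum_range_turn_le_kern hQ α hn

theorem norm_sum_mul_le_of_norm_sum_le {E : Type*} [NormedRing E] {u h : ℕ → E} {B : ℝ} {Q : ℕ}
    (hQ : 1 ≤ Q) (hB : ∀ n ≤ Q, ‖∑ q ∈ Finset.Icc 1 n, u q‖ ≤ B) :
    ‖∑ q ∈ Finset.Icc 1 Q, u q * h q‖ ≤
      B * (‖h Q‖ + ∑ q ∈ Finset.Ico 1 Q, ‖h (q + 1) - h q‖) := by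
  have h1 : ∑ q ∈ Finset.Icc 1 Q, u q * h q = (∑ q ∈ Finset.Icc 1 Q, u q) * h Q -
      ∑ q ∈ Finset.Ico 1 Q, (∑ p ∈ Finset.Icc 1 q, u p) * (h (q + 1) - h q) := by
    clear hB
    induction Q, hQ using Nat.le_induction with
    | base => simp
    | succ Q hQ ih =>
      rw [Finset.sum_Icc_succ_top (by omega), Finset.sum_Icc_succ_top (by omega), ih,
        Finset.sum_Ico_succ_top hQ]
      noncomm_ring
  rw [h1, mul_add, Finset.mul_sum]
  refine (norm_sub_le _ _).trans (add_le_add ?_ ((norm_sum_le _ _).trans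
    (Finset.sum_le_sum fun q hq => ?_)))
  · exact (norm_mul_le _ _).trans (mul_le_mul_of_nonneg_right (hB Q le_rfl) (norm_nonneg _))
  · exact (norm_mul_le _ _).trans (mul_le_mul_of_nonneg_right
      (hB q (Finset.mem_Ico.1 hq).2.le) (norm_nonneg _))

end Turn

section LatticeSum

variable {m : ℕ}

theorem summable_one_add_norm_intVec (m : ℕ) :
    Summable fun k : Fin m → ℤ => (1 + ‖intVec k‖)⁻¹ ^ (m + 1) := by
  have hi : Integrable fun x : Fin m → ℝ => (1 + ‖x‖)⁻¹ ^ (m + 1) := by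
    have := integrable_one_add_norm (E := Fin m → ℝ) (μ := volume) (r := (m + 1 : ℕ)) (by
      rw [Module.finrank_fin_fun]; push_cast; linarith)
    refine this.congr (Filter.Eventually.of_forall fun x => ?_)
    simp only
    rw [Real.rpow_neg (by positivity), Real.rpow_natCast, inv_pow]
  set S : Set (Fin m → ℝ) := {x | ∀ i, x i ∈ Set.Ioc (0 : ℝ) (0 + 1)} with hS
  have hSpi : S = Set.univ.pi fun _ => Set.Ioc (0 : ℝ) 1 := by ext x; simp [hS]
  have hSm : MeasurableSet S := hSpi ▸ MeasurableSet.univ_pi fun i => measurableSet_Ioc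
  have hSv : volume S = 1 := by rw [hSpi, volume_pi_pi]; simp
  have h1 := (integral_eq_sum_cube hi.ofReal (H := fun x => (((1 + ‖x‖)⁻¹ ^ (m + 1) : ℝ) : ℂ))).summable.norm
  refine Summable.of_nonneg_of_le (fun k => by positivity) (fun k => ?_) (h1.mul_left (2 ^ (m + 1)))
  rw [integral_complex_ofReal, Complex.norm_real]
  have hi' : IntegrableOn (fun x => (1 + ‖x + intVec k‖)⁻¹ ^ (m + 1)) S :=
    (hi.comp_add_right (intVec k)).integrableOn
  have h2 : (2 * (1 + ‖intVec k‖))⁻¹ ^ (m + 1) ≤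
      ∫ x in S, (1 + ‖x + intVec k‖)⁻¹ ^ (m + 1) := by
    have h3 : ∫ x in S, (2 * (1 + ‖intVec k‖))⁻¹ ^ (m + 1) ≤
        ∫ x in S, (1 + ‖x + intVec k‖)⁻¹ ^ (m + 1) := by
      refine setIntegral_mono_on (integrableOn_const (by simp [hSv])) hi' hSm fun x hx => ?_
      have h4 : ‖x‖ ≤ 1 := (pi_norm_le_iff_of_nonneg zero_le_one).2 fun i => by
        have := hx i
        rw [Real.norm_of_nonneg this.1.le]
        simpa using this.2
      have h5 := norm_add_le x (intVec k)
      gcongr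
      linarith [norm_nonneg (intVec k)]
    simpa [Measure.real, hSv] using h3
  rw [mul_inv, mul_pow, inv_pow] at h2
  calc (1 + ‖intVec k‖)⁻¹ ^ (m + 1)
      = 2 ^ (m + 1) * ((2 ^ (m + 1))⁻¹ * (1 + ‖intVec k‖)⁻¹ ^ (m + 1)) := by field_simp
    _ ≤ _ := mul_le_mul_of_nonneg_left (h2.trans (le_abs_self _)) (by positivity)

theorem card_intBox_le (R : ℕ) {j : ℕ} (hj : 1 ≤ j) :
    ((intBox m (R * j)).card : ℝ) ≤ (2 * R + 1) ^ m * (j : ℝ) ^ m := by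
  rw [intBox, Fintype.card_piFinset, Finset.prod_const, Finset.card_univ, Fintype.card_fin,
    Int.card_Icc, Nat.cast_pow, ← mul_pow]
  have h1 : (((R * j : ℕ) : ℤ) + 1 - -((R * j : ℕ) : ℤ)).toNat = 2 * (R * j) + 1 := by omega
  rw [h1]
  have h2 : (1 : ℝ) ≤ j := by exact_mod_cast hj
  gcongr
  push_cast
  nlinarith

end LatticeSum

section WeylSums

variable {m : ℕ}

/-- The exponential integral arising from Poisson summation of a Weyl sum. -/
noncomputable def oscCoef (f w : (Fin m → ℝ) → ℝ) (q j : ℝ) (k : Fin m → ℝ) : ℂ :=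
  ∫ x, (w x : ℂ) * oscExp (2 * Real.pi * q) (fun x => j * f x - ∑ i, x i * k i) x

/-- The weighted exponential sum over the rational points of denominator `q` in `[-R, R]^m`. -/
noncomputable def weylSum (f w : (Fin m → ℝ) → ℝ) (R : ℕ) (j : ℝ) (q : ℕ) : ℂ :=
  ∑ a ∈ intBox m (R * q), (w ((q : ℝ)⁻¹ • intVec a) : ℂ) * turn (j * (q * f ((q : ℝ)⁻¹ • intVec a)))

variable {D D' : Set (Fin m → ℝ)} {f f' w : (Fin m → ℝ) → ℝ}

theorem IsLegendrePair.continuous_weight_mul_oscExp (h : IsLegendrePair D f D' f')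
    (hw : IsWeight D w) (lam j : ℝ) :
    Continuous fun x => (w x : ℂ) * oscExp lam (fun x => j * f x) x := by
  have h0 : ContDiff ℝ (0 : ℕ) fun x => (w x : ℂ) * oscExp lam (fun x => j * f x) x := by
    refine contDiff_of_contDiffOn_tsupport h.isOpen (K := tsupport w) ?_ (isClosed_tsupport w)
      hw.subset fun x hx => by simp [image_eq_zero_of_notMem_tsupport hx]
    refine contDiffOn_zero.2 (ContinuousOn.mul ?_ ?_)
    · exact (Complex.continuous_ofReal.comp hw.contDiff.continuous).continuousOn
    · unfold oscExp
      have := h.contDiffOn.continuousOn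
      fun_prop
  exact h0.continuous

theorem IsLegendrePair.weylSum_eq (h : IsLegendrePair D f D' f') (hw : IsWeight D w) {R : ℕ}
    (hR : ∀ x, (R : ℝ) < ‖x‖ → w x = 0) (j : ℝ) {q : ℕ} (hq : 1 ≤ q)
    (hs : Summable fun k : Fin m → ℤ => oscCoef f w q j (intVec k)) :
    weylSum f w R j q = (q : ℂ) ^ m * ∑' k : Fin m → ℤ, oscCoef f w q j (intVec k) := by
  have hq0 : (0 : ℝ) < q := by exact_mod_cast hq
  set G : (Fin m → ℝ) → ℂ := fun x => (w x : ℂ) * oscExp (2 * Real.pi * q) (fun x => j * f x) x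
    with hG
  have hI : ∀ k : Fin m → ℤ, ∫ x, G ((q : ℝ)⁻¹ • x) *
      oscExp (2 * Real.pi) (fun x => -∑ i, x i * intVec k i) x =
      (q : ℂ) ^ m * oscCoef f w q j (intVec k) := by
    intro k
    have h1 := Measure.integral_comp_inv_smul_of_nonneg (volume : Measure (Fin m → ℝ))
      (fun x => (w x : ℂ) * oscExp (2 * Real.pi * q) (fun x => j * f x - ∑ i, x i * intVec k i) x)
      hq0.le
    rw [Module.finrank_fin_fun, Complex.real_smul] at h1
    rw [oscCoef, ← Complex.ofReal_natCast, ← Complex.ofReal_pow, ← h1]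
    congr 1
    funext x
    rw [hG]
    simp only
    rw [mul_assoc]
    congr 1
    simp only [oscExp]
    rw [← Complex.exp_add]
    congr 1
    rw [← add_mul, ← Complex.ofReal_add]
    congr 2
    have : ∑ i, ((q : ℝ)⁻¹ • x) i * intVec k i = (q : ℝ)⁻¹ * ∑ i, x i * intVec k i := by
      rw [Finset.mul_sum]
      exact Finset.sum_congr rfl fun i _ => by simp [mul_assoc]
    rw [this]
    field_simp
    ring
  have h2 := sum_intBox_eq_tsum_fourier (F := fun x => G ((q : ℝ)⁻¹ • x)) (M := R * q)
    ((h.continuous_weight_mul_oscExp hw _ j).comp (continuous_const_smul _)) (fun x hx => by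
      have : (R : ℝ) < ‖(q : ℝ)⁻¹ • x‖ := by
        rw [norm_smul, norm_inv, Real.norm_natCast, ← div_eq_inv_mul, lt_div_iff₀ hq0]
        exact_mod_cast hx
      simp [hG, hR _ this]) (by simp only [hI]; exact hs.mul_left _)
  simp only [hI, tsum_mul_left] at h2
  rw [← h2, weylSum]
  refine Finset.sum_congr rfl fun a _ => ?_
  simp only [hG, oscExp, turn]
  congr 4
  ring

theorem IsLegendrePair.norm_weylSum_sub_le (h : IsLegendrePair D f D' f') (hw : IsWeight D w)
    {R : ℕ} (hR : ∀ x, (R : ℝ) < ‖x‖ → w x = 0) {j : ℝ} {q : ℕ} (hq : 1 ≤ q)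
    {S : Finset (Fin m → ℤ)} {C : ℝ} (hC : 0 ≤ C)
    (hS : ∀ k ∉ S, ‖oscCoef f w q j (intVec k)‖ ≤ C * (q * (j + ‖intVec k‖))⁻¹ ^ (m + 1))
    (hS' : ∀ k ∉ S, 1 + ‖intVec k‖ ≤ 2 * (j + ‖intVec k‖)) :
    ‖weylSum f w R j q - (q : ℂ) ^ m * ∑ k ∈ S, oscCoef f w q j (intVec k)‖ ≤
      C * 2 ^ (m + 1) * ∑' k : Fin m → ℤ, (1 + ‖intVec k‖)⁻¹ ^ (m + 1) := by
  have hq1 : (1 : ℝ) ≤ q := by exact_mod_cast hq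
  set g : (Fin m → ℤ) → ℝ := fun k => C * 2 ^ (m + 1) * (1 + ‖intVec k‖)⁻¹ ^ (m + 1) with hg
  have hgs : Summable g := (summable_one_add_norm_intVec m).mul_left _
  have hb : ∀ k ∉ S, (q : ℝ) ^ m * ‖oscCoef f w q j (intVec k)‖ ≤ g k := by
    intro k hk
    have h1 : (j + ‖intVec k‖)⁻¹ ≤ 2 * (1 + ‖intVec k‖)⁻¹ := by
      rw [← div_eq_mul_inv, le_div_iff₀ (by positivity), mul_comm, ← div_eq_mul_inv, div_le_iff₀]
      · exact hS' k hk
      · linarith [hS' k hk, norm_nonneg (intVec k)]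
    have h0 : 0 ≤ (j + ‖intVec k‖)⁻¹ := by
      have := hS' k hk
      have := norm_nonneg (intVec k)
      exact inv_nonneg.2 (by linarith)
    calc (q : ℝ) ^ m * ‖oscCoef f w q j (intVec k)‖
        ≤ q ^ m * (C * (q * (j + ‖intVec k‖))⁻¹ ^ (m + 1)) := by gcongr; exact hS k hk
      _ = C * (j + ‖intVec k‖)⁻¹ ^ (m + 1) * (q : ℝ)⁻¹ := by
        rw [mul_inv, mul_pow, inv_pow (q : ℝ), pow_succ (q : ℝ)]
        field_simp
      _ ≤ C * (2 * (1 + ‖intVec k‖)⁻¹) ^ (m + 1) * 1 := by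
        gcongr
        exact inv_le_one_of_one_le₀ hq1
      _ = g k := by rw [hg, mul_pow]; ring
  have hs : Summable fun k : Fin m → ℤ => oscCoef f w q j (intVec k) := by
    rw [← S.summable_compl_iff]
    refine Summable.of_norm_bounded (hgs.subtype _) fun k => ?_
    refine le_trans ?_ (hb k k.2)
    exact le_mul_of_one_le_left (norm_nonneg _) (one_le_pow₀ hq1)
  rw [h.weylSum_eq hw hR j hq hs, ← hs.sum_add_tsum_compl (s := S), mul_add, add_sub_cancel_left,
    norm_mul, norm_pow, Complex.norm_natCast, ← tsum_mul_left]
  have hsn : Summable fun k : ((S : Set (Fin m → ℤ))ᶜ : Set _) =>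
      ‖oscCoef f w q j (intVec k)‖ := hs.norm.subtype _
  refine (mul_le_mul_of_nonneg_left (norm_tsum_le_tsum_norm hsn) (by positivity)).trans ?_
  rw [← tsum_mul_left]
  refine (Summable.tsum_le_tsum (fun k : ((S : Set (Fin m → ℤ))ᶜ : Set _) => hb k k.2)
    (hsn.mul_left _) (hgs.subtype _)).trans ?_
  exact hgs.tsum_subtype_le _ _ (fun k => by positivity)

theorem IsLegendrePair.exists_norm_weylSum_zero_sub_le (h : IsLegendrePair D f D' f')
    (hw : IsWeight D w) {R : ℕ} (hR : ∀ x, (R : ℝ) < ‖x‖ → w x = 0) :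
    ∃ C : ℝ, 0 ≤ C ∧ ∀ q : ℕ, 1 ≤ q → ‖weylSum f w R 0 q - (q : ℂ) ^ m * ∫ x, (w x : ℂ)‖ ≤ C := by
  obtain ⟨V, hV, hKV, hVD⟩ := exists_compact_between (h.isCompact_image_tsupport hw) h.isOpen'
    (h.image_tsupport_subset hw)
  obtain ⟨C, hC, hb⟩ := h.exists_nonstationary hw hKV
  refine ⟨C * 2 ^ (m + 1) * ∑' k : Fin m → ℤ, (1 + ‖intVec k‖)⁻¹ ^ (m + 1), by positivity,
    fun q hq => ?_⟩
  have h1 : ∀ k ∉ ({0} : Finset (Fin m → ℤ)), 1 ≤ ‖intVec k‖ := by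
    intro k hk
    have h2 : k ∉ intBox m 0 := by
      intro hk'
      refine hk (Finset.mem_singleton.2 (funext fun i => ?_))
      have := Fintype.mem_piFinset.1 hk' i
      simpa using this
    by_contra! h3
    refine hk (Finset.mem_singleton.2 (funext fun i => ?_))
    have h4 := (norm_le_pi_norm (intVec k) i).trans_lt h3
    rw [intVec, Real.norm_eq_abs] at h4
    have : |k i| < 1 := by exact_mod_cast h4
    simpa using Int.abs_lt_one_iff.1 this
  have h2 := h.norm_weylSum_sub_le hw hR (j := 0) hq (S := {0}) hC
    (fun k hk => hb q 0 (intVec k) (by exact_mod_cast hq) (Or.inl ⟨rfl, h1 k hk⟩))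
    (fun k hk => by linarith [h1 k hk])
  convert h2 using 4
  rw [Finset.sum_singleton, oscCoef]
  congr 1
  funext x
  simp [oscExp, intVec]

end WeylSums

section VanDerCorput

variable {m : ℕ}

/-- The weighted sum of `min (Q, 1 / ‖j f(a / j)‖)` over the rational points `a / j` in
`[-R, R]^m`. -/
noncomputable def kernSum (f w : (Fin m → ℝ) → ℝ) (R j : ℕ) (Q : ℝ) : ℝ :=
  ∑ a ∈ intBox m (R * j), |w ((j : ℝ)⁻¹ • intVec a)| * kern Q (j * f ((j : ℝ)⁻¹ • intVec a))

theorem inv_sqrt_two_pi_mul_le {q j : ℝ} (hq : 0 < q) (hj : 0 < j) (r : ℕ) :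
    (√(2 * Real.pi * q * j))⁻¹ ^ r ≤ (√q)⁻¹ ^ r * (√j)⁻¹ ^ r := by
  rw [← mul_pow, ← mul_inv, ← Real.sqrt_mul hq.le]
  have := Real.two_le_pi
  gcongr
  nlinarith [mul_pos hq hj]

theorem one_le_two_pi_mul {q j : ℝ} (hq : 1 ≤ q) (hj : 1 ≤ j) : 1 ≤ 2 * Real.pi * q * j := by
  have := Real.two_le_pi
  have : 1 ≤ q * j := one_le_mul_of_one_le_of_one_le hq hj
  nlinarith

theorem norm_sum_turn_mul_le {p : ℕ} {F : ℝ → ℂ} {C : ℝ} (hC : 0 ≤ C)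
    (h1 : ∀ lam : ℝ, 1 ≤ lam → ‖F lam‖ ≤ C * (√lam)⁻¹ ^ (p + 2))
    (h2 : ∀ lam mu : ℝ, 1 ≤ lam → lam ≤ mu →
      ‖F mu - F lam‖ ≤ C * (√lam)⁻¹ ^ (p + 2 + 2) * (mu - lam))
    (α : ℝ) {j Q : ℕ} (hj : 1 ≤ j) (hQ : 1 ≤ Q) :
    ‖∑ q ∈ Finset.Icc 1 Q, turn (q * α) * ((q : ℂ) ^ (p + 2) * F (2 * Real.pi * q * j))‖ ≤
      C * (p + 3 + 2 * Real.pi) * (√Q ^ (p + 2) * (√j)⁻¹ ^ (p + 2)) * kern Q α := by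
  have hj1 : (1 : ℝ) ≤ j := by exact_mod_cast hj
  have hQ1 : (1 : ℝ) ≤ Q := by exact_mod_cast hQ
  have hπ := Real.pi_pos
  set t := √(j : ℝ) with ht
  have ht0 : 0 < t := Real.sqrt_pos.2 (by linarith)
  have htt : (j : ℝ) = t ^ 2 := (Real.sq_sqrt (by linarith)).symm
  have hF : ∀ q : ℕ, 1 ≤ q → ‖F (2 * Real.pi * q * j)‖ ≤ C * ((√q)⁻¹ ^ (p + 2) * t⁻¹ ^ (p + 2)) := by
    intro q hq
    have hq1 : (1 : ℝ) ≤ q := by exact_mod_cast hq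
    exact (h1 _ (one_le_two_pi_mul hq1 hj1)).trans (mul_le_mul_of_nonneg_left
      (inv_sqrt_two_pi_mul_le (by linarith) (by linarith) _) hC)
  set h : ℕ → ℂ := fun q => (q : ℂ) ^ (p + 2) * F (2 * Real.pi * q * j) with hh
  have b1 : ‖h Q‖ ≤ C * (√Q ^ (p + 2) * t⁻¹ ^ (p + 2)) := by
    rw [hh, norm_mul, norm_pow, Complex.norm_natCast]
    have hs : 0 < √(Q : ℝ) := Real.sqrt_pos.2 (by linarith)
    calc (Q : ℝ) ^ (p + 2) * ‖F (2 * Real.pi * Q * j)‖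
        ≤ (√Q ^ 2) ^ (p + 2) * (C * ((√Q)⁻¹ ^ (p + 2) * t⁻¹ ^ (p + 2))) := by
          rw [Real.sq_sqrt (by linarith)]
          exact mul_le_mul_of_nonneg_left (hF Q hQ) (by positivity)
      _ = _ := by
        rw [← pow_mul, two_mul, pow_add, inv_pow (√(Q : ℝ))]
        field_simp
  have b2 : ∀ q ∈ Finset.Ico 1 Q, ‖h (q + 1) - h q‖ ≤
      C * (p + 2 + 2 * Real.pi) * (√Q ^ p * t⁻¹ ^ (p + 2)) := by
    intro q hq
    rw [Finset.mem_Ico] at hq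
    have hq1 : (1 : ℝ) ≤ q := by exact_mod_cast hq.1
    have hqQ : (q : ℝ) + 1 ≤ Q := by exact_mod_cast hq.2
    have e : h (q + 1) - h q = (((q + 1 : ℝ) ^ (p + 2) - (q : ℝ) ^ (p + 2) : ℝ) : ℂ) *
        F (2 * Real.pi * (q + 1 : ℕ) * j) + (q : ℂ) ^ (p + 2) *
        (F (2 * Real.pi * (q + 1 : ℕ) * j) - F (2 * Real.pi * q * j)) := by
      simp only [hh]
      push_cast
      ring
    set s := √(q : ℝ) with hs
    set s' := √((q : ℝ) + 1) with hs'
    have hs0 : 0 < s := Real.sqrt_pos.2 (by linarith)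
    have hs0' : 0 < s' := Real.sqrt_pos.2 (by linarith)
    have hss : (q : ℝ) = s ^ 2 := (Real.sq_sqrt (by linarith)).symm
    have hss' : (q : ℝ) + 1 = s' ^ 2 := (Real.sq_sqrt (by linarith)).symm
    have hsQ : s ≤ √Q := Real.sqrt_le_sqrt (by linarith)
    have hsQ' : s' ≤ √Q := Real.sqrt_le_sqrt hqQ
    have c1 : |(q + 1 : ℝ) ^ (p + 2) - (q : ℝ) ^ (p + 2)| ≤ (p + 2) * (s' ^ 2) ^ (p + 1) := by
      have := abs_pow_sub_pow_le (q + 1 : ℝ) (q : ℝ) (p + 2)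
      rw [add_sub_cancel_left, abs_one, one_mul, abs_of_nonneg (by linarith : (0 : ℝ) ≤ q + 1),
        abs_of_nonneg (by linarith : (0 : ℝ) ≤ q), max_eq_left (by linarith)] at this
      rw [← hss']
      simpa using this
    have c2 := hF (q + 1) (by omega)
    push_cast at c2
    have c3 : ‖F (2 * Real.pi * (q + 1 : ℕ) * j) - F (2 * Real.pi * q * j)‖ ≤
        C * (s⁻¹ ^ (p + 2 + 2) * t⁻¹ ^ (p + 2 + 2)) * (2 * Real.pi * t ^ 2) := by
      have c4 := h2 (2 * Real.pi * q * j) (2 * Real.pi * (q + 1 : ℕ) * j)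
        (one_le_two_pi_mul hq1 hj1) (by push_cast; gcongr; linarith)
      have c5 : 2 * Real.pi * (q + 1 : ℕ) * j - 2 * Real.pi * q * j = 2 * Real.pi * t ^ 2 := by
        rw [← htt]; push_cast; ring
      rw [c5] at c4
      refine c4.trans ?_
      gcongr
      exact inv_sqrt_two_pi_mul_le (by linarith) (by linarith) _
    rw [e]
    refine (norm_add_le _ _).trans ?_
    rw [norm_mul, norm_mul, norm_pow, Complex.norm_real, Complex.norm_natCast, Real.norm_eq_abs]
    have d1 : |(q + 1 : ℝ) ^ (p + 2) - (q : ℝ) ^ (p + 2)| * ‖F (2 * Real.pi * (q + 1 : ℕ) * j)‖ ≤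
        C * (p + 2) * (√Q ^ p * t⁻¹ ^ (p + 2)) := by
      calc _ ≤ ((p + 2) * (s' ^ 2) ^ (p + 1)) * (C * (s'⁻¹ ^ (p + 2) * t⁻¹ ^ (p + 2))) := by
            refine mul_le_mul c1 ?_ (norm_nonneg _) (by positivity)
            push_cast
            exact c2
        _ = C * (p + 2) * (s' ^ p * t⁻¹ ^ (p + 2)) := by
            rw [inv_pow s', ← pow_mul, show 2 * (p + 1) = p + (p + 2) by ring, pow_add s']
            field_simp
        _ ≤ _ := by gcongr
    have d2 : (q : ℝ) ^ (p + 2) *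
        ‖F (2 * Real.pi * (q + 1 : ℕ) * j) - F (2 * Real.pi * q * j)‖ ≤
        C * (2 * Real.pi) * (√Q ^ p * t⁻¹ ^ (p + 2)) := by
      calc _ ≤ (s ^ 2) ^ (p + 2) *
            (C * (s⁻¹ ^ (p + 2 + 2) * t⁻¹ ^ (p + 2 + 2)) * (2 * Real.pi * t ^ 2)) := by
            rw [← hss]
            exact mul_le_mul_of_nonneg_left c3 (by positivity)
        _ = C * (2 * Real.pi) * (s ^ p * t⁻¹ ^ (p + 2)) := by
            rw [inv_pow s, ← pow_mul, show 2 * (p + 2) = p + (p + 2 + 2) by ring, pow_add s,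
              pow_add t⁻¹ (p + 2) 2, inv_pow t 2]
            field_simp
        _ ≤ _ := by gcongr
    linarith
  have hcard : (Finset.Ico 1 Q).card • (C * (p + 2 + 2 * Real.pi) * (√Q ^ p * t⁻¹ ^ (p + 2))) ≤
      C * (p + 2 + 2 * Real.pi) * (√Q ^ (p + 2) * t⁻¹ ^ (p + 2)) := by
    rw [nsmul_eq_mul, Nat.card_Ico, pow_add (√(Q : ℝ)), Real.sq_sqrt (by linarith)]
    have : ((Q - 1 : ℕ) : ℝ) ≤ Q := by exact_mod_cast Nat.sub_le _ _
    calc _ ≤ (Q : ℝ) * (C * (p + 2 + 2 * Real.pi) * (√Q ^ p * t⁻¹ ^ (p + 2))) := by gcongr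
      _ = _ := by ring
  refine (norm_sum_mul_le_of_norm_sum_le (B := kern Q α) hQ fun n hn =>
    norm_sum_Icc_turn_le_kern (by linarith) α (by exact_mod_cast hn)).trans ?_
  rw [mul_comm]
  refine mul_le_mul_of_nonneg_right ?_ (kern_nonneg _ _)
  have := (Finset.sum_le_card_nsmul _ _ _ b2).trans hcard
  linarith

variable {D D' : Set (Fin m → ℝ)} {f f' w : (Fin m → ℝ) → ℝ}

theorem IsLegendrePair.integrable_weight_mul_legPhase (h : IsLegendrePair D f D' f')
    (hw : IsWeight D w) (lam : ℝ) (y : Fin m → ℝ) :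
    Integrable fun x => (w x : ℂ) * oscExp lam (legPhase f f' y) x := by
  have h1 : Continuous fun x => (w x : ℂ) * oscExp lam (legPhase f f' y) x := by
    have h2 := h.continuous_weight_mul_oscExp hw lam 1
    have h3 : Continuous fun x => oscExp lam (fun x => f' y - ∑ i, x i * y i) x := by
      unfold oscExp
      fun_prop
    refine (h2.mul h3).congr fun x => ?_
    simp only [oscExp, legPhase, Pi.mul_apply]
    rw [mul_assoc, ← Complex.exp_add]
    congr 2
    push_cast
    ring
  refine h1.integrable_of_hasCompactSupport
    (HasCompactSupport.intro hw.hasCompactSupport fun x hx => ?_)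
  simp [image_eq_zero_of_notMem_tsupport hx]

theorem IsLegendrePair.exists_norm_sum_weylSum_le (h : IsLegendrePair D f D' f')
    (hw : IsWeight D w) (hm : 2 ≤ m) {R R' : ℕ} (hR : ∀ x, (R : ℝ) < ‖x‖ → w x = 0)
    (hR' : ∀ y, (R' : ℝ) < ‖y‖ → dualWeight D' f' w y = 0) :
    ∃ C : ℝ, 0 ≤ C ∧ ∀ j Q : ℕ, 1 ≤ j → 1 ≤ Q →
      ‖∑ q ∈ Finset.Icc 1 Q, weylSum f w R j q‖ ≤
        C * (√Q ^ m * (√j)⁻¹ ^ m * kernSum f' (dualWeight D' f' w) R' j Q +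
          √Q ^ (m + 1) * √j ^ (m - 1) + Q) := by
  obtain ⟨χ, V, C₁, hχ, hV, hVD, hKV, hC₁, hst⟩ := h.exists_stationary hw (by omega)
  obtain ⟨C₂, hC₂, hns⟩ := h.exists_nonstationary hw hKV
  obtain ⟨R₀, hR₀⟩ := hV.isBounded.exists_norm_le
  obtain ⟨R₂, hR₂⟩ := exists_nat_ge R₀
  set w' := dualWeight D' f' w with hw'
  set Λ := ∑' k : Fin m → ℤ, (1 + ‖intVec k‖)⁻¹ ^ (m + 1) with hΛ
  obtain ⟨p, rfl⟩ : ∃ p, m = p + 2 := ⟨m - 2, by omega⟩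
  set A := C₁ * (p + 3 + 2 * Real.pi) with hA
  set B := C₂ * 2 ^ (p + 2 + 1) * Λ with hB
  have hA0 : 0 ≤ A := by positivity
  have hΛ0 : 0 ≤ Λ := tsum_nonneg fun k => by positivity
  have hB0 : 0 ≤ B := by positivity
  refine ⟨A + B + C₁ * (2 * R₂ + 1) ^ (p + 2), by positivity, fun j Q hj hQ => ?_⟩
  have hj1 : (1 : ℝ) ≤ j := by exact_mod_cast hj
  have hQ1 : (1 : ℝ) ≤ Q := by exact_mod_cast hQ
  classical
  set S : Finset (Fin (p + 2) → ℤ) :=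
    (intBox (p + 2) (R₂ * j)).filter fun k => (j : ℝ)⁻¹ • intVec k ∈ V with hS
  have hSV : ∀ k, k ∈ S ↔ (j : ℝ)⁻¹ • intVec k ∈ V := by
    intro k
    rw [hS, Finset.mem_filter]
    refine ⟨fun h => h.2, fun hk => ⟨?_, hk⟩⟩
    by_contra hk'
    have h1 := lt_norm_of_notMem_intBox hk'
    have h2 := (hR₀ _ hk).trans hR₂
    rw [norm_smul, norm_inv, Real.norm_natCast, inv_mul_le_iff₀ (by linarith)] at h2
    push_cast at h1
    linarith
  have hA1 : ∀ q ∈ Finset.Icc 1 Q, ‖weylSum f w R j q -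
      (q : ℂ) ^ (p + 2) * ∑ k ∈ S, oscCoef f w q j (intVec k)‖ ≤ B := by
    intro q hq
    have hq' := (Finset.mem_Icc.1 hq).1
    exact h.norm_weylSum_sub_le hw hR hq' hC₂ (fun k hk => hns q j (intVec k)
      (by exact_mod_cast hq') (Or.inr ⟨hj1, fun h' => hk ((hSV k).2 h')⟩))
      (fun k hk => by linarith [norm_nonneg (intVec k)])
  have hE : ∀ k ∈ S, ∀ q : ℕ, 1 ≤ q → ‖(q : ℂ) ^ (p + 2) *
      ∫ x, ((w x : ℂ) - (w' ((j : ℝ)⁻¹ • intVec k) : ℂ) * (χ x : ℂ)) *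
        oscExp (2 * Real.pi * q * j) (legPhase f f' ((j : ℝ)⁻¹ • intVec k)) x‖ ≤
      C₁ * (√q ^ (p + 1) * (√j)⁻¹ ^ (p + 3)) := by
    intro k hk q hq
    have hq1 : (1 : ℝ) ≤ q := by exact_mod_cast hq
    have h1 := (hst _ ((hSV k).1 hk)).2.2 _ (one_le_two_pi_mul hq1 hj1)
    rw [norm_mul, norm_pow, Complex.norm_natCast]
    have hs : 0 < √(q : ℝ) := Real.sqrt_pos.2 (by linarith)
    calc _ ≤ (√q ^ 2) ^ (p + 2) * (C₁ * ((√q)⁻¹ ^ (p + 3) * (√j)⁻¹ ^ (p + 3))) := by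
          rw [Real.sq_sqrt (by linarith)]
          refine mul_le_mul_of_nonneg_left (h1.trans ?_) (by positivity)
          exact mul_le_mul_of_nonneg_left
            (inv_sqrt_two_pi_mul_le (by linarith) (by linarith) _) hC₁
      _ = _ := by
        rw [inv_pow (√(q : ℝ)), ← pow_mul, show 2 * (p + 2) = p + 1 + (p + 3) by ring,
          pow_add (√(q : ℝ))]
        field_simp
  have hk : ∀ k ∈ S, ‖∑ q ∈ Finset.Icc 1 Q, (q : ℂ) ^ (p + 2) * oscCoef f w q j (intVec k)‖ ≤
      A * (√Q ^ (p + 2) * (√j)⁻¹ ^ (p + 2)) * (|w' ((j : ℝ)⁻¹ • intVec k)| *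
        kern Q (j * f' ((j : ℝ)⁻¹ • intVec k))) +
      C₁ * (√Q ^ (p + 3) * (√j)⁻¹ ^ (p + 3)) := by
    intro k hk
    set y := (j : ℝ)⁻¹ • intVec k with hy
    have hyV : y ∈ V := (hSV k).1 hk
    set F : ℝ → ℂ := fun lam => ∫ x, (χ x : ℂ) * oscExp lam (legPhase f f' y) x with hF
    set G : ℝ → ℂ := fun lam => ∫ x, ((w x : ℂ) - (w' y : ℂ) * (χ x : ℂ)) *
        oscExp lam (legPhase f f' y) x with hG
    have e1 : ∀ q : ℕ, oscCoef f w q j (intVec k) = turn (q * -(j * f' y)) *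
        ((w' y : ℂ) * F (2 * Real.pi * q * j) + G (2 * Real.pi * q * j)) := by
      intro q
      have i1 := h.integrable_weight_mul_legPhase hw (2 * Real.pi * q * j) y
      have i2 := (h.integrable_weight_mul_legPhase hχ (2 * Real.pi * q * j) y).const_mul (w' y : ℂ)
      have e2 : (w' y : ℂ) * F (2 * Real.pi * q * j) + G (2 * Real.pi * q * j) =
          ∫ x, (w x : ℂ) * oscExp (2 * Real.pi * q * j) (legPhase f f' y) x := by
        simp only [hF, hG]
        rw [← integral_const_mul, ← integral_add i2 ((i1.sub i2).congr
          (Filter.Eventually.of_forall fun x => by simp only [Pi.sub_apply]; ring))]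
        congr 1
        funext x
        ring
      rw [e2, oscCoef, ← integral_const_mul]
      congr 1
      funext x
      simp only [oscExp, turn, legPhase]
      rw [mul_left_comm, ← Complex.exp_add]
      congr 2
      rw [← add_mul, ← Complex.ofReal_add]
      congr 2
      have : ∑ i, x i * intVec k i = j * ∑ i, x i * y i := by
        rw [Finset.mul_sum]
        refine Finset.sum_congr rfl fun i _ => ?_
        simp only [hy, Pi.smul_apply, smul_eq_mul]
        field_simp
      rw [this]
      ring
    have e3 : ∑ q ∈ Finset.Icc 1 Q, (q : ℂ) ^ (p + 2) * oscCoef f w q j (intVec k) =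
        (w' y : ℂ) * (∑ q ∈ Finset.Icc 1 Q, turn (q * -(j * f' y)) *
          ((q : ℂ) ^ (p + 2) * F (2 * Real.pi * q * j))) +
        ∑ q ∈ Finset.Icc 1 Q, turn (q * -(j * f' y)) *
          ((q : ℂ) ^ (p + 2) * G (2 * Real.pi * q * j)) := by
      rw [Finset.mul_sum, ← Finset.sum_add_distrib]
      refine Finset.sum_congr rfl fun q _ => ?_
      rw [e1]
      ring
    rw [e3]
    refine (norm_add_le _ _).trans (add_le_add ?_ ?_)
    · have := norm_sum_turn_mul_le hC₁ (hst y hyV).1 (hst y hyV).2.1 (-(j * f' y)) hj hQ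
      rw [norm_mul, Complex.norm_real, Real.norm_eq_abs]
      rw [kern_neg] at this
      refine (mul_le_mul_of_nonneg_left this (abs_nonneg _)).trans (le_of_eq ?_)
      ring
    · have h1 : ∀ q ∈ Finset.Icc 1 Q, ‖turn (q * -(j * f' y)) *
          ((q : ℂ) ^ (p + 2) * G (2 * Real.pi * q * j))‖ ≤
          C₁ * (√Q ^ (p + 1) * (√j)⁻¹ ^ (p + 3)) := by
        intro q hq
        rw [Finset.mem_Icc] at hq
        rw [norm_mul, norm_turn, one_mul]
        refine (hE k hk q hq.1).trans ?_
        have : (q : ℝ) ≤ Q := by exact_mod_cast hq.2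
        gcongr
      refine (norm_sum_le _ _).trans ((Finset.sum_le_card_nsmul _ _ _ h1).trans (le_of_eq ?_))
      rw [Nat.card_Icc, nsmul_eq_mul, add_tsub_cancel_right, pow_succ (√(Q : ℝ)) (p + 2),
        pow_succ (√(Q : ℝ)) (p + 1), mul_assoc (√(Q : ℝ) ^ (p + 1)),
        Real.mul_self_sqrt (by linarith)]
      ring
  have hker : ∑ k ∈ S, |w' ((j : ℝ)⁻¹ • intVec k)| * kern Q (j * f' ((j : ℝ)⁻¹ • intVec k)) ≤
      kernSum f' w' R' j Q := by
    have hz : ∀ k ∉ intBox (p + 2) (R' * j), |w' ((j : ℝ)⁻¹ • intVec k)| *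
        kern Q (j * f' ((j : ℝ)⁻¹ • intVec k)) = 0 := fun k hk' => ?_
    · rw [kernSum, Finset.sum_subset Finset.subset_union_right fun k _ hk => hz k hk]
      exact Finset.sum_le_sum_of_subset_of_nonneg Finset.subset_union_left fun k _ _ =>
        mul_nonneg (abs_nonneg _) (kern_nonneg _ _)
    rw [hR', abs_zero, zero_mul]
    have h1 := lt_norm_of_notMem_intBox hk'
    rw [norm_smul, norm_inv, Real.norm_natCast, ← div_eq_inv_mul, lt_div_iff₀ (by linarith)]
    push_cast at h1
    exact h1
  have hScard : (S.card : ℝ) ≤ (2 * R₂ + 1) ^ (p + 2) * (j : ℝ) ^ (p + 2) :=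
    le_trans (by exact_mod_cast Finset.card_filter_le _ _) (card_intBox_le R₂ hj)
  have e4 : ∑ q ∈ Finset.Icc 1 Q, weylSum f w R j q =
      ∑ q ∈ Finset.Icc 1 Q, (weylSum f w R j q -
        (q : ℂ) ^ (p + 2) * ∑ k ∈ S, oscCoef f w q j (intVec k)) +
      ∑ k ∈ S, ∑ q ∈ Finset.Icc 1 Q, (q : ℂ) ^ (p + 2) * oscCoef f w q j (intVec k) := by
    rw [Finset.sum_comm, ← Finset.sum_add_distrib]
    refine Finset.sum_congr rfl fun q _ => ?_
    rw [Finset.mul_sum]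
    ring
  have b1 : ‖∑ q ∈ Finset.Icc 1 Q, (weylSum f w R j q -
        (q : ℂ) ^ (p + 2) * ∑ k ∈ S, oscCoef f w q j (intVec k))‖ ≤ B * Q := by
    refine (norm_sum_le _ _).trans ((Finset.sum_le_card_nsmul _ _ _ hA1).trans (le_of_eq ?_))
    rw [Nat.card_Icc, nsmul_eq_mul, add_tsub_cancel_right, mul_comm]
  have b2 : ‖∑ k ∈ S, ∑ q ∈ Finset.Icc 1 Q, (q : ℂ) ^ (p + 2) * oscCoef f w q j (intVec k)‖ ≤
      A * (√Q ^ (p + 2) * (√j)⁻¹ ^ (p + 2) * kernSum f' w' R' j Q) +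
      C₁ * (2 * R₂ + 1) ^ (p + 2) * (√Q ^ (p + 3) * √j ^ (p + 1)) := by
    refine (norm_sum_le _ _).trans ((Finset.sum_le_sum hk).trans ?_)
    rw [Finset.sum_add_distrib, ← Finset.mul_sum, Finset.sum_const, nsmul_eq_mul]
    refine add_le_add ?_ ?_
    · refine (mul_le_mul_of_nonneg_left hker (by positivity)).trans (le_of_eq ?_)
      ring
    · have ht : 0 < √(j : ℝ) := Real.sqrt_pos.2 (by linarith)
      calc _ ≤ (2 * R₂ + 1) ^ (p + 2) * (√j ^ 2) ^ (p + 2) *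
            (C₁ * (√Q ^ (p + 3) * (√j)⁻¹ ^ (p + 3))) := by
            rw [Real.sq_sqrt (by linarith)]
            exact mul_le_mul_of_nonneg_right hScard (by positivity)
        _ = _ := by
          rw [inv_pow (√(j : ℝ)), ← pow_mul, show 2 * (p + 2) = p + 1 + (p + 3) by ring,
            pow_add (√(j : ℝ))]
          field_simp
  rw [e4]
  refine (norm_add_le _ _).trans ((add_le_add b1 b2).trans ?_)
  have n1 : 0 ≤ √(Q : ℝ) ^ (p + 2) * (√(j : ℝ))⁻¹ ^ (p + 2) * kernSum f' w' R' j Q := by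
    refine mul_nonneg (by positivity) (Finset.sum_nonneg fun a _ => ?_)
    exact mul_nonneg (abs_nonneg _) (kern_nonneg _ _)
  have n2 : 0 ≤ √(Q : ℝ) ^ (p + 3) * √(j : ℝ) ^ (p + 1) := by positivity
  have n3 : (0 : ℝ) ≤ Q := by linarith
  have n4 : 0 ≤ C₁ * (2 * R₂ + 1) ^ (p + 2) := by positivity
  rw [show p + 2 - 1 = p + 1 by omega]
  set X := √(Q : ℝ) ^ (p + 2) * (√(j : ℝ))⁻¹ ^ (p + 2) * kernSum f' w' R' j Q
  set Y := √(Q : ℝ) ^ (p + 3) * √(j : ℝ) ^ (p + 1)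
  set N := C₁ * (2 * R₂ + 1) ^ (p + 2)
  have : (A + B + N) * (X + Y + Q) = (B * Q + (A * X + N * Y)) +
    (A * Y + A * Q + B * X + B * Y + N * X + N * Q) := by ring
  rw [this]
  have : 0 ≤ A * Y + A * Q + B * X + B * Y + N * X + N * Q := by positivity
  linarith

end VanDerCorput

section Fejer

theorem sum_natAbs_sub_le {a : ℕ → ℝ} (ha : ∀ j, 0 ≤ a j) {J r : ℕ} (hr : r < J) :
    ∑ s ∈ Finset.range J, a (Int.natAbs (r - s)) ≤ a 0 + 2 * ∑ j ∈ Finset.Icc 1 J, a j := by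
  have hsplit : Finset.range J = insert r ((Finset.range r) ∪ (Finset.Ico (r + 1) J)) := by
    ext s
    simp only [Finset.mem_insert, Finset.mem_union, Finset.mem_range, Finset.mem_Ico]
    omega
  have h1 : ∑ s ∈ Finset.range r, a (Int.natAbs (r - s)) ≤ ∑ j ∈ Finset.Icc 1 J, a j := by
    rw [← Finset.sum_image (f := a) (g := fun s : ℕ => Int.natAbs (r - s)) (fun x hx y hy hxy => by
      simp only [Finset.coe_range, Set.mem_Iio] at hx hy
      simp only at hxy
      omega)]
    refine Finset.sum_le_sum_of_subset_of_nonneg (fun j hj => ?_) fun j _ _ => ha j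
    simp only [Finset.mem_image, Finset.mem_range] at hj
    obtain ⟨s, hs, rfl⟩ := hj
    rw [Finset.mem_Icc]
    omega
  have h2 : ∑ s ∈ Finset.Ico (r + 1) J, a (Int.natAbs (r - s)) ≤ ∑ j ∈ Finset.Icc 1 J, a j := by
    rw [← Finset.sum_image (f := a) (g := fun s : ℕ => Int.natAbs (r - s)) (fun x hx y hy hxy => by
      simp only [Finset.coe_Ico, Set.mem_Ico] at hx hy
      simp only at hxy
      omega)]
    refine Finset.sum_le_sum_of_subset_of_nonneg (fun j hj => ?_) fun j _ _ => ha j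
    simp only [Finset.mem_image, Finset.mem_Ico] at hj
    obtain ⟨s, hs, rfl⟩ := hj
    rw [Finset.mem_Icc]
    omega
  rw [hsplit, Finset.sum_insert (by simp), Finset.sum_union (by
    rw [Finset.disjoint_left]
    intro s hs hs'
    simp only [Finset.mem_range, Finset.mem_Ico] at hs hs'
    omega)]
  simp only [sub_self, Int.natAbs_zero]
  linarith

/-- The Dirichlet kernel `∑_{r < J} e(rθ)`. -/
noncomputable def dirichletSum (J : ℕ) (θ : ℝ) : ℂ := ∑ r ∈ Finset.range J, turn (r * θ)

theorem norm_sq_dirichletSum (J : ℕ) (θ : ℝ) : ((‖dirichletSum J θ‖ ^ 2 : ℝ) : ℂ) =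
    ∑ r ∈ Finset.range J, ∑ s ∈ Finset.range J, turn (((r : ℤ) - (s : ℤ) : ℤ) * θ) := by
  rw [Complex.ofReal_pow, ← Complex.mul_conj', dirichletSum, map_sum, Finset.sum_mul_sum]
  refine Finset.sum_congr rfl fun r _ => Finset.sum_congr rfl fun s _ => ?_
  rw [← turn_neg, ← turn_add]
  congr 1
  push_cast
  ring

theorem norm_turn_natCast_mul_sub_one_le (r : ℕ) (θ : ℝ) :
    ‖turn (r * θ) - 1‖ ≤ 2 * Real.pi * (r * nint θ) := by
  have h1 : turn (r * θ) = turn (r * (θ - round θ)) := by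
    have : (r : ℝ) * θ = r * (θ - round θ) + ((r * round θ : ℤ) : ℝ) := by push_cast; ring
    rw [this, turn_add, turn_intCast, mul_one]
  rw [h1, turn, mul_comm]
  refine Real.norm_exp_I_mul_ofReal_sub_one_le.trans (le_of_eq ?_)
  rw [Real.norm_eq_abs, abs_mul (2 * Real.pi), abs_mul (r : ℝ), abs_of_pos Real.two_pi_pos,
    Nat.abs_cast, nint]

theorem half_le_norm_dirichletSum {J : ℕ} {θ : ℝ} (hθ : nint θ ≤ 1 / (16 * J)) :
    (J : ℝ) / 2 ≤ ‖dirichletSum J θ‖ := by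
  rcases Nat.eq_zero_or_pos J with rfl | hJ
  · simp
  have hJ0 : (0 : ℝ) < J := by exact_mod_cast hJ
  have h1 : ‖dirichletSum J θ - J‖ ≤ J / 2 := by
    have h2 : dirichletSum J θ - J = ∑ r ∈ Finset.range J, (turn (r * θ) - 1) := by
      simp [dirichletSum]
    rw [h2]
    refine (norm_sum_le _ _).trans ?_
    have h3 : ∀ r ∈ Finset.range J, ‖turn (r * θ) - 1‖ ≤ 1 / 2 := by
      intro r hr
      refine (norm_turn_natCast_mul_sub_one_le r θ).trans ?_
      have h4 : (r : ℝ) ≤ J := by exact_mod_cast (Finset.mem_range.1 hr).le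
      have h5 : (r : ℝ) * nint θ ≤ J * (1 / (16 * J)) :=
        mul_le_mul h4 hθ (nint_nonneg _) hJ0.le
      have h6 : (J : ℝ) * (1 / (16 * J)) = 1 / 16 := by field_simp
      nlinarith [Real.pi_pos, Real.pi_le_four]
    refine (Finset.sum_le_card_nsmul _ _ _ h3).trans (le_of_eq ?_)
    rw [Finset.card_range, nsmul_eq_mul]
    ring
  have h2 := norm_sub_norm_le (J : ℂ) (dirichletSum J θ)
  rw [Complex.norm_natCast, norm_sub_rev] at h2
  linarith

variable {ι : Type*}

/-- Exponential sum over a weighted finite family of real points. -/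
noncomputable def expSum (s : Finset ι) (W x : ι → ℝ) (j : ℝ) : ℂ :=
  ∑ i ∈ s, (W i : ℂ) * turn (j * x i)

theorem norm_expSum_intCast (s : Finset ι) (W x : ι → ℝ) (j : ℤ) :
    ‖expSum s W x j‖ = ‖expSum s W x (j.natAbs : ℝ)‖ := by
  rcases Int.natAbs_eq j with h | h
  · conv_lhs => rw [h]
    simp
  · have h1 : expSum s W x j = (starRingEnd ℂ) (expSum s W x (j.natAbs : ℝ)) := by
      rw [expSum, expSum, map_sum]
      refine Finset.sum_congr rfl fun i _ => ?_
      rw [map_mul, Complex.conj_ofReal, ← turn_neg]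
      congr 2
      have h2 : (j : ℝ) = -(j.natAbs : ℝ) := by rw [← Int.cast_natCast, ← Int.cast_neg, ← h]
      rw [h2, neg_mul]
    rw [h1, RCLike.norm_conj]

theorem sum_nint_le_of_expSum (s : Finset ι) {W : ι → ℝ} (hW : ∀ i ∈ s, 0 ≤ W i) (x : ι → ℝ) (θ : ℝ)
    {J : ℕ} (hJ : 1 ≤ J) :
    ∑ i ∈ s, (if nint (x i - θ) ≤ 1 / (16 * J) then W i else 0) ≤
      4 / J * (‖expSum s W x 0‖ + 2 * ∑ j ∈ Finset.Icc 1 J, ‖expSum s W x j‖) := by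
  have hJ0 : (0 : ℝ) < J := by exact_mod_cast hJ
  have h1 : ∀ i ∈ s, (if nint (x i - θ) ≤ 1 / (16 * J) then W i else 0) ≤
      4 / J ^ 2 * (W i * ‖dirichletSum J (x i - θ)‖ ^ 2) := by
    intro i hi
    split_ifs with h
    · have h2 := pow_le_pow_left₀ (by positivity) (half_le_norm_dirichletSum h) 2
      have h3 : 4 / (J : ℝ) ^ 2 * (W i * ((J : ℝ) / 2) ^ 2) = W i := by field_simp; ring
      refine h3.symm.le.trans ?_
      have := hW i hi
      gcongr
    · have := hW i hi
      positivity
  have h2 : ∑ i ∈ s, W i * ‖dirichletSum J (x i - θ)‖ ^ 2 ≤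
      ∑ r ∈ Finset.range J, ∑ t ∈ Finset.range J,
        ‖expSum s W x ((Int.natAbs ((r : ℤ) - (t : ℤ)) : ℕ) : ℝ)‖ := by
    have h3 : ((∑ i ∈ s, W i * ‖dirichletSum J (x i - θ)‖ ^ 2 : ℝ) : ℂ) =
        ∑ r ∈ Finset.range J, ∑ t ∈ Finset.range J,
          turn (((r : ℤ) - (t : ℤ) : ℤ) * (-θ)) * expSum s W x (((r : ℤ) - (t : ℤ) : ℤ) : ℝ) := by
      simp only [Complex.ofReal_sum, Complex.ofReal_mul, norm_sq_dirichletSum, expSum,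
        Finset.mul_sum]
      rw [Finset.sum_comm]
      refine Finset.sum_congr rfl fun r _ => ?_
      rw [Finset.sum_comm]
      refine Finset.sum_congr rfl fun t _ => Finset.sum_congr rfl fun i _ => ?_
      rw [mul_left_comm, ← turn_add]
      congr 2
      ring
    calc ∑ i ∈ s, W i * ‖dirichletSum J (x i - θ)‖ ^ 2
        ≤ ‖((∑ i ∈ s, W i * ‖dirichletSum J (x i - θ)‖ ^ 2 : ℝ) : ℂ)‖ := by
          rw [Complex.norm_real]
          exact le_abs_self _
      _ ≤ _ := by
        rw [h3]
        refine (norm_sum_le _ _).trans (Finset.sum_le_sum fun r _ => ?_)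
        refine (norm_sum_le _ _).trans (Finset.sum_le_sum fun t _ => ?_)
        rw [norm_mul, norm_turn, one_mul, norm_expSum_intCast]
  have h3 : ∑ r ∈ Finset.range J, ∑ t ∈ Finset.range J,
        ‖expSum s W x ((Int.natAbs ((r : ℤ) - (t : ℤ)) : ℕ) : ℝ)‖ ≤
      J * (‖expSum s W x 0‖ + 2 * ∑ j ∈ Finset.Icc 1 J, ‖expSum s W x j‖) := by
    have h4 := Finset.sum_le_card_nsmul (Finset.range J) _ _ fun r hr =>
      sum_natAbs_sub_le (a := fun j : ℕ => ‖expSum s W x j‖) (fun j => norm_nonneg _)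
        (Finset.mem_range.1 hr)
    rw [Finset.card_range, nsmul_eq_mul] at h4
    simpa using h4
  calc _ ≤ ∑ i ∈ s, 4 / J ^ 2 * (W i * ‖dirichletSum J (x i - θ)‖ ^ 2) := Finset.sum_le_sum h1
    _ = 4 / J ^ 2 * ∑ i ∈ s, W i * ‖dirichletSum J (x i - θ)‖ ^ 2 := (Finset.mul_sum _ _ _).symm
    _ ≤ 4 / J ^ 2 * (J * (‖expSum s W x 0‖ + 2 * ∑ j ∈ Finset.Icc 1 J, ‖expSum s W x j‖)) := by
      gcongr
      exact h2.trans h3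
    _ = _ := by field_simp

/-- A dyadic decomposition of `kern`. -/
theorem kern_le_sum_dyadic {M : ℕ} (hM : 1 ≤ M) (α : ℝ) :
    kern M α ≤ 2 * ∑ i ∈ Finset.range (Nat.log 2 M + 1),
      2 ^ i * (if nint α ≤ (2 ^ i : ℝ)⁻¹ then (1 : ℝ) else 0) := by
  have hM1 : (1 : ℝ) ≤ M := by exact_mod_cast hM
  have h0 : 0 < max (M : ℝ)⁻¹ (nint α) := lt_max_of_lt_left (by positivity)
  have h1 : max (M : ℝ)⁻¹ (nint α) ≤ 1 :=
    max_le (inv_le_one_of_one_le₀ hM1) ((nint_le_half α).trans (by norm_num))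
  have hk1 : 1 ≤ kern M α := (one_le_inv₀ h0).2 h1
  have hkM : kern M α ≤ M := by
    rw [kern, inv_le_comm₀ h0 (by linarith)]
    exact le_max_left _ _
  set N := ⌊kern M α⌋₊ with hN
  have hN1 : 1 ≤ N := Nat.le_floor (by exact_mod_cast hk1)
  set i := Nat.log 2 N with hi
  have hi1 : 2 ^ i ≤ N := Nat.pow_log_le_self 2 (by omega)
  have hi2 : N < 2 ^ (i + 1) := Nat.lt_pow_succ_log_self (by norm_num) N
  have hk2 : kern M α ≤ 2 * 2 ^ i := by
    have h2 := Nat.lt_floor_add_one (kern M α)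
    have h3 : ((N + 1 : ℕ) : ℝ) ≤ ((2 ^ (i + 1) : ℕ) : ℝ) := by exact_mod_cast hi2
    push_cast at h3
    rw [pow_succ] at h3
    linarith
  have hk3 : (2 : ℝ) ^ i ≤ kern M α := by
    have h2 : (N : ℝ) ≤ kern M α := Nat.floor_le (by linarith)
    have h3 : ((2 ^ i : ℕ) : ℝ) ≤ N := by exact_mod_cast hi1
    push_cast at h3
    linarith
  have hiM : i ≤ Nat.log 2 M := by
    refine Nat.log_mono_right ?_
    have h2 : (N : ℝ) ≤ kern M α := Nat.floor_le (by linarith)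
    exact_mod_cast h2.trans hkM
  have hn : nint α ≤ (2 ^ i : ℝ)⁻¹ := by
    rw [kern, le_inv_comm₀ (by positivity) h0] at hk3
    exact (le_max_right _ _).trans hk3
  refine hk2.trans (mul_le_mul_of_nonneg_left ?_ zero_le_two)
  have := Finset.single_le_sum (f := fun i : ℕ => (2 : ℝ) ^ i *
    (if nint α ≤ (2 ^ i : ℝ)⁻¹ then (1 : ℝ) else 0)) (s := Finset.range (Nat.log 2 M + 1))
    (fun i _ => by positivity) (Finset.mem_range.2 (Nat.lt_succ_of_le hiM))
  simpa [hn] using this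

theorem sum_mul_kern_le (s : Finset ι) {W : ι → ℝ} (hW : ∀ i ∈ s, 0 ≤ W i) (x : ι → ℝ) {M : ℕ}
    (hM : 1 ≤ M) {X Y : ℝ} (hY : 0 ≤ Y)
    (h : ∀ δ > 0, ∑ i ∈ s, (if nint (x i) ≤ δ then W i else 0) ≤ δ * X + Y) :
    ∑ i ∈ s, W i * kern M (x i) ≤ 2 * ((Nat.log 2 M + 1) * X + 2 * M * Y) := by
  have hM1 : 2 ^ Nat.log 2 M ≤ M := Nat.pow_log_le_self 2 (by omega)
  have h1 : ∀ i ∈ s, W i * kern M (x i) ≤ 2 * ∑ k ∈ Finset.range (Nat.log 2 M + 1),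
      2 ^ k * (if nint (x i) ≤ (2 ^ k : ℝ)⁻¹ then W i else 0) := by
    intro i hi
    refine (mul_le_mul_of_nonneg_left (kern_le_sum_dyadic hM (x i)) (hW i hi)).trans (le_of_eq ?_)
    rw [mul_left_comm, Finset.mul_sum]
    congr 1
    refine Finset.sum_congr rfl fun k _ => ?_
    split_ifs <;> ring
  refine (Finset.sum_le_sum h1).trans ?_
  rw [← Finset.mul_sum, Finset.sum_comm]
  refine mul_le_mul_of_nonneg_left ?_ zero_le_two
  have h2 : ∀ k ∈ Finset.range (Nat.log 2 M + 1),
      ∑ i ∈ s, 2 ^ k * (if nint (x i) ≤ (2 ^ k : ℝ)⁻¹ then W i else 0) ≤ X + 2 ^ k * Y := by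
    intro k _
    rw [← Finset.mul_sum]
    refine (mul_le_mul_of_nonneg_left (h _ (by positivity)) (by positivity)).trans (le_of_eq ?_)
    field_simp
  refine (Finset.sum_le_sum h2).trans ?_
  rw [Finset.sum_add_distrib, Finset.sum_const, Finset.card_range, nsmul_eq_mul, ← Finset.sum_mul,
    geom_sum_eq (by norm_num)]
  have h3 : ((2 ^ Nat.log 2 M : ℕ) : ℝ) ≤ M := by exact_mod_cast hM1
  push_cast at h3 ⊢
  have h4 : ((2 : ℝ) ^ (Nat.log 2 M + 1) - 1) / (2 - 1) ≤ 2 * M := by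
    rw [pow_succ]
    linarith
  linarith [mul_le_mul_of_nonneg_right h4 hY]

end Fejer

section FejerApproximation

theorem nint_add_intCast (x : ℝ) (k : ℤ) : nint (x + k) = nint x := by
  rw [nint, nint, round_add_intCast]
  congr 1
  push_cast
  ring

theorem nint_eq_min {t : ℝ} (h0 : 0 ≤ t) (h1 : t ≤ 1) : nint t = min t (1 - t) := by
  rcases le_total t (1 / 2) with h | h
  · rw [nint_eq_self h0 h, min_eq_left (by linarith)]
  · rw [min_eq_right (by linarith), ← nint_eq_self (x := 1 - t) (by linarith) (by linarith),
      ← nint_neg]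
    have := nint_add_intCast (-t) 1
    rw [← this]
    congr 1
    push_cast
    ring

/-- The Fejér kernel. -/
noncomputable def fejer (J : ℕ) (t : ℝ) : ℝ := (J : ℝ)⁻¹ * ‖dirichletSum J t‖ ^ 2

theorem fejer_nonneg (J : ℕ) (t : ℝ) : 0 ≤ fejer J t := by unfold fejer; positivity

theorem continuous_fejer (J : ℕ) : Continuous (fejer J) := by
  unfold fejer dirichletSum
  have := continuous_turn
  fun_prop

theorem fejer_add_intCast (J : ℕ) (t : ℝ) (k : ℤ) : fejer J (t + k) = fejer J t := by
  have : dirichletSum J (t + k) = dirichletSum J t := by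
    refine Finset.sum_congr rfl fun r _ => ?_
    have h : (r : ℝ) * (t + k) = r * t + ((r * k : ℤ) : ℝ) := by push_cast; ring
    rw [h, turn_add, turn_intCast, mul_one]
  rw [fejer, fejer, this]

theorem fejer_eq (J : ℕ) (t : ℝ) : ((fejer J t : ℝ) : ℂ) = (J : ℂ)⁻¹ *
    ∑ r ∈ Finset.range J, ∑ s ∈ Finset.range J, turn (((r : ℤ) - (s : ℤ) : ℤ) * t) := by
  rw [← norm_sq_dirichletSum, fejer]
  push_cast
  rfl

theorem integral_turn_intCast_mul (k : ℤ) (a b : ℝ) (hk : k ≠ 0) :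
    ∫ t in a..b, turn (k * t) = (turn (k * b) - turn (k * a)) / (2 * Real.pi * k * Complex.I) := by
  have hc : (2 * Real.pi * k * Complex.I : ℂ) ≠ 0 := by
    have := Real.pi_ne_zero
    simp [this, hk]
  have h1 := integral_exp_mul_complex (a := a) (b := b) hc
  have h2 : ∀ t : ℝ, Complex.exp (2 * Real.pi * k * Complex.I * t) = turn (k * t) := by
    intro t
    rw [turn]
    congr 1
    push_cast
    ring
  simpa only [h2] using h1

theorem norm_integral_turn_le (k : ℤ) (a b : ℝ) (hk : k ≠ 0) :
    ‖∫ t in a..b, turn (k * t)‖ ≤ (k.natAbs : ℝ)⁻¹ := by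
  rw [integral_turn_intCast_mul k a b hk, norm_div]
  have h1 : ‖turn (k * b) - turn (k * a)‖ ≤ 2 :=
    (norm_sub_le _ _).trans (by rw [norm_turn, norm_turn]; norm_num)
  have h2 : ‖(2 * Real.pi * k * Complex.I : ℂ)‖ = 2 * Real.pi * (k.natAbs : ℝ) := by
    rw [norm_mul, norm_mul, norm_mul, Complex.norm_I, Complex.norm_intCast, Complex.norm_real,
      Real.norm_of_nonneg Real.pi_pos.le, Complex.norm_ofNat, mul_one, Nat.cast_natAbs, Int.cast_abs]
  have hk0 : (0 : ℝ) < k.natAbs := by exact_mod_cast Int.natAbs_pos.2 hk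
  rw [h2, div_le_iff₀ (by positivity), mul_comm (2 * Real.pi), inv_mul_cancel_left₀ hk0.ne']
  linarith [Real.two_le_pi]

theorem continuous_sum_turn (J r : ℕ) : Continuous fun t : ℝ => ∑ s ∈ Finset.range J,
    turn (((r : ℤ) - (s : ℤ) : ℤ) * t) := by
  have := continuous_turn
  fun_prop

theorem integral_fejer {J : ℕ} (hJ : 1 ≤ J) (a : ℝ) : ∫ t in a..(a + 1), fejer J t = 1 := by
  have hJ0 : (J : ℂ) ≠ 0 := by exact_mod_cast (by omega : J ≠ 0)
  have hci : ∀ k : ℤ, IntervalIntegrable (fun t => turn (k * t)) volume a (a + 1) := fun k =>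
    (continuous_turn.comp (continuous_const_mul _)).intervalIntegrable _ _
  have h1 : ∀ k : ℤ, ∫ t in a..(a + 1), turn (k * t) = if k = 0 then 1 else 0 := by
    intro k
    split_ifs with hk
    · simp [hk, turn_zero]
    · rw [integral_turn_intCast_mul k _ _ hk, mul_add, mul_one, turn_add, turn_intCast, mul_one,
        sub_self, zero_div]
  have h2 : ((∫ t in a..(a + 1), fejer J t : ℝ) : ℂ) = 1 := by
    rw [← intervalIntegral.integral_ofReal]
    simp only [fejer_eq]
    rw [intervalIntegral.integral_const_mul, intervalIntegral.integral_finsetSum fun r _ =>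
      (continuous_sum_turn J r).intervalIntegrable _ _]
    have h3 : ∀ r ∈ Finset.range J, ∫ t in a..(a + 1), ∑ s ∈ Finset.range J,
        turn (((r : ℤ) - (s : ℤ) : ℤ) * t) = 1 := by
      intro r hr
      rw [intervalIntegral.integral_finsetSum fun s _ => hci _]
      simp only [h1, sub_eq_zero, Nat.cast_inj]
      rw [Finset.sum_ite_eq, if_pos hr]
    rw [Finset.sum_congr rfl h3]
    simp [hJ0]
  exact_mod_cast h2

theorem integral_fejer_le {J : ℕ} {a b : ℝ} (ha : 0 < a) (hab : a ≤ b) (hb : b < 1) :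
    ∫ t in a..b, fejer J t ≤ (J : ℝ)⁻¹ * (a⁻¹ + (1 - b)⁻¹) := by
  have hF : ∀ t ∈ Set.uIcc a b, HasDerivAt (fun t : ℝ => (J : ℝ)⁻¹ * (-t⁻¹ + (1 - t)⁻¹))
      ((J : ℝ)⁻¹ * ((t ^ 2)⁻¹ + ((1 - t) ^ 2)⁻¹)) t := by
    intro t ht
    rw [Set.uIcc_of_le hab] at ht
    have h1 := (hasDerivAt_inv (x := t) (by linarith [ht.1])).neg
    have h2 := ((hasDerivAt_id t).const_sub 1).inv (by simp only [id]; linarith [ht.2])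
    refine ((h1.add h2).const_mul ((J : ℝ)⁻¹)).congr_deriv ?_
    simp only [id]
    rw [neg_neg, neg_neg, one_div]
  have hc : ContinuousOn (fun t : ℝ => (J : ℝ)⁻¹ * ((t ^ 2)⁻¹ + ((1 - t) ^ 2)⁻¹))
      (Set.uIcc a b) := by
    rw [Set.uIcc_of_le hab]
    refine ContinuousOn.mul continuousOn_const (ContinuousOn.add ?_ ?_)
    · exact ContinuousOn.inv₀ (by fun_prop) fun t ht => by
        have : 0 < t := ha.trans_le ht.1
        positivity
    · exact ContinuousOn.inv₀ (by fun_prop) fun t ht => by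
        have : 0 < 1 - t := by linarith [ht.2]
        positivity
  have h1 := intervalIntegral.integral_eq_sub_of_hasDerivAt hF hc.intervalIntegrable
  have h2 : ∫ t in a..b, fejer J t ≤ ∫ t in a..b, (J : ℝ)⁻¹ * ((t ^ 2)⁻¹ + ((1 - t) ^ 2)⁻¹) := by
    refine intervalIntegral.integral_mono_on hab ((continuous_fejer J).intervalIntegrable _ _)
      hc.intervalIntegrable fun t ht => ?_
    have t0 : 0 < t := ha.trans_le ht.1
    have t1 : 0 < 1 - t := by linarith [ht.2]
    have h3 : nint t * ‖dirichletSum J t‖ ≤ 1 := nint_mul_norm_sum_turn_le t J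
    rw [nint_eq_min t0.le (by linarith)] at h3
    refine mul_le_mul_of_nonneg_left ?_ (by positivity)
    have key : ∀ u : ℝ, 0 < u → u * ‖dirichletSum J t‖ ≤ 1 → ‖dirichletSum J t‖ ^ 2 ≤ (u ^ 2)⁻¹ := by
      intro u hu h
      rw [← inv_pow]
      refine pow_le_pow_left₀ (norm_nonneg _) ?_ 2
      rwa [← one_div, le_div_iff₀ hu, mul_comm]
    rcases min_choice t (1 - t) with h | h
    · rw [h] at h3
      have := key t t0 h3
      have : 0 ≤ ((1 - t) ^ 2)⁻¹ := by positivity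
      linarith
    · rw [h] at h3
      have := key _ t1 h3
      have : 0 ≤ (t ^ 2)⁻¹ := by positivity
      linarith
  refine h2.trans ?_
  rw [h1, ← mul_sub]
  refine mul_le_mul_of_nonneg_left ?_ (by positivity)
  have b1 : 0 < b⁻¹ := inv_pos.2 (ha.trans_le hab)
  have b2 : 0 < (1 - a)⁻¹ := inv_pos.2 (by linarith)
  linarith

theorem le_kern_add_kern {J : ℕ} (hJ : 1 ≤ J) {E a b α β : ℝ} (hE : E ≤ 1) (hα : nint α ≤ a)
    (hβ : nint β ≤ b)
    (h : 0 < nint α → 0 < nint β → E ≤ (J : ℝ)⁻¹ * (a⁻¹ + b⁻¹)) :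
    E ≤ (J : ℝ)⁻¹ * (kern J α + kern J β) := by
  have hJ0 : (0 : ℝ) < J := by exact_mod_cast hJ
  have triv : ∀ γ, nint γ ≤ (J : ℝ)⁻¹ → kern J γ = J := fun γ hγ => by
    rw [kern, max_eq_left hγ, inv_inv]
  by_cases h1 : nint α ≤ (J : ℝ)⁻¹
  · rw [triv α h1, mul_add, inv_mul_cancel₀ hJ0.ne']
    have := mul_nonneg (inv_pos.2 hJ0).le (kern_nonneg J β)
    linarith
  by_cases h2 : nint β ≤ (J : ℝ)⁻¹
  · rw [triv β h2, mul_add, inv_mul_cancel₀ hJ0.ne']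
    have := mul_nonneg (inv_pos.2 hJ0).le (kern_nonneg J α)
    linarith
  push Not at h1 h2
  have p1 : 0 < nint α := (inv_pos.2 hJ0).trans h1
  have p2 : 0 < nint β := (inv_pos.2 hJ0).trans h2
  refine (h p1 p2).trans ?_
  rw [kern, kern, max_eq_right h1.le, max_eq_right h2.le]
  gcongr

theorem abs_integral_fejer_sub_le {J : ℕ} (hJ : 1 ≤ J) {δ : ℝ} (hδ : 0 < δ) (hδ' : δ < 1 / 2)
    (x : ℝ) : |(∫ t in (x - δ)..(x + δ), fejer J t) - (if nint x < δ then 1 else 0)| ≤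
      (J : ℝ)⁻¹ * (kern J (x + δ) + kern J (x - δ)) := by
  have hintegral : ∀ a b : ℝ, IntervalIntegrable (fejer J) volume a b := fun a b =>
    (continuous_fejer J).intervalIntegrable _ _
  have hpos : ∀ {a b : ℝ}, a ≤ b → 0 ≤ ∫ t in a..b, fejer J t := fun h =>
    intervalIntegral.integral_nonneg h fun t _ => fejer_nonneg J t
  suffices key : ∀ y : ℝ, -δ ≤ y → y < 1 - δ →
      |(∫ t in (y - δ)..(y + δ), fejer J t) - (if nint y < δ then 1 else 0)| ≤
      (J : ℝ)⁻¹ * (kern J (y + δ) + kern J (y - δ)) by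
    set k := ⌊x + δ⌋ with hk
    have h1 := key (x - k) (by linarith [Int.floor_le (x + δ)])
      (by linarith [Int.lt_floor_add_one (x + δ)])
    have e0 : ∀ z : ℝ, nint (z - k) = nint z := fun z => by
      have := nint_add_intCast (z - k) k
      rwa [sub_add_cancel, eq_comm] at this
    have e1 : kern J (x - k + δ) = kern J (x + δ) := by
      rw [kern, kern, show x - k + δ = x + δ - k by ring, e0]
    have e2 : kern J (x - k - δ) = kern J (x - δ) := by
      rw [kern, kern, show x - k - δ = x - δ - k by ring, e0]
    have e3 : ∫ t in (x - k - δ)..(x - k + δ), fejer J t = ∫ t in (x - δ)..(x + δ), fejer J t := by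
      have := intervalIntegral.integral_comp_add_right (a := x - k - δ) (b := x - k + δ)
        (fejer J) (k : ℝ)
      simp only [fejer_add_intCast] at this
      rw [this]
      congr 1 <;> ring
    rwa [e0, e1, e2, e3] at h1
  intro y hy1 hy2
  have htot := integral_fejer hJ (y - δ)
  have hsplit := intervalIntegral.integral_add_adjacent_intervals (hintegral (y - δ) (y + δ))
    (hintegral (y + δ) (y - δ + 1))
  have p1 := hpos (a := y - δ) (b := y + δ) (by linarith)
  have p2 := hpos (a := y + δ) (b := y - δ + 1) (by linarith)
  rcases lt_or_ge y δ with hlt | hge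
  · refine le_kern_add_kern hJ (a := y + δ) (b := δ - y) ?_ ?_ ?_ fun h1 h2 => ?_
    · split_ifs <;> rw [abs_le] <;> constructor <;> linarith
    · exact (nint_le_abs _).trans (by rw [abs_of_nonneg (by linarith)])
    · exact (nint_le_abs _).trans (by rw [abs_of_neg (by linarith)]; linarith)
    · have h3 : 0 < y + δ := by
        refine lt_of_le_of_ne (by linarith) fun h => ?_
        rw [← h] at h1
        simp [nint] at h1
      have h4 : nint y < δ := (nint_le_abs y).trans_lt (abs_lt.2 ⟨by linarith, hlt⟩)
      have h5 := integral_fejer_le (J := J) h3 (by linarith : y + δ ≤ y - δ + 1) (by linarith)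
      rw [if_pos h4, abs_sub_comm, abs_of_nonneg (by linarith)]
      rw [show 1 - (y - δ + 1) = δ - y by ring] at h5
      linarith
  · refine (le_kern_add_kern hJ (α := y - δ) (β := y + δ) (a := y - δ) (b := 1 - (y + δ)) ?_ ?_ ?_
      fun h1 h2 => ?_).trans (le_of_eq (by ring))
    · split_ifs <;> rw [abs_le] <;> constructor <;> linarith
    · exact (nint_le_abs _).trans (by rw [abs_of_nonneg (by linarith)])
    · rw [nint_eq_min (by linarith) (by linarith)]
      exact min_le_right _ _
    · have h3 : 0 < y - δ := by
        refine lt_of_le_of_ne (by linarith) fun h => ?_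
        rw [← h] at h1
        simp [nint] at h1
      have h4 : ¬ nint y < δ := by
        rw [nint_eq_min (by linarith) (by linarith), not_lt, le_min_iff]
        constructor <;> linarith
      have h5 := integral_fejer_le (J := J) h3 (by linarith : y - δ ≤ y + δ) (by linarith)
      rw [if_neg h4, sub_zero, abs_of_nonneg p1]
      exact h5

variable {ι : Type*}

theorem integral_fejer_eq_sum (J : ℕ) (x δ : ℝ) :
    ((∫ t in (x - δ)..(x + δ), fejer J t : ℝ) : ℂ) = (J : ℂ)⁻¹ *
      ∑ r ∈ Finset.range J, ∑ s ∈ Finset.range J, turn (((r : ℤ) - (s : ℤ) : ℤ) * x) *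
        ∫ t in (-δ)..δ, turn (((r : ℤ) - (s : ℤ) : ℤ) * t) := by
  have hci : ∀ k : ℤ, IntervalIntegrable (fun t => turn (k * t)) volume (x - δ) (x + δ) := fun k =>
    (continuous_turn.comp (continuous_const_mul _)).intervalIntegrable _ _
  rw [← intervalIntegral.integral_ofReal]
  simp only [fejer_eq]
  rw [intervalIntegral.integral_const_mul, intervalIntegral.integral_finsetSum fun r _ =>
    (continuous_sum_turn J r).intervalIntegrable _ _]
  congr 1
  refine Finset.sum_congr rfl fun r _ => ?_
  rw [intervalIntegral.integral_finsetSum fun s _ => hci _]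
  refine Finset.sum_congr rfl fun s _ => ?_
  rw [← intervalIntegral.integral_const_mul]
  simp only [← turn_add, ← mul_add]
  rw [intervalIntegral.integral_comp_add_left
    (fun t => turn ((((r : ℤ) - (s : ℤ) : ℤ) : ℝ) * t)) x]
  rfl

theorem abs_sum_nint_lt_sub_le (s : Finset ι) (W x : ι → ℝ) {J : ℕ} (hJ : 1 ≤ J) {δ : ℝ}
    (hδ : 0 < δ) (hδ' : δ < 1 / 2) :
    |∑ i ∈ s, (if nint (x i) < δ then W i else 0) - 2 * δ * ∑ i ∈ s, W i| ≤
      2 * ∑ j ∈ Finset.Icc 1 J, (j : ℝ)⁻¹ * ‖expSum s W x j‖ +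
      (J : ℝ)⁻¹ * ∑ i ∈ s, |W i| * (kern J (x i + δ) + kern J (x i - δ)) := by
  have hJ0 : (0 : ℝ) < J := by exact_mod_cast hJ
  have hJC : (J : ℂ) ≠ 0 := by exact_mod_cast hJ0.ne'
  set P : ℝ → ℝ := fun x => ∫ t in (x - δ)..(x + δ), fejer J t with hP
  set c : ℤ → ℂ := fun k => ∫ t in (-δ)..δ, turn (k * t) with hc
  set d : ℤ → ℂ := fun k => if k = 0 then 0 else c k with hd
  have hc0 : c 0 = 2 * δ := by
    simp only [hc, Int.cast_zero, zero_mul, turn_zero, intervalIntegral.integral_const]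
    rw [Complex.real_smul]
    push_cast
    ring
  have hdb : ∀ k, ‖d k‖ ≤ (k.natAbs : ℝ)⁻¹ := by
    intro k
    by_cases hk : k = 0
    · simp [hd, hk]
    · simp only [hd, if_neg hk]
      exact norm_integral_turn_le k _ _ hk
  have hmain : ((∑ i ∈ s, W i * P (x i) - 2 * δ * ∑ i ∈ s, W i : ℝ) : ℂ) = (J : ℂ)⁻¹ *
      ∑ r ∈ Finset.range J, ∑ t ∈ Finset.range J,
        d ((r : ℤ) - (t : ℤ)) * expSum s W x (((r : ℤ) - (t : ℤ) : ℤ) : ℝ) := by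
    have h1 : ((∑ i ∈ s, W i * P (x i) : ℝ) : ℂ) = (J : ℂ)⁻¹ *
        ∑ r ∈ Finset.range J, ∑ t ∈ Finset.range J,
          c ((r : ℤ) - (t : ℤ)) * expSum s W x (((r : ℤ) - (t : ℤ) : ℤ) : ℝ) := by
      simp only [Complex.ofReal_sum, Complex.ofReal_mul, hP, integral_fejer_eq_sum, expSum,
        Finset.mul_sum]
      rw [Finset.sum_comm]
      refine Finset.sum_congr rfl fun r _ => ?_
      rw [Finset.sum_comm]
      refine Finset.sum_congr rfl fun t _ => Finset.sum_congr rfl fun i _ => ?_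
      simp only [hc]
      ring
    have h2 : ∀ r ∈ Finset.range J, ∑ t ∈ Finset.range J,
        c ((r : ℤ) - (t : ℤ)) * expSum s W x (((r : ℤ) - (t : ℤ) : ℤ) : ℝ) =
        ∑ t ∈ Finset.range J,
          d ((r : ℤ) - (t : ℤ)) * expSum s W x (((r : ℤ) - (t : ℤ) : ℤ) : ℝ) +
        2 * δ * ∑ i ∈ s, (W i : ℂ) := by
      intro r hr
      have h3 : ∀ t : ℕ, c ((r : ℤ) - (t : ℤ)) * expSum s W x (((r : ℤ) - (t : ℤ) : ℤ) : ℝ) =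
          d ((r : ℤ) - (t : ℤ)) * expSum s W x (((r : ℤ) - (t : ℤ) : ℤ) : ℝ) +
          if r = t then 2 * δ * ∑ i ∈ s, (W i : ℂ) else 0 := by
        intro t
        by_cases hrt : r = t
        · subst hrt
          simp [hd, hc0, expSum, turn_zero]
        · have : (r : ℤ) - (t : ℤ) ≠ 0 := by omega
          simp [hd, hrt, this]
      rw [Finset.sum_congr rfl fun t _ => h3 t, Finset.sum_add_distrib, Finset.sum_ite_eq,
        if_pos hr]
    rw [Complex.ofReal_sub, h1, Finset.sum_congr rfl h2, Finset.sum_add_distrib, Finset.sum_const,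
      Finset.card_range, nsmul_eq_mul, mul_add, inv_mul_cancel_left₀ hJC]
    push_cast
    ring
  have hb1 : |∑ i ∈ s, W i * P (x i) - 2 * δ * ∑ i ∈ s, W i| ≤
      2 * ∑ j ∈ Finset.Icc 1 J, (j : ℝ)⁻¹ * ‖expSum s W x j‖ := by
    rw [← Real.norm_eq_abs, ← Complex.norm_real, hmain, norm_mul, norm_inv, Complex.norm_natCast,
      inv_mul_le_iff₀ hJ0]
    have h4 := Finset.sum_le_card_nsmul (Finset.range J) _ _ fun r hr =>
      sum_natAbs_sub_le (a := fun j : ℕ => (j : ℝ)⁻¹ * ‖expSum s W x j‖)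
        (fun j => by positivity) (Finset.mem_range.1 hr)
    rw [Finset.card_range, nsmul_eq_mul, Nat.cast_zero, inv_zero, zero_mul, zero_add] at h4
    refine le_trans ?_ h4
    refine (norm_sum_le _ _).trans (Finset.sum_le_sum fun r _ => ?_)
    refine (norm_sum_le _ _).trans (Finset.sum_le_sum fun t _ => ?_)
    rw [norm_mul, norm_expSum_intCast]
    exact mul_le_mul_of_nonneg_right (hdb _) (norm_nonneg _)
  have hb2 : |∑ i ∈ s, (if nint (x i) < δ then W i else 0) - ∑ i ∈ s, W i * P (x i)| ≤
      (J : ℝ)⁻¹ * ∑ i ∈ s, |W i| * (kern J (x i + δ) + kern J (x i - δ)) := by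
    rw [← Finset.sum_sub_distrib, Finset.mul_sum]
    refine (Finset.abs_sum_le_sum_abs _ _).trans (Finset.sum_le_sum fun i _ => ?_)
    have h1 := abs_integral_fejer_sub_le hJ hδ hδ' (x i)
    have h2 : (if nint (x i) < δ then W i else 0) - W i * P (x i) =
        -(W i * (P (x i) - if nint (x i) < δ then 1 else 0)) := by
      split_ifs <;> ring
    rw [h2, abs_neg, abs_mul, mul_left_comm]
    exact mul_le_mul_of_nonneg_left h1 (abs_nonneg _)
  have h3 := abs_add_le (∑ i ∈ s, (if nint (x i) < δ then W i else 0) - ∑ i ∈ s, W i * P (x i))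
    (∑ i ∈ s, W i * P (x i) - 2 * δ * ∑ i ∈ s, W i)
  rw [sub_add_sub_cancel] at h3
  linarith

end FejerApproximation

section AbelSummation

theorem sum_Icc_mul_eq_add_sum_sub (v u : ℕ → ℝ) (N : ℕ) :
    ∑ j ∈ Finset.Icc 1 (N + 1), v j * u j = v (N + 1) * ∑ j ∈ Finset.Icc 1 (N + 1), u j +
      ∑ j ∈ Finset.Icc 1 N, (v j - v (j + 1)) * ∑ i ∈ Finset.Icc 1 j, u i := by
  induction N with
  | zero => simp
  | succ N ih =>
    rw [Finset.sum_Icc_succ_top (by omega), ih,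
      Finset.sum_Icc_succ_top (by omega : 1 ≤ N + 1 + 1) u,
      Finset.sum_Icc_succ_top (by omega : 1 ≤ N + 1)
        fun j => (v j - v (j + 1)) * ∑ i ∈ Finset.Icc 1 j, u i]
    ring

theorem inv_sqrt_pow_sub_le (d : ℕ) {j : ℕ} (hj : 1 ≤ j) :
    (√(j : ℝ))⁻¹ ^ d - (√((j + 1 : ℕ) : ℝ))⁻¹ ^ d ≤ d * (√(j : ℝ))⁻¹ ^ (d + 2) := by
  have hj0 : (0 : ℝ) < j := by exact_mod_cast hj
  have ht : 0 < √(j : ℝ) := Real.sqrt_pos.2 hj0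
  push_cast
  have ht' : 0 < √((j : ℝ) + 1) := Real.sqrt_pos.2 (by linarith)
  set s := √(j : ℝ) / √((j : ℝ) + 1) with hs
  have hs0 : 0 ≤ s := by positivity
  have hs2 : s ^ 2 = 1 - 1 / ((j : ℝ) + 1) := by
    rw [hs, div_pow, Real.sq_sqrt hj0.le, Real.sq_sqrt (by linarith)]
    field_simp
    ring
  have hs1 : s ^ 2 ≤ 1 := by
    rw [hs2]
    have : 0 < 1 / ((j : ℝ) + 1) := by positivity
    linarith
  have hs1' : s ≤ 1 := by
    rw [hs, div_le_one ht']
    exact Real.sqrt_le_sqrt (by linarith)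
  have h1 : 1 - (d : ℝ) / j ≤ s ^ d := by
    have h2 : 1 + (d : ℝ) * (s ^ 2 - 1) ≤ (1 + (s ^ 2 - 1)) ^ d :=
      one_add_mul_le_pow (by nlinarith) d
    have h3 : (s ^ 2) ^ d ≤ s ^ d := by
      refine pow_le_pow_left₀ (by positivity) ?_ d
      nlinarith
    have h4 : (d : ℝ) * (1 / (j + 1)) ≤ d / j := by
      rw [mul_one_div]
      exact div_le_div_of_nonneg_left (by positivity) hj0 (by linarith)
    rw [add_sub_cancel, hs2] at h2
    rw [hs2] at h3
    linarith
  have h5 : (√((j : ℝ) + 1))⁻¹ ^ d = (√(j : ℝ))⁻¹ ^ d * s ^ d := by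
    rw [← mul_pow, hs]
    congr 1
    field_simp
  have h6 : (√(j : ℝ))⁻¹ ^ (d + 2) = (√(j : ℝ))⁻¹ ^ d * (j : ℝ)⁻¹ := by
    rw [pow_add, inv_pow _ 2, Real.sq_sqrt hj0.le]
  rw [h5, h6]
  have h7 : 0 ≤ (√(j : ℝ))⁻¹ ^ d := by positivity
  have := mul_le_mul_of_nonneg_left h1 h7
  calc _ = (√(j : ℝ))⁻¹ ^ d * (1 - s ^ d) := by ring
    _ ≤ (√(j : ℝ))⁻¹ ^ d * (d / j) := mul_le_mul_of_nonneg_left (by linarith) h7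
    _ = _ := by ring

theorem sum_inv_sqrt_pow_mul_le {p : ℕ} {u : ℕ → ℝ} {X Y : ℝ} (hX : 0 ≤ X) (hY : 0 ≤ Y) {N : ℕ}
    (hN : 1 ≤ N) (h0 : ∀ j, 0 ≤ u j)
    (h : ∀ n, 1 ≤ n → n ≤ N →
      ∑ j ∈ Finset.Icc 1 n, u j ≤ X * (n : ℝ) ^ (p + 3) + Y * (n : ℝ) ^ (p + 2)) :
    ∑ j ∈ Finset.Icc 1 N, (√(j : ℝ))⁻¹ ^ (p + 2) * u j ≤
      (p + 3) * (X * √(N : ℝ) ^ (p + 4) + Y * √(N : ℝ) ^ (p + 2)) := by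
  obtain ⟨k, rfl⟩ : ∃ k, N = k + 1 := ⟨N - 1, by omega⟩
  have key : ∀ n, 1 ≤ n → n ≤ k + 1 → (√(n : ℝ))⁻¹ ^ (p + 2) *
      ∑ j ∈ Finset.Icc 1 n, u j ≤ X * √(n : ℝ) ^ (p + 4) + Y * √(n : ℝ) ^ (p + 2) := by
    intro n hn hn'
    have ht : 0 < √(n : ℝ) := Real.sqrt_pos.2 (by exact_mod_cast hn)
    have h1 : (n : ℝ) = √(n : ℝ) ^ 2 := (Real.sq_sqrt (by positivity)).symm
    refine (mul_le_mul_of_nonneg_left (h n hn hn') (by positivity)).trans (le_of_eq ?_)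
    rw [inv_pow]
    set t := √(n : ℝ)
    rw [h1]
    field_simp
    ring
  rw [sum_Icc_mul_eq_add_sum_sub]
  set B := X * √((k + 1 : ℕ) : ℝ) ^ (p + 2) + Y * √((k + 1 : ℕ) : ℝ) ^ p with hB
  have hB0 : 0 ≤ B := by positivity
  have hBB : ((k + 1 : ℕ) : ℝ) * B =
      X * √((k + 1 : ℕ) : ℝ) ^ (p + 4) + Y * √((k + 1 : ℕ) : ℝ) ^ (p + 2) := by
    have h1 : ((k + 1 : ℕ) : ℝ) = √((k + 1 : ℕ) : ℝ) ^ 2 := (Real.sq_sqrt (by positivity)).symm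
    rw [hB]
    set t := √((k + 1 : ℕ) : ℝ)
    rw [h1]
    ring
  have h2 : ∀ j ∈ Finset.Icc 1 k, ((√(j : ℝ))⁻¹ ^ (p + 2) - (√((j + 1 : ℕ) : ℝ))⁻¹ ^ (p + 2)) *
      ∑ i ∈ Finset.Icc 1 j, u i ≤ (p + 2) * B := by
    intro j hj
    rw [Finset.mem_Icc] at hj
    have hj0 : (0 : ℝ) < j := by exact_mod_cast hj.1
    have ht : 0 < √(j : ℝ) := Real.sqrt_pos.2 hj0
    have hU : 0 ≤ ∑ i ∈ Finset.Icc 1 j, u i := Finset.sum_nonneg fun i _ => h0 i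
    have h3 := mul_le_mul_of_nonneg_right (inv_sqrt_pow_sub_le (p + 2) hj.1) hU
    refine h3.trans ?_
    have h4 := key j hj.1 (by omega)
    have h5 : √(j : ℝ) ≤ √((k + 1 : ℕ) : ℝ) := Real.sqrt_le_sqrt (by exact_mod_cast (by omega))
    have h6 : X * √(j : ℝ) ^ (p + 2) + Y * √(j : ℝ) ^ p ≤ B := by
      rw [hB]
      gcongr
    push_cast
    rw [mul_assoc]
    refine mul_le_mul_of_nonneg_left (le_trans ?_ h6) (by positivity)
    rw [pow_add _ (p + 2) 2, mul_comm (_ ^ (p + 2)), mul_assoc]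
    refine (mul_le_mul_of_nonneg_left h4 (by positivity)).trans (le_of_eq ?_)
    rw [inv_pow]
    field_simp
    ring
  have h7 := Finset.sum_le_card_nsmul _ _ _ h2
  rw [Nat.card_Icc, nsmul_eq_mul, add_tsub_cancel_right] at h7
  have h8 := key (k + 1) (by omega) le_rfl
  have h9 : (k : ℝ) * ((p + 2) * B) ≤ ((k + 1 : ℕ) : ℝ) * ((p + 2) * B) := by
    refine mul_le_mul_of_nonneg_right ?_ (by positivity)
    push_cast
    linarith
  rw [mul_left_comm ((k + 1 : ℕ) : ℝ), hBB] at h9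
  linarith

theorem sum_inv_mul_le {u : ℕ → ℝ} {E : ℝ} (hE : 0 ≤ E) {N : ℕ} (hN : 1 ≤ N)
    (h : ∀ n, 1 ≤ n → n ≤ N → ∑ j ∈ Finset.Icc 1 n, u j ≤ n * E) :
    ∑ j ∈ Finset.Icc 1 N, (j : ℝ)⁻¹ * u j ≤ (1 + Real.log N) * E := by
  obtain ⟨k, rfl⟩ : ∃ k, N = k + 1 := ⟨N - 1, by omega⟩
  have h1 : ∀ j ∈ Finset.Icc 1 k, ((j : ℝ)⁻¹ - ((j + 1 : ℕ) : ℝ)⁻¹) *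
      ∑ i ∈ Finset.Icc 1 j, u i ≤ ((j + 1 : ℕ) : ℝ)⁻¹ * E := by
    intro j hj
    rw [Finset.mem_Icc] at hj
    have hj0 : (0 : ℝ) < j := by exact_mod_cast hj.1
    have h2 : (j : ℝ)⁻¹ - ((j + 1 : ℕ) : ℝ)⁻¹ = (j : ℝ)⁻¹ * ((j + 1 : ℕ) : ℝ)⁻¹ := by
      push_cast
      field_simp
      ring
    rw [h2]
    refine (mul_le_mul_of_nonneg_left (h j hj.1 (by omega)) (by positivity)).trans (le_of_eq ?_)
    push_cast
    field_simp
  have h3 := h (k + 1) (by omega) le_rfl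
  have h4 : ((k + 1 : ℕ) : ℝ)⁻¹ * ∑ j ∈ Finset.Icc 1 (k + 1), u j ≤ E := by
    rw [inv_mul_le_iff₀ (by positivity)]
    exact h3
  have h5 : ∀ k : ℕ, 1 + ∑ j ∈ Finset.Icc 1 k, ((j + 1 : ℕ) : ℝ)⁻¹ =
      ((harmonic (k + 1) : ℚ) : ℝ) := by
    intro k
    induction k with
    | zero => simp
    | succ k ih =>
      rw [harmonic_succ, Finset.sum_Icc_succ_top (by omega), ← add_assoc, ih]
      push_cast
      ring
  rw [sum_Icc_mul_eq_add_sum_sub]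
  have h6 := Finset.sum_le_sum h1
  rw [← Finset.sum_mul] at h6
  have h7 := harmonic_le_one_add_log (k + 1)
  rw [← h5] at h7
  have := mul_le_mul_of_nonneg_right h7 hE
  linarith

end AbelSummation

section RationalPoints

/-- The pairs `⟨q, a⟩` of a denominator `1 ≤ q ≤ Q` and a numerator `a` in the box of radius
`R * q`. -/
noncomputable def ratBox (m R Q : ℕ) : Finset (Σ _ : ℕ, Fin m → ℤ) :=
  (Finset.Icc 1 Q).sigma fun q => intBox m (R * q)

/-- The rational point `a / q`. -/
noncomputable def ratPt {m : ℕ} (i : Σ _ : ℕ, Fin m → ℤ) : Fin m → ℝ :=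
  (i.1 : ℝ)⁻¹ • intVec i.2

/-- The value `q * f (a / q)`. -/
noncomputable def ratVal {m : ℕ} (f : (Fin m → ℝ) → ℝ) (i : Σ _ : ℕ, Fin m → ℤ) : ℝ :=
  i.1 * f (ratPt i)

/-- The weighted number of rational points `a / q` with `1 ≤ q ≤ Q` and
`‖q * f (a / q) - θ‖ ≤ δ`. -/
noncomputable def ratCount {m : ℕ} (f w : (Fin m → ℝ) → ℝ) (R Q : ℕ) (δ θ : ℝ) : ℝ :=
  ∑ i ∈ ratBox m R Q, if nint (ratVal f i - θ) ≤ δ then w (ratPt i) else 0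

/-- The exponential sum over rational points with denominators up to `Q`. -/
noncomputable def ratSum {m : ℕ} (f w : (Fin m → ℝ) → ℝ) (R Q : ℕ) (j : ℝ) : ℂ :=
  expSum (ratBox m R Q) (fun i => w (ratPt i)) (ratVal f) j

variable {m : ℕ} {D D' : Set (Fin m → ℝ)} {f f' w : (Fin m → ℝ) → ℝ}

theorem ratSum_eq (f w : (Fin m → ℝ) → ℝ) (R Q : ℕ) (j : ℝ) :
    ratSum f w R Q j = ∑ q ∈ Finset.Icc 1 Q, weylSum f w R j q := by
  rw [ratSum, expSum, ratBox, Finset.sum_sigma]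
  rfl

theorem sum_kernSum_eq (f w : (Fin m → ℝ) → ℝ) (R n : ℕ) (Q : ℝ) :
    ∑ j ∈ Finset.Icc 1 n, kernSum f w R j Q =
      ∑ i ∈ ratBox m R n, |w (ratPt i)| * kern Q (ratVal f i) := by
  rw [ratBox, Finset.sum_sigma]
  rfl

theorem sum_ratBox_le {v : (Fin m → ℝ) → ℝ} {B : ℝ} (hB : 0 ≤ B) (hv : ∀ x, v x ≤ B) (R Q : ℕ) :
    ∑ i ∈ ratBox m R Q, v (ratPt i) ≤ B * (2 * R + 1) ^ m * (Q : ℝ) ^ (m + 1) := by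
  rw [ratBox, Finset.sum_sigma]
  have h1 : ∀ q ∈ Finset.Icc 1 Q, ∑ a ∈ intBox m (R * q), v (ratPt ⟨q, a⟩) ≤
      B * (2 * R + 1) ^ m * (Q : ℝ) ^ m := by
    intro q hq
    rw [Finset.mem_Icc] at hq
    have h2 := Finset.sum_le_card_nsmul (intBox m (R * q)) (fun a => v (ratPt ⟨q, a⟩)) B
      fun a _ => hv _
    rw [nsmul_eq_mul] at h2
    have h3 := card_intBox_le (m := m) R hq.1
    have h4 : (q : ℝ) ^ m ≤ (Q : ℝ) ^ m :=
      pow_le_pow_left₀ (by positivity) (by exact_mod_cast hq.2) m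
    calc _ ≤ _ := h2
      _ ≤ ((2 * R + 1) ^ m * (q : ℝ) ^ m) * B := mul_le_mul_of_nonneg_right h3 hB
      _ ≤ ((2 * R + 1) ^ m * (Q : ℝ) ^ m) * B := by gcongr
      _ = _ := by ring
  have h5 := Finset.sum_le_card_nsmul _ _ _ h1
  rw [Nat.card_Icc, nsmul_eq_mul, add_tsub_cancel_right] at h5
  exact h5.trans (le_of_eq (by ring))

theorem ratCount_le {v : (Fin m → ℝ) → ℝ} (hv0 : ∀ x, 0 ≤ v x) {B : ℝ} (hB : 0 ≤ B)
    (hv : ∀ x, v x ≤ B) (R Q : ℕ) (δ θ : ℝ) :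
    ratCount f v R Q δ θ ≤ B * (2 * R + 1) ^ m * (Q : ℝ) ^ (m + 1) := by
  refine le_trans (Finset.sum_le_sum fun i _ => ?_) (sum_ratBox_le hB hv R Q)
  split_ifs
  · exact le_rfl
  · exact hv0 _

theorem ratCount_mono {v : (Fin m → ℝ) → ℝ} (hv0 : ∀ x, 0 ≤ v x) (R Q : ℕ) {δ δ' : ℝ}
    (hδ : δ ≤ δ') (θ : ℝ) : ratCount f v R Q δ θ ≤ ratCount f v R Q δ' θ := by
  refine Finset.sum_le_sum fun i _ => ?_
  split_ifs with h1 h2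
  · exact le_rfl
  · exact absurd (h1.trans hδ) h2
  · exact hv0 _
  · exact le_rfl

theorem norm_ratSum_le {B : ℝ} (hB : 0 ≤ B) (hv : ∀ x, |w x| ≤ B) (R Q : ℕ) (j : ℝ) :
    ‖ratSum f w R Q j‖ ≤ B * (2 * R + 1) ^ m * (Q : ℝ) ^ (m + 1) := by
  refine le_trans (norm_sum_le _ _) (le_trans (Finset.sum_le_sum fun i _ => ?_)
    (sum_ratBox_le hB hv R Q))
  rw [norm_mul, norm_turn, mul_one, Complex.norm_real, Real.norm_eq_abs]

/-- A logarithmic weight that is at least `1`. -/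
noncomputable def ell (Q : ℕ) : ℝ := 1 + 2 * Real.log Q

theorem one_le_ell (Q : ℕ) : 1 ≤ ell Q := by
  have := Real.log_natCast_nonneg Q
  rw [ell]
  linarith

theorem ell_mono {P Q : ℕ} (hP : 1 ≤ P) (h : P ≤ Q) : ell P ≤ ell Q := by
  have := Real.log_le_log (by exact_mod_cast hP : (0 : ℝ) < P) (by exact_mod_cast h : (P : ℝ) ≤ Q)
  rw [ell, ell]
  linarith

theorem natLog_add_one_le_ell (Q : ℕ) : (Nat.log 2 Q : ℝ) + 1 ≤ ell Q := by
  have h1 : (Nat.log 2 Q : ℝ) ≤ Real.logb 2 Q := by exact_mod_cast Real.natLog_le_logb Q 2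
  have h2 : Real.logb 2 Q ≤ 2 * Real.log Q := by
    rw [Real.logb, div_le_iff₀ (Real.log_pos one_lt_two)]
    have h3 := Real.log_natCast_nonneg Q
    have h4 := Real.log_two_gt_d9
    nlinarith
  rw [ell]
  linarith

theorem sum_mul_kern_ratVal_le {v : (Fin m → ℝ) → ℝ} (hv0 : ∀ x, 0 ≤ v x) {R n M : ℕ} (hM : 1 ≤ M)
    {X Y θ : ℝ} (hX : 0 ≤ X) (hY : 0 ≤ Y) (h : ∀ δ > 0, ratCount f v R n δ θ ≤ δ * X + Y) :
    ∑ i ∈ ratBox m R n, v (ratPt i) * kern M (ratVal f i - θ) ≤ 2 * (ell M * X + 2 * M * Y) := by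
  refine (sum_mul_kern_le (ratBox m R n) (W := fun i => v (ratPt i)) (fun i _ => hv0 _)
    (fun i => ratVal f i - θ) hM hY h).trans ?_
  have := mul_le_mul_of_nonneg_right (natLog_add_one_le_ell M) hX
  linarith

theorem IsLegendrePair.exists_sum_norm_ratSum_le {p : ℕ} {D D' : Set (Fin (p + 2) → ℝ)}
    {f f' w : (Fin (p + 2) → ℝ) → ℝ} (h : IsLegendrePair D f D' f') (hw : IsWeight D w)
    {R R' : ℕ} (hR : ∀ x, (R : ℝ) < ‖x‖ → w x = 0)
    (hR' : ∀ y, (R' : ℝ) < ‖y‖ → dualWeight D' f' w y = 0)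
    {v' : (Fin (p + 2) → ℝ) → ℝ} (hv' : ∀ y, |dualWeight D' f' w y| ≤ v' y) :
    ∃ C, 0 ≤ C ∧ ∀ (A : ℝ) (H : ℕ → ℝ), 0 ≤ A → (∀ n, 0 ≤ H n) →
      (∀ i j, 1 ≤ i → i ≤ j → H i ≤ H j) →
      ∀ n Q : ℕ, 1 ≤ n → n ≤ Q →
      (∀ J, 1 ≤ J → J ≤ n → ∀ δ > 0, ratCount f' v' R' J δ 0 ≤
        A * (δ * (J : ℝ) ^ (p + 3) + (J : ℝ) ^ (p + 2) * H J)) →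
      ∑ j ∈ Finset.Icc 1 n, ‖ratSum f w R Q j‖ ≤ C * (n * (A * (ell Q * (√Q ^ (p + 2) *
        √n ^ (p + 2)) + H n * (Q * (√Q ^ (p + 2) * √n ^ p))) + (Q : ℝ) ^ (p + 2))) := by
  obtain ⟨C, hC, hT⟩ := h.exists_norm_sum_weylSum_le hw (by omega) hR hR'
  have hv0 : ∀ y, 0 ≤ v' y := fun y => (abs_nonneg _).trans (hv' y)
  refine ⟨4 * C * (p + 3), by positivity, fun A H hA hH hmono n Q hn hnQ hcnt => ?_⟩
  have hQ : 1 ≤ Q := hn.trans hnQ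
  have hQ1 : (1 : ℝ) ≤ Q := by exact_mod_cast hQ
  have hnQ' : (n : ℝ) ≤ Q := by exact_mod_cast hnQ
  have hell := one_le_ell Q
  have hk0 : ∀ j, 0 ≤ kernSum f' (dualWeight D' f' w) R' j Q := fun j =>
    Finset.sum_nonneg fun a _ => mul_nonneg (abs_nonneg _) (kern_nonneg _ _)
  have hk : ∀ N, 1 ≤ N → N ≤ n → ∑ j ∈ Finset.Icc 1 N, kernSum f' (dualWeight D' f' w) R' j Q ≤
      2 * A * ell Q * (N : ℝ) ^ (p + 3) + 4 * A * Q * H n * (N : ℝ) ^ (p + 2) := by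
    intro N hN hNn
    rw [sum_kernSum_eq]
    have h1 := sum_mul_kern_ratVal_le (f := f') hv0 (R := R') (n := N) hQ (θ := 0)
      (X := A * (N : ℝ) ^ (p + 3)) (Y := A * ((N : ℝ) ^ (p + 2) * H N)) (by positivity)
      (mul_nonneg hA (mul_nonneg (by positivity) (hH N)))
      fun δ hδ => (hcnt N hN hNn δ hδ).trans (le_of_eq (by ring))
    simp only [sub_zero] at h1
    have h2 : A * ((N : ℝ) ^ (p + 2) * H N) ≤ A * ((N : ℝ) ^ (p + 2) * H n) := by
      have := hmono N n hN hNn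
      gcongr
    have h3 := mul_le_mul_of_nonneg_left h2 (by positivity : (0 : ℝ) ≤ 4 * Q)
    calc _ ≤ ∑ i ∈ ratBox (p + 2) R' N, v' (ratPt i) * kern Q (ratVal f' i) :=
          Finset.sum_le_sum fun i _ => mul_le_mul_of_nonneg_right (hv' _) (kern_nonneg _ _)
      _ ≤ _ := h1
      _ ≤ _ := by linarith
  have hX : 0 ≤ 2 * A * ell Q := by positivity
  have hY : 0 ≤ 4 * A * Q * H n := mul_nonneg (by positivity) (hH n)
  have h4 := sum_inv_sqrt_pow_mul_le hX hY hn hk0 hk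
  have h5 : ∀ j ∈ Finset.Icc 1 n, ‖ratSum f w R Q j‖ ≤ C * √Q ^ (p + 2) * ((√(j : ℝ))⁻¹ ^ (p + 2) *
      kernSum f' (dualWeight D' f' w) R' j Q) + 2 * C * (Q : ℝ) ^ (p + 2) := by
    intro j hj
    rw [Finset.mem_Icc] at hj
    rw [ratSum_eq]
    refine (hT j Q hj.1 hQ).trans ?_
    have h6 : √(Q : ℝ) ^ (p + 2 + 1) * √(j : ℝ) ^ (p + 2 - 1) ≤ (Q : ℝ) ^ (p + 2) := by
      have h7 : √(j : ℝ) ≤ √(Q : ℝ) := Real.sqrt_le_sqrt (by exact_mod_cast hj.2.trans hnQ)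
      calc _ ≤ √(Q : ℝ) ^ (p + 2 + 1) * √(Q : ℝ) ^ (p + 2 - 1) := by gcongr
        _ = (√(Q : ℝ) ^ 2) ^ (p + 2) := by
          rw [← pow_add, ← pow_mul]
          congr 1
          omega
        _ = _ := by rw [Real.sq_sqrt (by linarith)]
    have h8 : (Q : ℝ) ≤ (Q : ℝ) ^ (p + 2) := le_self_pow₀ hQ1 (by omega)
    have := mul_le_mul_of_nonneg_left (add_le_add h6 h8) hC
    linarith
  refine (Finset.sum_le_sum h5).trans ?_
  rw [Finset.sum_add_distrib, ← Finset.mul_sum, Finset.sum_const, Nat.card_Icc, nsmul_eq_mul,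
    add_tsub_cancel_right]
  have h9 := mul_le_mul_of_nonneg_left h4 (by positivity : 0 ≤ C * √(Q : ℝ) ^ (p + 2))
  refine (add_le_add_left h9 _).trans ?_
  have hn2 : (n : ℝ) = √(n : ℝ) ^ 2 := (Real.sq_sqrt (by positivity)).symm
  have e1 : √(n : ℝ) ^ (p + 4) = n * √(n : ℝ) ^ (p + 2) := by
    conv_rhs => rw [hn2, Real.sqrt_sq (Real.sqrt_nonneg _)]
    ring
  have e2 : √(n : ℝ) ^ (p + 2) = n * √(n : ℝ) ^ p := by
    conv_rhs => rw [hn2, Real.sqrt_sq (Real.sqrt_nonneg _)]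
    ring
  rw [e1]
  conv_lhs => rw [e2]
  have n1 : 0 ≤ C * ↑n * A * ell Q * √(Q : ℝ) ^ (p + 2) * √(n : ℝ) ^ (p + 2) := by positivity
  have n2 : 0 ≤ C * n * (Q : ℝ) ^ (p + 2) := by positivity
  have n3 : 0 ≤ (p : ℝ) := by positivity
  rw [e2] at *
  nlinarith [mul_nonneg n3 n1, mul_nonneg n3 n2]

theorem IsLegendrePair.exists_ratCount_le {p : ℕ} {D D' : Set (Fin (p + 2) → ℝ)}
    {f f' w : (Fin (p + 2) → ℝ) → ℝ} (h : IsLegendrePair D f D' f') (hw : IsWeight D w)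
    (hw0 : ∀ x, 0 ≤ w x) {R R' : ℕ} (hR : ∀ x, (R : ℝ) < ‖x‖ → w x = 0)
    (hR' : ∀ y, (R' : ℝ) < ‖y‖ → dualWeight D' f' w y = 0) :
    ∃ C, 0 ≤ C ∧ ∀ (A : ℝ) (H : ℕ → ℝ), 0 ≤ A → (∀ n, 0 ≤ H n) →
      (∀ i j, 1 ≤ i → i ≤ j → H i ≤ H j) →
      ∀ n Q : ℕ, 1 ≤ n → n ≤ Q →
      (∀ J, 1 ≤ J → J ≤ n → ∀ δ > 0, ratCount f' (dualWeight D' f' w) R' J δ 0 ≤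
        A * (δ * (J : ℝ) ^ (p + 3) + (J : ℝ) ^ (p + 2) * H J)) →
      ∀ θ, ratCount f w R Q (1 / (16 * n)) θ ≤ C * ((Q : ℝ) ^ (p + 3) / n + A * (ell Q *
        (√Q ^ (p + 2) * √n ^ (p + 2)) + H n * (Q * (√Q ^ (p + 2) * √n ^ p))) +
        (Q : ℝ) ^ (p + 2)) := by
  have hd0 : ∀ y, |dualWeight D' f' w y| ≤ dualWeight D' f' w y := fun y => by
    rw [abs_of_nonneg (dualWeight_nonneg hw0 y)]
  obtain ⟨C, hC, hU⟩ := h.exists_sum_norm_ratSum_le hw hR hR' hd0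
  obtain ⟨B, hB⟩ := hw.hasCompactSupport.exists_bound_of_continuous hw.contDiff.continuous
  have hB0 : 0 ≤ B := (norm_nonneg _).trans (hB 0)
  set B' := B * (2 * R + 1) ^ (p + 2) with hB'
  have hB'0 : 0 ≤ B' := by positivity
  refine ⟨4 * B' + 8 * C, by positivity, fun A H hA hH hmono n Q hn hnQ hcnt θ => ?_⟩
  have h1 := sum_nint_le_of_expSum (ratBox (p + 2) R Q) (W := fun i => w (ratPt i))
    (fun i _ => hw0 _) (ratVal f) θ hn
  have h2 := hU A H hA hH hmono n Q hn hnQ hcnt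
  have h3 := norm_ratSum_le (f := f) hB0 hB R Q 0
  refine h1.trans ?_
  change 4 / (n : ℝ) * (‖ratSum f w R Q 0‖ + 2 * ∑ j ∈ Finset.Icc 1 n, ‖ratSum f w R Q j‖) ≤ _
  have hn0 : (0 : ℝ) < n := by exact_mod_cast hn
  have hell := one_le_ell Q
  have hHn := hH n
  set T := A * (ell Q * (√(Q : ℝ) ^ (p + 2) * √(n : ℝ) ^ (p + 2)) +
    H n * (Q * (√(Q : ℝ) ^ (p + 2) * √(n : ℝ) ^ p))) with hT
  have hT0 : 0 ≤ T := by positivity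
  calc _ ≤ 4 / (n : ℝ) * (B' * (Q : ℝ) ^ (p + 2 + 1) + 2 * (C * (n * (T + (Q : ℝ) ^ (p + 2))))) := by
        gcongr
    _ = 4 * B' * ((Q : ℝ) ^ (p + 3) / n) + 8 * C * (T + (Q : ℝ) ^ (p + 2)) := by
        field_simp
        ring
    _ ≤ _ := by
        have n1 : 0 ≤ B' * (T + (Q : ℝ) ^ (p + 2)) := by positivity
        have n2 : 0 ≤ C * ((Q : ℝ) ^ (p + 3) / n) := by positivity
        linarith

end RationalPoints

section Bootstrap

/-- Growth conditions on the error term `H` under which the bootstrapping of the counting function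
closes up. -/
structure IsGauge (p : ℕ) (C : ℝ) (H : ℕ → ℝ) : Prop where
  two_le : ∀ n, 2 ≤ H n
  mono : ∀ i j, 1 ≤ i → i ≤ j → H i ≤ H j
  ell_le : ∀ Q, 4 * C * ell Q ≤ H Q ^ 2
  contract : ∀ J Q : ℕ, 1 ≤ J → J * H Q ≤ Q → 4 * C * (√(J : ℝ) ^ p * H J) ≤ √(Q : ℝ) ^ p * H Q

theorem exists_scale {Q : ℕ} {h δ : ℝ} (hh : 2 ≤ h) (hhQ : h ≤ Q) (hδ : 0 < δ) (hδ' : δ ≤ 1 / 16) :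
    ∃ J : ℕ, 1 ≤ J ∧ J < Q ∧ J * h ≤ Q ∧ δ ≤ 1 / (16 * J) ∧ 1 / (J : ℝ) ≤ 2 * h / Q + 32 * δ := by
  have hQ0 : (0 : ℝ) < Q := by linarith
  have half : ∀ {x : ℝ}, 1 ≤ x → 1 ≤ ⌊x⌋₊ ∧ x / 2 ≤ (⌊x⌋₊ : ℝ) := by
    intro x hx
    have h1 : 1 ≤ ⌊x⌋₊ := Nat.one_le_floor_iff x |>.2 hx
    refine ⟨h1, ?_⟩
    have h2 := Nat.lt_floor_add_one x
    have h3 : (1 : ℝ) ≤ ⌊x⌋₊ := by exact_mod_cast h1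
    linarith
  have a1 : 1 ≤ (Q : ℝ) / h := by rwa [le_div_iff₀ (by linarith), one_mul]
  have a2 : 1 ≤ 1 / (16 * δ) := by
    rw [le_div_iff₀ (by positivity)]
    linarith
  have key : ∀ J : ℕ, 1 ≤ J → (J : ℝ) ≤ Q / h → (J : ℝ) ≤ 1 / (16 * δ) →
      (Q / h / 2 ≤ (J : ℝ) ∨ 1 / (16 * δ) / 2 ≤ (J : ℝ)) → 1 ≤ J ∧ J < Q ∧ J * h ≤ Q ∧
      δ ≤ 1 / (16 * J) ∧ 1 / (J : ℝ) ≤ 2 * h / Q + 32 * δ := by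
    intro J hJ h1 h2 h3
    have hJ1 : (1 : ℝ) ≤ J := by exact_mod_cast hJ
    have h4 : J * h ≤ Q := (le_div_iff₀ (by linarith)).1 h1
    refine ⟨hJ, ?_, h4, ?_, ?_⟩
    · have : (J : ℝ) < Q := by nlinarith
      exact_mod_cast this
    · rw [le_div_iff₀ (by positivity)] at h2 ⊢
      linarith
    · have p1 : 0 < 2 * h / Q := by positivity
      rcases h3 with h3 | h3
      · have : 1 / (J : ℝ) ≤ 2 * h / Q := by
          rw [div_div, div_le_iff₀ (by positivity)] at h3
          rw [div_le_div_iff₀ (by linarith) hQ0]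
          linarith
        linarith
      · have : 1 / (J : ℝ) ≤ 32 * δ := by
          rw [div_div, div_le_iff₀ (by positivity)] at h3
          rw [div_le_iff₀ (by linarith)]
          linarith
        linarith
  rcases le_total ((Q : ℝ) / h) (1 / (16 * δ)) with hc | hc
  · have h1 := Nat.floor_le (zero_le_one.trans a1)
    exact ⟨_, key _ (half a1).1 h1 (h1.trans hc) (Or.inl (half a1).2)⟩
  · have h1 := Nat.floor_le (zero_le_one.trans a2)
    exact ⟨_, key _ (half a2).1 (h1.trans hc) h1 (Or.inr (half a2).2)⟩

theorem weighted_count_bootstrap {p : ℕ} {C C₃ A : ℝ} {H : ℕ → ℝ} (hC : 1 ≤ C)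
    (hH : IsGauge p C H) (hA1 : 16 * C₃ ≤ A) (hA2 : 32 * C ≤ A) {Q : ℕ} (hQ : 1 ≤ Q)
    {F : ℝ → ℝ → ℝ} (hFm : ∀ δ δ' θ, δ ≤ δ' → F δ θ ≤ F δ' θ)
    (hF3 : ∀ δ θ, F δ θ ≤ C₃ * (Q : ℝ) ^ (p + 3))
    (hstep : ∀ J : ℕ, 1 ≤ J → J < Q → ∀ θ, F (1 / (16 * J)) θ ≤ C * ((Q : ℝ) ^ (p + 3) / J +
      A * (ell Q * (√Q ^ (p + 2) * √J ^ (p + 2)) + H J * (Q * (√Q ^ (p + 2) * √J ^ p))) +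
        (Q : ℝ) ^ (p + 2)))
    {δ : ℝ} (hδ : 0 < δ) (θ : ℝ) :
    F δ θ ≤ A * (δ * (Q : ℝ) ^ (p + 3) + (Q : ℝ) ^ (p + 2) * H Q) := by
  have hQ1 : (1 : ℝ) ≤ Q := by exact_mod_cast hQ
  have hH2 := hH.two_le Q
  have hA0 : 0 ≤ A := by linarith
  have n1 : 0 ≤ A * (δ * (Q : ℝ) ^ (p + 3)) := by positivity
  have n2 : 0 ≤ A * ((Q : ℝ) ^ (p + 2) * H Q) := by positivity
  by_cases hδ' : 1 / 16 ≤ δ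
  · refine (hF3 δ θ).trans ?_
    have : C₃ * (Q : ℝ) ^ (p + 3) ≤ A * (1 / 16) * (Q : ℝ) ^ (p + 3) := by
      gcongr
      linarith
    have : A * (1 / 16) * (Q : ℝ) ^ (p + 3) ≤ A * δ * (Q : ℝ) ^ (p + 3) := by gcongr
    linarith
  by_cases hHQ : (Q : ℝ) ≤ H Q
  · refine (hF3 δ θ).trans ?_
    have : C₃ * (Q : ℝ) ^ (p + 3) ≤ A * ((Q : ℝ) ^ (p + 2) * H Q) := by
      rw [pow_succ _ (p + 2)]
      gcongr
      linarith
    linarith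
  push Not at hδ' hHQ
  obtain ⟨J, hJ, hJQ, hJH, hJδ, hJinv⟩ := exists_scale hH2 hHQ.le hδ hδ'.le
  refine (hFm _ _ θ hJδ).trans ((hstep J hJ hJQ θ).trans ?_)
  have hQ0 : (0 : ℝ) < Q := by linarith
  have hJ0 : (0 : ℝ) < J := by exact_mod_cast hJ
  have b1 : (Q : ℝ) ^ (p + 3) / J ≤ 2 * ((Q : ℝ) ^ (p + 2) * H Q) + 32 * (δ * (Q : ℝ) ^ (p + 3)) := by
    calc (Q : ℝ) ^ (p + 3) / J = (Q : ℝ) ^ (p + 3) * (1 / J) := by ring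
      _ ≤ (Q : ℝ) ^ (p + 3) * (2 * H Q / Q + 32 * δ) := by gcongr
      _ = _ := by
        field_simp
        ring
  have b2 : (Q : ℝ) ^ (p + 2) ≤ (Q : ℝ) ^ (p + 2) * H Q := le_mul_of_one_le_right (by positivity)
    (by linarith)
  have hs2 : √(Q : ℝ) ^ 2 = Q := Real.sq_sqrt hQ0.le
  have hsJ : √(J : ℝ) ^ 2 = J := Real.sq_sqrt hJ0.le
  have hsle : √(J : ℝ) ≤ √(Q : ℝ) := Real.sqrt_le_sqrt (by exact_mod_cast hJQ.le)
  have eQ : √(Q : ℝ) ^ (p + 2) * √(Q : ℝ) ^ p * Q = (Q : ℝ) ^ (p + 2) := by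
    calc _ = √(Q : ℝ) ^ (p + 2) * √(Q : ℝ) ^ p * √(Q : ℝ) ^ 2 := by rw [hs2]
      _ = (√(Q : ℝ) ^ 2) ^ (p + 2) := by ring
      _ = _ := by rw [hs2]
  have b3 : C * (ell Q * (√(Q : ℝ) ^ (p + 2) * √(J : ℝ) ^ (p + 2))) ≤
      (Q : ℝ) ^ (p + 2) * H Q / 4 := by
    have h1 : √(J : ℝ) ^ (p + 2) * H Q ≤ √(Q : ℝ) ^ p * Q := by
      calc √(J : ℝ) ^ (p + 2) * H Q = √(J : ℝ) ^ p * (J * H Q) := by rw [pow_add, hsJ, mul_assoc]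
        _ ≤ √(Q : ℝ) ^ p * Q := by gcongr
    have h2 := hH.ell_le Q
    have h3 : 4 * C * ell Q * (√(J : ℝ) ^ (p + 2)) ≤ √(Q : ℝ) ^ p * Q * H Q := by
      calc _ ≤ H Q ^ 2 * √(J : ℝ) ^ (p + 2) := mul_le_mul_of_nonneg_right h2 (by positivity)
        _ = √(J : ℝ) ^ (p + 2) * H Q * H Q := by ring
        _ ≤ _ := mul_le_mul_of_nonneg_right h1 (by linarith)
    have h4 := mul_le_mul_of_nonneg_left h3 (by positivity : 0 ≤ √(Q : ℝ) ^ (p + 2))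
    rw [← eQ]
    linarith
  have b4 : C * (H J * (Q * (√(Q : ℝ) ^ (p + 2) * √(J : ℝ) ^ p))) ≤
      (Q : ℝ) ^ (p + 2) * H Q / 4 := by
    have h1 := hH.contract J Q hJ hJH
    have h4 := mul_le_mul_of_nonneg_left h1 (by positivity : 0 ≤ √(Q : ℝ) ^ (p + 2) * Q)
    rw [← eQ]
    linarith
  have c1 := mul_le_mul_of_nonneg_left (add_le_add b3 b4) hA0
  have c2 := mul_le_mul_of_nonneg_left (add_le_add b1 b2) (by linarith : 0 ≤ C)
  have c3 := mul_le_mul_of_nonneg_right hA2 (by positivity : 0 ≤ δ * (Q : ℝ) ^ (p + 3))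
  have c4 := mul_le_mul_of_nonneg_right hA2 (by positivity : 0 ≤ (Q : ℝ) ^ (p + 2) * H Q)
  have c5 : 0 ≤ C * ((Q : ℝ) ^ (p + 2) * H Q) := by positivity
  linarith

theorem IsLegendrePair.exists_ratCount_le_of_isGauge {p : ℕ} {D D' : Set (Fin (p + 2) → ℝ)}
    {f f' w : (Fin (p + 2) → ℝ) → ℝ} (h : IsLegendrePair D f D' f') (hw : IsWeight D w)
    (hw0 : ∀ x, 0 ≤ w x) {R R' : ℕ} (hR : ∀ x, (R : ℝ) < ‖x‖ → w x = 0)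
    (hR' : ∀ y, (R' : ℝ) < ‖y‖ → dualWeight D' f' w y = 0) :
    ∃ C, 1 ≤ C ∧ ∃ A, 0 ≤ A ∧ ∀ H : ℕ → ℝ, IsGauge p C H → ∀ Q : ℕ, 1 ≤ Q → ∀ δ > 0, ∀ θ,
      ratCount f w R Q δ θ ≤ A * (δ * (Q : ℝ) ^ (p + 3) + (Q : ℝ) ^ (p + 2) * H Q) ∧
      ratCount f' (dualWeight D' f' w) R' Q δ θ ≤
        A * (δ * (Q : ℝ) ^ (p + 3) + (Q : ℝ) ^ (p + 2) * H Q) := by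
  set w' := dualWeight D' f' w with hw'def
  have hw' : IsWeight D' w' := h.isWeight_dualWeight hw
  have hw'0 : ∀ y, 0 ≤ w' y := dualWeight_nonneg hw0
  have hdd : dualWeight D f w' = w := h.dualWeight_dualWeight hw
  obtain ⟨B, hB⟩ := hw.hasCompactSupport.exists_bound_of_continuous hw.contDiff.continuous
  obtain ⟨B', hB'⟩ := hw'.hasCompactSupport.exists_bound_of_continuous hw'.contDiff.continuous
  have hB0 : 0 ≤ B := (norm_nonneg _).trans (hB 0)
  have hB'0 : 0 ≤ B' := (norm_nonneg _).trans (hB' 0)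
  obtain ⟨C₁, hC₁, hs1⟩ := h.exists_ratCount_le hw hw0 hR hR'
  obtain ⟨C₂, hC₂, hs2⟩ := h.symm.exists_ratCount_le hw' hw'0 hR' (by rwa [hdd])
  rw [hdd] at hs2
  set E := B * (2 * R + 1) ^ (p + 2) with hE
  set E' := B' * (2 * R' + 1) ^ (p + 2) with hE'
  have hE0 : 0 ≤ E := by positivity
  have hE'0 : 0 ≤ E' := by positivity
  have htriv : ∀ (Q : ℕ) δ θ, ratCount f w R Q δ θ ≤ (E + E') * (Q : ℝ) ^ (p + 3) := fun Q δ θ =>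
    (ratCount_le hw0 hB0 (fun x => (le_abs_self _).trans (hB x)) R Q δ θ).trans (by
      have : 0 ≤ E' * (Q : ℝ) ^ (p + 3) := by positivity
      rw [add_mul]
      exact le_add_of_nonneg_right this)
  have htriv' : ∀ (Q : ℕ) δ θ, ratCount f' w' R' Q δ θ ≤ (E + E') * (Q : ℝ) ^ (p + 3) :=
    fun Q δ θ =>
    (ratCount_le hw'0 hB'0 (fun x => (le_abs_self _).trans (hB' x)) R' Q δ θ).trans (by
      have : 0 ≤ E * (Q : ℝ) ^ (p + 3) := by positivity
      rw [add_mul]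
      exact le_add_of_nonneg_left this)
  set C := 1 + C₁ + C₂ with hC
  have hC1 : 1 ≤ C := by linarith
  set A := 16 * (E + E') + 32 * C with hA
  have hA0 : 0 ≤ A := by positivity
  refine ⟨C, hC1, A, hA0, fun H hH Q => ?_⟩
  have hH0 : ∀ n, 0 ≤ H n := fun n => by linarith [hH.two_le n]
  induction Q using Nat.strong_induction_on with
  | _ Q ih =>
    intro hQ δ hδ θ
    have hell := one_le_ell Q
    have up : ∀ (c : ℝ) (J : ℕ), c ≤ C → c * ((Q : ℝ) ^ (p + 3) / J +
        A * (ell Q * (√Q ^ (p + 2) * √J ^ (p + 2)) + H J * (Q * (√Q ^ (p + 2) * √J ^ p))) +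
        (Q : ℝ) ^ (p + 2)) ≤ C * ((Q : ℝ) ^ (p + 3) / J +
        A * (ell Q * (√Q ^ (p + 2) * √J ^ (p + 2)) + H J * (Q * (√Q ^ (p + 2) * √J ^ p))) +
        (Q : ℝ) ^ (p + 2)) := by
      intro c J hc
      have := hH0 J
      exact mul_le_mul_of_nonneg_right hc (by positivity)
    constructor
    · refine weighted_count_bootstrap hC1 hH (by linarith) (by linarith) hQ
        (F := ratCount f w R Q) (fun δ δ' θ h => ratCount_mono hw0 R Q h θ) (htriv Q)
        (fun J hJ hJQ θ => ?_) hδ θ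
      exact (hs1 A H hA0 hH0 hH.mono J Q hJ hJQ.le (fun J' hJ' hJJ δ hδ =>
        (ih J' (by omega) hJ' δ hδ 0).2) θ).trans (up _ _ (by linarith))
    · refine weighted_count_bootstrap hC1 hH (by linarith) (by linarith) hQ
        (F := ratCount f' w' R' Q) (fun δ δ' θ h => ratCount_mono hw'0 R' Q h θ) (htriv' Q)
        (fun J hJ hJQ θ => ?_) hδ θ
      exact (hs2 A H hA0 hH0 hH.mono J Q hJ hJQ.le (fun J' hJ' hJJ δ hδ =>
        (ih J' (by omega) hJ' δ hδ 0).1) θ).trans (up _ _ (by linarith))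

theorem isGauge_ell {p : ℕ} {C : ℝ} (hC : 1 ≤ C) :
    IsGauge (p + 1) C fun Q => 16 * C ^ 2 * ell Q where
  two_le Q := by
    have := one_le_ell Q
    nlinarith
  mono i j hi hij := mul_le_mul_of_nonneg_left (ell_mono hi hij) (by positivity)
  ell_le Q := by
    have h1 := one_le_ell Q
    have h2 : (1 : ℝ) ≤ C ^ 3 := one_le_pow₀ hC
    have h3 : 4 * C * ell Q * 1 ≤ 4 * C * ell Q * (64 * C ^ 3 * ell Q) := by
      refine mul_le_mul_of_nonneg_left ?_ (by positivity)
      nlinarith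
    linarith
  contract J Q hJ hJQ := by
    have hl := one_le_ell Q
    have hJ0 : (0 : ℝ) < J := by exact_mod_cast hJ
    have hJQ' : (J : ℝ) ≤ Q := by
      refine le_trans (le_mul_of_one_le_right hJ0.le ?_) hJQ
      nlinarith
    have h1 : 4 * C * √(J : ℝ) ≤ √(Q : ℝ) := by
      refine Real.le_sqrt_of_sq_le ?_
      rw [mul_pow, Real.sq_sqrt hJ0.le]
      refine le_trans ?_ hJQ
      have : (J : ℝ) * (16 * C ^ 2) * 1 ≤ (J : ℝ) * (16 * C ^ 2) * ell Q :=
        mul_le_mul_of_nonneg_left hl (by positivity)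
      linarith
    have h2 : √(J : ℝ) ^ p ≤ √(Q : ℝ) ^ p := by gcongr
    have h3 := ell_mono hJ (by exact_mod_cast hJQ')
    have h4 := one_le_ell J
    calc _ = √(J : ℝ) ^ p * (4 * C * √(J : ℝ)) * (16 * C ^ 2 * ell J) := by ring
      _ ≤ √(Q : ℝ) ^ p * √(Q : ℝ) * (16 * C ^ 2 * ell Q) := by gcongr
      _ = _ := by ring

theorem isGauge_exp {C : ℝ} (hC : 1 ≤ C) :
    IsGauge 0 C fun Q => 2 * Real.exp (4 * C * √(ell Q)) where
  two_le Q := by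
    have : 1 ≤ Real.exp (4 * C * √(ell Q)) := Real.one_le_exp (by positivity)
    linarith
  mono i j hi hij := by
    have := Real.sqrt_le_sqrt (ell_mono hi hij)
    gcongr
  ell_le Q := by
    have h1 := one_le_ell Q
    have h2 : 4 * C * √(ell Q) ≤ Real.exp (4 * C * √(ell Q)) := by
      linarith [Real.add_one_le_exp (4 * C * √(ell Q))]
    have h3 := pow_le_pow_left₀ (by positivity) h2 2
    rw [mul_pow, Real.sq_sqrt (by linarith)] at h3
    have h4 : 4 * C * ell Q ≤ (4 * C) ^ 2 * ell Q := by
      refine mul_le_mul_of_nonneg_right ?_ (by linarith)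
      nlinarith
    have h5 : 0 ≤ Real.exp (4 * C * √(ell Q)) ^ 2 := by positivity
    linarith [mul_pow 2 (Real.exp (4 * C * √(ell Q))) 2]
  contract J Q hJ hJQ := by
    set c := 4 * C with hc
    set t := √(ell Q) with ht
    have hl := one_le_ell Q
    have hlJ := one_le_ell J
    have ht0 : 0 ≤ t := Real.sqrt_nonneg _
    have ht2 : t ^ 2 = ell Q := Real.sq_sqrt (by linarith)
    have hJ0 : (0 : ℝ) < J := by exact_mod_cast hJ
    have h1 : (J : ℝ) * Real.exp (c * t) ≤ Q := by
      have : 0 ≤ (J : ℝ) * Real.exp (c * t) := by positivity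
      linarith
    have h2 := Real.log_le_log (by positivity) h1
    rw [Real.log_mul hJ0.ne' (Real.exp_ne_zero _), Real.log_exp] at h2
    have h3 : ell J ≤ t ^ 2 - 2 * c * t := by
      rw [ht2, ell, ell]
      linarith
    have h4 : √(ell J) ≤ t - c := by
      have h5 : c ≤ t := by nlinarith
      rw [Real.sqrt_le_left (by linarith)]
      nlinarith [sq_nonneg c]
    have h6 : Real.exp (c * √(ell J)) ≤ Real.exp (c * t) * Real.exp (-(c * c)) := by
      rw [← Real.exp_add]
      refine Real.exp_le_exp.2 ?_
      nlinarith
    have h7 : c * Real.exp (-(c * c)) ≤ 1 := by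
      rw [Real.exp_neg, ← div_eq_mul_inv, div_le_one (Real.exp_pos _)]
      have := Real.add_one_le_exp (c * c)
      nlinarith
    simp only [pow_zero, one_mul]
    have h8 := mul_le_mul_of_nonneg_left h6 (by positivity : 0 ≤ c)
    have h9 := mul_le_mul_of_nonneg_left h7 (Real.exp_pos (c * t)).le
    linarith

end Bootstrap

section LegendreTransform

variable {m : ℕ} {D : Set (Fin m → ℝ)} {f : (Fin m → ℝ) → ℝ}

theorem exists_equiv_hasFDerivAt_gradv (hD : IsOpen D) (hf : ContDiffOn ℝ (m + 2 : ℕ) f D)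
    {x : Fin m → ℝ} (hx : x ∈ D) (hdet : (hess f x).det ≠ 0) :
    ∃ e : (Fin m → ℝ) ≃L[ℝ] (Fin m → ℝ), HasFDerivAt (gradv f) (e : (Fin m → ℝ) →L[ℝ] _) x := by
  have hg : ContDiffAt ℝ (m + 1 : ℕ) (gradv f) x :=
    (contDiffOn_gradv hD hf).contDiffAt (hD.mem_nhds hx)
  have hd : DifferentiableAt ℝ (gradv f) x := hg.differentiableAt (by simp)
  set T := fderiv ℝ (gradv f) x with hT
  have hTv : ∀ v, T v = Matrix.vecMul v (hess f x) := by
    intro v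
    ext j
    have h1 : T v j = fderiv ℝ (fun y => gradv f y j) x v := by
      have h2 := (hasFDerivAt_pi'.1 hd.hasFDerivAt) j
      rw [h2.fderiv]
      rfl
    rw [h1, fderiv_apply_eq_sum]
    rfl
  have hinj : Function.Injective T := by
    rw [injective_iff_map_eq_zero]
    intro v hv
    rw [hTv] at hv
    exact Matrix.eq_zero_of_vecMul_eq_zero hdet hv
  refine ⟨(LinearEquiv.ofInjectiveEndo (T : (Fin m → ℝ) →ₗ[ℝ] _) hinj).toContinuousLinearEquiv, ?_⟩
  refine hd.hasFDerivAt.congr_fderiv ?_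
  ext v : 1
  rfl

theorem exists_isLegendrePair (hD : IsOpen D) (hf : ContDiffOn ℝ (m + 2 : ℕ) f D)
    (hdet : ∀ x ∈ D, (hess f x).det ≠ 0) (hinj : Set.InjOn (gradv f) D) :
    ∃ D' f', IsLegendrePair D f D' f' := by
  set g := gradv f with hg
  set D' := g '' D with hD'
  set φ := Function.invFunOn g D with hφ
  have hgc : ∀ x ∈ D, ContDiffAt ℝ (m + 1 : ℕ) g x := fun x hx =>
    (contDiffOn_gradv hD hf).contDiffAt (hD.mem_nhds hx)
  have hm0 : ((m + 1 : ℕ) : WithTop ℕ∞) ≠ 0 := by simp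
  have hφg : ∀ x ∈ D, φ (g x) = x := fun x hx => hinj.leftInvOn_invFunOn hx
  have hφD : ∀ y ∈ D', φ y ∈ D := by
    rintro _ ⟨x, hx, rfl⟩
    rwa [hφg x hx]
  have hgφ : ∀ y ∈ D', g (φ y) = y := by
    rintro _ ⟨x, hx, rfl⟩
    rw [hφg x hx]
  have hopen : IsOpen D' := by
    rw [isOpen_iff_mem_nhds]
    rintro _ ⟨x, hx, rfl⟩
    obtain ⟨e, he⟩ := exists_equiv_hasFDerivAt_gradv hD hf hx (hdet x hx)
    have hs := (hgc x hx).hasStrictFDerivAt' he hm0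
    rw [← hs.map_nhds_eq_of_equiv]
    exact Filter.image_mem_map (hD.mem_nhds hx)
  have hφc : ∀ y ∈ D', ContDiffAt ℝ (m + 1 : ℕ) φ y := by
    rintro _ ⟨x, hx, rfl⟩
    obtain ⟨e, he⟩ := exists_equiv_hasFDerivAt_gradv hD hf hx (hdet x hx)
    have hs := (hgc x hx).hasStrictFDerivAt' he hm0
    refine ((hgc x hx).to_localInverse he hm0).congr_of_eventuallyEq ?_
    have h1 : ∀ᶠ y in nhds (g x), g (hs.localInverse g e x y) = y := hs.eventually_right_inverse
    have h2 : ∀ᶠ y in nhds (g x), hs.localInverse g e x y ∈ D :=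
      hs.localInverse_tendsto.eventually (hD.mem_nhds hx)
    filter_upwards [h1, h2] with y hy1 hy2
    change φ y = hs.localInverse g e x y
    conv_lhs => rw [← hy1]
    exact hφg _ hy2
  have hφd : ∀ y ∈ D', DifferentiableAt ℝ φ y := fun y hy => (hφc y hy).differentiableAt hm0
  set f' : (Fin m → ℝ) → ℝ := fun y => ∑ i, y i * φ y i - f (φ y) with hf'
  have hf'd : ∀ y ∈ D', HasFDerivAt f'
      (∑ i, φ y i • ContinuousLinearMap.proj (R := ℝ) (φ := fun _ : Fin m => ℝ) i) y := by
    intro y hy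
    have h1 := (hφd y hy).hasFDerivAt
    have h2 : HasFDerivAt f (fderiv ℝ f (φ y)) (φ y) :=
      ((hf.contDiffAt (hD.mem_nhds (hφD y hy))).differentiableAt (by simp)).hasFDerivAt
    have h3 : HasFDerivAt (fun y : Fin m → ℝ => ∑ i, y i * φ y i) _ y :=
      HasFDerivAt.fun_sum fun i _ =>
        (hasFDerivAt_apply (𝕜 := ℝ) i y).mul ((hasFDerivAt_pi'.1 h1) i)
    refine (h3.sub (h2.comp y h1)).congr_fderiv ?_
    ext v : 1
    have h4 : fderiv ℝ f (φ y) (fderiv ℝ φ y v) = ∑ i, fderiv ℝ φ y v i * y i := by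
      rw [fderiv_apply_eq_sum]
      refine Finset.sum_congr rfl fun i _ => ?_
      rw [← hg, hgφ y hy]
    simp [h4, Finset.sum_add_distrib, mul_comm]
  have hgrad : ∀ y ∈ D', gradv f' y = φ y := by
    intro y hy
    ext j
    rw [gradv, (hf'd y hy).fderiv]
    simp [Pi.single_apply]
  have hf'c : ContDiffOn ℝ (m + 2 : ℕ) f' D' := by
    have h1 : ((m + 2 : ℕ) : WithTop ℕ∞) = ((m + 1 : ℕ) : WithTop ℕ∞) + 1 := by norm_cast
    rw [h1, contDiffOn_succ_iff_fderiv_of_isOpen hopen]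
    refine ⟨fun y hy => (hf'd y hy).differentiableAt.differentiableWithinAt, by simp, ?_⟩
    refine ContDiffOn.congr (f := fun y => ∑ i, φ y i •
      ContinuousLinearMap.proj (R := ℝ) (φ := fun _ : Fin m => ℝ) i) ?_
      fun y hy => (hf'd y hy).fderiv
    refine ContDiffOn.sum fun i _ => ContDiffOn.fun_smul ?_ contDiffOn_const
    intro y hy
    exact (contDiffAt_pi.1 (hφc y hy) i).contDiffWithinAt
  refine ⟨D', f', hD, hopen, hf, hf'c, fun x hx => Set.mem_image_of_mem g hx, fun y hy => ?_,
    fun x hx => ?_, fun y hy => ?_, fun x hx => ?_⟩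
  · rw [hgrad y hy]
    exact hφD y hy
  · rw [hgrad _ (Set.mem_image_of_mem g hx)]
    exact hφg x hx
  · rw [hgrad y hy]
    exact hgφ y hy
  · change f x + (∑ i, g x i * φ (g x) i - f (φ (g x))) = ∑ i, x i * g x i
    rw [hφg x hx]
    simp [mul_comm]

end LegendreTransform

section PowerSums

theorem pow_succ_sub_pow_succ_le {x y : ℝ} (hy : 0 ≤ y) (hxy : y ≤ x) (k : ℕ) :
    x ^ (k + 1) - y ^ (k + 1) ≤ (k + 1) * x ^ k * (x - y) := by
  induction k with
  | zero => simp
  | succ k ih =>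
    have hx : 0 ≤ x := hy.trans hxy
    have h1 := mul_le_mul_of_nonneg_left ih hx
    have h2 : y ^ (k + 1) * (x - y) ≤ x ^ (k + 1) * (x - y) :=
      mul_le_mul_of_nonneg_right (pow_le_pow_left₀ hy hxy _) (by linarith)
    push_cast
    calc x ^ (k + 1 + 1) - y ^ (k + 1 + 1) =
        x * (x ^ (k + 1) - y ^ (k + 1)) + y ^ (k + 1) * (x - y) := by ring
      _ ≤ x * ((k + 1) * x ^ k * (x - y)) + x ^ (k + 1) * (x - y) := add_le_add h1 h2
      _ = _ := by ring

theorem le_pow_succ_sub_pow_succ {x y : ℝ} (hy : 0 ≤ y) (hxy : y ≤ x) (k : ℕ) :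
    (k + 1) * y ^ k * (x - y) ≤ x ^ (k + 1) - y ^ (k + 1) := by
  induction k with
  | zero => simp
  | succ k ih =>
    have h1 := mul_le_mul_of_nonneg_left ih hy
    have h2 : y ^ (k + 1) * (x - y) ≤ x ^ (k + 1) * (x - y) :=
      mul_le_mul_of_nonneg_right (pow_le_pow_left₀ hy hxy _) (by linarith)
    push_cast
    calc ((k : ℝ) + 1 + 1) * y ^ (k + 1) * (x - y) =
        y * ((k + 1) * y ^ k * (x - y)) + y ^ (k + 1) * (x - y) := by ring
      _ ≤ y * (x ^ (k + 1) - y ^ (k + 1)) + x ^ (k + 1) * (x - y) := add_le_add h1 h2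
      _ = _ := by ring

theorem pow_succ_le_mul_sum_pow (k N : ℕ) :
    (N : ℝ) ^ (k + 1) ≤ (k + 1) * ∑ q ∈ Finset.Icc 1 N, (q : ℝ) ^ k := by
  induction N with
  | zero => simp
  | succ N ih =>
    rw [Finset.sum_Icc_succ_top (by omega)]
    have := pow_succ_sub_pow_succ_le (x := ((N + 1 : ℕ) : ℝ)) (y := N) (by positivity)
      (by push_cast; linarith) k
    have e : ((N + 1 : ℕ) : ℝ) - N = 1 := by push_cast; ring
    rw [e] at this
    linarith

theorem mul_sum_pow_le (k N : ℕ) :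
    (k + 1) * ∑ q ∈ Finset.Icc 1 N, (q : ℝ) ^ k ≤
      (N : ℝ) ^ (k + 1) + (k + 1) * (N : ℝ) ^ k := by
  induction N with
  | zero => simp; positivity
  | succ N ih =>
    rw [Finset.sum_Icc_succ_top (by omega)]
    have := le_pow_succ_sub_pow_succ (x := ((N + 1 : ℕ) : ℝ)) (y := N) (by positivity)
      (by push_cast; linarith) k
    have e : ((N + 1 : ℕ) : ℝ) - N = 1 := by push_cast; ring
    rw [e] at this
    linarith

theorem abs_sum_pow_sub_le (k N : ℕ) :
    |∑ q ∈ Finset.Icc 1 N, (q : ℝ) ^ k - (N : ℝ) ^ (k + 1) / (k + 1)| ≤ (N : ℝ) ^ k := by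
  have hk : (0 : ℝ) < k + 1 := by positivity
  have h1 := pow_succ_le_mul_sum_pow k N
  have h2 := mul_sum_pow_le k N
  rw [abs_le]
  have e : (N : ℝ) ^ (k + 1) / (k + 1) * (k + 1) = (N : ℝ) ^ (k + 1) := by field_simp
  constructor
  · have : 0 ≤ (N : ℝ) ^ k := by positivity
    nlinarith
  · nlinarith

theorem abs_sum_floor_pow_sub_le (k : ℕ) {Q : ℝ} (hQ : 0 ≤ Q) :
    |∑ q ∈ Finset.Icc 1 ⌊Q⌋₊, (q : ℝ) ^ k - Q ^ (k + 1) / (k + 1)| ≤ 2 * Q ^ k := by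
  have h1 := abs_sum_pow_sub_le k ⌊Q⌋₊
  have h2 := Nat.floor_le hQ
  have h3 := Nat.lt_floor_add_one Q
  have hk : (0 : ℝ) < k + 1 := by positivity
  have h4 := pow_succ_sub_pow_succ_le (Nat.cast_nonneg _) h2 k
  have h5 : (k + 1) * Q ^ k * (Q - ⌊Q⌋₊) ≤ (k + 1) * Q ^ k * 1 :=
    mul_le_mul_of_nonneg_left (by linarith) (by positivity)
  have h6 : (⌊Q⌋₊ : ℝ) ^ k ≤ Q ^ k := by gcongr
  have h7 : (⌊Q⌋₊ : ℝ) ^ (k + 1) ≤ Q ^ (k + 1) := by gcongr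
  have h8 : |(⌊Q⌋₊ : ℝ) ^ (k + 1) / (k + 1) - Q ^ (k + 1) / (k + 1)| ≤ Q ^ k := by
    rw [← sub_div, abs_div, abs_of_pos hk, div_le_iff₀ hk, abs_sub_comm, abs_of_nonneg (by linarith)]
    linarith
  have := abs_sub_le (∑ q ∈ Finset.Icc 1 ⌊Q⌋₊, (q : ℝ) ^ k) ((⌊Q⌋₊ : ℝ) ^ (k + 1) / (k + 1))
    (Q ^ (k + 1) / (k + 1))
  linarith

end PowerSums

section CountingFunction

theorem NSw_eq_sum {m : ℕ} (f : (Fin m → ℝ) → ℝ) {w : (Fin m → ℝ) → ℝ} {R : ℕ}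
    (hR : ∀ x, (R : ℝ) < ‖x‖ → w x = 0) {Q : ℝ} (hQ : 0 ≤ Q) (δ : ℝ) :
    NSw f w Q δ = ∑ i ∈ ratBox m R ⌊Q⌋₊, if nint (ratVal f i) < δ then w (ratPt i) else 0 := by
  have hpt : ∀ (q : ℕ) (a : Fin m → ℤ), (fun i => (a i : ℝ) / (((q : ℕ) : ℤ) : ℝ)) =
      ratPt ⟨q, a⟩ := by
    intro q a
    ext i
    simp [ratPt, intVec, div_eq_inv_mul]
  have hin : ∀ q ∈ Finset.Icc 1 ⌊Q⌋₊, (∑ᶠ a : Fin m → ℤ,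
      if 1 ≤ (q : ℤ) ∧ (((q : ℕ) : ℤ) : ℝ) ≤ Q ∧
        nint ((((q : ℕ) : ℤ) : ℝ) * f (fun i => (a i : ℝ) / (((q : ℕ) : ℤ) : ℝ))) < δ
      then w (fun i => (a i : ℝ) / (((q : ℕ) : ℤ) : ℝ)) else 0) =
      ∑ a ∈ intBox m (R * q), if nint (ratVal f ⟨q, a⟩) < δ then w (ratPt ⟨q, a⟩) else 0 := by
    intro q hq
    rw [Finset.mem_Icc] at hq
    have hq0 : (0 : ℝ) < q := by exact_mod_cast hq.1
    have hqQ : (q : ℝ) ≤ Q := (Nat.le_floor_iff hQ).1 hq.2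
    rw [finsum_eq_sum_of_support_subset]
    · refine Finset.sum_congr rfl fun a _ => ?_
      have h1 : 1 ≤ (q : ℤ) := by exact_mod_cast hq.1
      simp only [hpt]
      simp only [h1, hqQ, ratVal, true_and, Int.cast_natCast]
      congr
    · intro a ha
      by_contra hn
      refine ha ?_
      simp only [hpt]
      have h1 := lt_norm_of_notMem_intBox hn
      have h2 : w (ratPt ⟨q, a⟩) = 0 := by
        refine hR _ ?_
        rw [ratPt, norm_smul, norm_inv, Real.norm_natCast, ← div_eq_inv_mul, lt_div_iff₀ hq0]
        push_cast at h1
        exact h1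
      rw [h2, ite_self]
  rw [NSw, finsum_eq_sum_of_support_subset (s := (Finset.Icc 1 ⌊Q⌋₊).map Nat.castEmbedding),
    Finset.sum_map, ratBox, Finset.sum_sigma]
  · exact Finset.sum_congr rfl hin
  · intro q hq
    by_contra hn
    refine hq ?_
    have : ¬ (1 ≤ q ∧ (q : ℝ) ≤ Q) := by
      rintro ⟨h1, h2⟩
      refine hn ?_
      lift q to ℕ using by omega
      rw [Finset.mem_coe, Finset.mem_map]
      refine ⟨q, Finset.mem_Icc.2 ⟨by exact_mod_cast h1, Nat.le_floor (by exact_mod_cast h2)⟩, rfl⟩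
    refine finsum_eq_zero_of_forall_eq_zero fun a => ?_
    rw [if_neg fun h => this ⟨h.1, h.2.1⟩]

/-- Every weight is dominated by a nonnegative weight on the same domain. -/
theorem IsWeight.exists_le {m : ℕ} {D : Set (Fin m → ℝ)} (hD : IsOpen D) {w : (Fin m → ℝ) → ℝ}
    (hw : IsWeight D w) : ∃ v, IsWeight D v ∧ (∀ x, 0 ≤ v x) ∧ ∀ x, |w x| ≤ v x := by
  obtain ⟨B, hB⟩ := hw.hasCompactSupport.exists_bound_of_continuous hw.contDiff.continuous
  have hB0 : 0 ≤ B := (norm_nonneg _).trans (hB 0)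
  obtain ⟨g, hg, hgc, hgD, hg1⟩ := exists_contDiff_extension (r := m + 1) hD
    hw.hasCompactSupport.isCompact hw.subset (f := fun _ => 1) contDiffOn_const
  have hsupp : Function.support (fun x => B * g x ^ 2) ⊆ Function.support g := fun x hx h =>
    hx (by simp [h])
  refine ⟨fun x => B * g x ^ 2, ⟨contDiff_const.mul (hg.pow 2),
    hgc.mono hsupp, (closure_mono hsupp).trans hgD⟩, fun x => by positivity, fun x => ?_⟩
  by_cases hx : x ∈ tsupport w
  · have h1 := (hg1 x hx).eq_of_nhds
    simp only [h1, one_pow, mul_one]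
    exact hB x
  · rw [image_eq_zero_of_notMem_tsupport hx, abs_zero]
    positivity

theorem abs_dualWeight_le {m : ℕ} {D' : Set (Fin m → ℝ)} {f' w v : (Fin m → ℝ) → ℝ}
    (h : ∀ x, |w x| ≤ v x) (y : Fin m → ℝ) : |dualWeight D' f' w y| ≤ dualWeight D' f' v y := by
  by_cases hy : y ∈ D'
  · simp only [dualWeight, Set.indicator_of_mem hy]
    exact h _
  · simp [dualWeight, Set.indicator_of_notMem hy]

theorem IsWeight.exists_radius {m : ℕ} {D : Set (Fin m → ℝ)} {w : (Fin m → ℝ) → ℝ}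
    (hw : IsWeight D w) : ∃ R : ℕ, ∀ x, (R : ℝ) < ‖x‖ → w x = 0 := by
  obtain ⟨r, hr⟩ := hw.hasCompactSupport.isCompact.isBounded.exists_norm_le
  obtain ⟨R, hR⟩ := exists_nat_ge r
  refine ⟨R, fun x hx => ?_⟩
  by_contra h
  have := hr x (subset_tsupport w h)
  linarith

theorem IsLegendrePair.exists_abs_sum_sub_le {p : ℕ} {D D' : Set (Fin (p + 2) → ℝ)}
    {f f' w : (Fin (p + 2) → ℝ) → ℝ} (h : IsLegendrePair D f D' f') (hw : IsWeight D w) :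
    ∃ R : ℕ, (∀ x, (R : ℝ) < ‖x‖ → w x = 0) ∧ ∃ C₀, 1 ≤ C₀ ∧ ∃ C, 0 ≤ C ∧
      ∀ H : ℕ → ℝ, IsGauge p C₀ H → ∀ Q : ℕ, 1 ≤ Q → ∀ δ > 0, δ < 1 / 2 →
      |∑ i ∈ ratBox (p + 2) R Q, (if nint (ratVal f i) < δ then w (ratPt i) else 0) -
        2 * δ * ∑ i ∈ ratBox (p + 2) R Q, w (ratPt i)| ≤
        C * ((Q : ℝ) ^ (p + 2) * (ell Q * (ell Q + H Q))) := by
  obtain ⟨v, hv, hv0, hwv⟩ := hw.exists_le h.isOpen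
  obtain ⟨R, hR⟩ := hv.exists_radius
  obtain ⟨R', hR'⟩ := (h.isWeight_dualWeight hv).exists_radius
  have hwR : ∀ x, (R : ℝ) < ‖x‖ → w x = 0 := fun x hx =>
    abs_nonpos_iff.1 ((hwv x).trans (hR x hx).le)
  have hdv := abs_dualWeight_le (D' := D') (f' := f') hwv
  have hwR' : ∀ y, (R' : ℝ) < ‖y‖ → dualWeight D' f' w y = 0 := fun y hy =>
    abs_nonpos_iff.1 ((hdv y).trans (hR' y hy).le)
  obtain ⟨C₀, hC₀, A, hA, hcnt⟩ := h.exists_ratCount_le_of_isGauge hv hv0 hR hR'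
  obtain ⟨C, hC, hU⟩ := h.exists_sum_norm_ratSum_le hw hwR hwR' hdv
  refine ⟨R, hwR, C₀, hC₀, 2 * C * (A + 1) + 8 * A, by positivity, fun H hH Q hQ δ hδ hδ' => ?_⟩
  have hH0 : ∀ n, 0 ≤ H n := fun n => by linarith [hH.two_le n]
  have hHQ := hH0 Q
  have hell := one_le_ell Q
  have hQ0 : (0 : ℝ) < Q := by exact_mod_cast hQ
  have hsQ : √(Q : ℝ) ^ 2 = Q := Real.sq_sqrt hQ0.le
  refine (abs_sum_nint_lt_sub_le (ratBox (p + 2) R Q) (fun i => w (ratPt i)) (ratVal f) hQ hδ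
    hδ').trans ?_
  set S := (Q : ℝ) ^ (p + 2) * (ell Q + H Q) with hS
  have hS0 : 0 ≤ S := by positivity
  have b1 : ∑ j ∈ Finset.Icc 1 Q, (j : ℝ)⁻¹ * ‖ratSum f w R Q j‖ ≤
      ell Q * (C * ((A + 1) * S)) := by
    refine (sum_inv_mul_le (E := C * ((A + 1) * S)) (by positivity) hQ
      fun n hn hnQ => ?_).trans ?_
    · refine (hU A H hA hH0 hH.mono n Q hn hnQ fun J hJ _ δ hδ =>
        (hcnt H hH J hJ δ hδ 0).2).trans ?_
      have hs : √(n : ℝ) ≤ √(Q : ℝ) := Real.sqrt_le_sqrt (by exact_mod_cast hnQ)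
      have c1 : √(Q : ℝ) ^ (p + 2) * √(n : ℝ) ^ (p + 2) ≤ (Q : ℝ) ^ (p + 2) := by
        calc _ ≤ √(Q : ℝ) ^ (p + 2) * √(Q : ℝ) ^ (p + 2) := by gcongr
          _ = (√(Q : ℝ) ^ 2) ^ (p + 2) := by ring
          _ = _ := by rw [hsQ]
      have c2 : Q * (√(Q : ℝ) ^ (p + 2) * √(n : ℝ) ^ p) ≤ (Q : ℝ) ^ (p + 2) := by
        calc _ ≤ Q * (√(Q : ℝ) ^ (p + 2) * √(Q : ℝ) ^ p) := by gcongr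
          _ = √(Q : ℝ) ^ 2 * (√(Q : ℝ) ^ (p + 2) * √(Q : ℝ) ^ p) := by rw [hsQ]
          _ = (√(Q : ℝ) ^ 2) ^ (p + 2) := by ring
          _ = _ := by rw [hsQ]
      have c3 := hH.mono n Q hn hnQ
      have c4 : (Q : ℝ) ^ (p + 2) ≤ S := by
        rw [hS]
        exact le_mul_of_one_le_right (by positivity) (by linarith)
      rw [mul_left_comm]
      refine mul_le_mul_of_nonneg_left (mul_le_mul_of_nonneg_left ?_ hC) (by positivity)
      calc _ ≤ A * (ell Q * (Q : ℝ) ^ (p + 2) + H Q * (Q : ℝ) ^ (p + 2)) + S := by gcongr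
        _ = _ := by
          rw [hS]
          ring
    · refine mul_le_mul_of_nonneg_right ?_ (by positivity)
      have := Real.log_natCast_nonneg Q
      rw [ell]
      linarith
  have b2 : ∀ θ, ∑ i ∈ ratBox (p + 2) R Q, v (ratPt i) * kern Q (ratVal f i - θ) ≤
      4 * A * (Q * S) := by
    intro θ
    refine (sum_mul_kern_ratVal_le hv0 hQ (X := A * (Q : ℝ) ^ (p + 3))
      (Y := A * ((Q : ℝ) ^ (p + 2) * H Q)) (by positivity) (by positivity) fun δ hδ =>
      ((hcnt H hH Q hQ δ hδ θ).1).trans (le_of_eq (by ring))).trans ?_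
    have : 0 ≤ A * (Q * ((Q : ℝ) ^ (p + 2) * ell Q)) := by positivity
    have e : (Q : ℝ) ^ (p + 3) = Q * (Q : ℝ) ^ (p + 2) := by ring
    rw [hS, e]
    linarith
  have b3 : ∑ i ∈ ratBox (p + 2) R Q, |w (ratPt i)| *
      (kern Q (ratVal f i + δ) + kern Q (ratVal f i - δ)) ≤ 8 * A * (Q * S) := by
    have h1 := b2 (-δ)
    have h2 := b2 δ
    simp only [sub_neg_eq_add] at h1
    calc _ ≤ ∑ i ∈ ratBox (p + 2) R Q, v (ratPt i) *
          (kern Q (ratVal f i + δ) + kern Q (ratVal f i - δ)) :=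
          Finset.sum_le_sum fun i _ => mul_le_mul_of_nonneg_right (hwv _)
            (add_nonneg (kern_nonneg _ _) (kern_nonneg _ _))
      _ = _ := by simp only [mul_add, Finset.sum_add_distrib]
      _ ≤ _ := add_le_add h1 h2
      _ = _ := by ring
  have b4 : (Q : ℝ)⁻¹ * ∑ i ∈ ratBox (p + 2) R Q, |w (ratPt i)| *
      (kern Q (ratVal f i + δ) + kern Q (ratVal f i - δ)) ≤ 8 * A * S := by
    rw [inv_mul_le_iff₀ hQ0]
    linarith
  have b5 : 8 * A * S ≤ 8 * A * (ell Q * S) := by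
    refine mul_le_mul_of_nonneg_left ?_ (by positivity)
    nlinarith
  calc _ ≤ 2 * (ell Q * (C * ((A + 1) * S))) + 8 * A * S := add_le_add
        (mul_le_mul_of_nonneg_left b1 zero_le_two) b4
    _ ≤ 2 * (ell Q * (C * ((A + 1) * S))) + 8 * A * (ell Q * S) := by linarith
    _ = _ := by
      rw [hS]
      ring

theorem IsLegendrePair.exists_abs_NSw_sub_le {p : ℕ} {D D' : Set (Fin (p + 2) → ℝ)}
    {f f' w : (Fin (p + 2) → ℝ) → ℝ} (h : IsLegendrePair D f D' f') (hw : IsWeight D w) :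
    ∃ C₀, 1 ≤ C₀ ∧ ∃ C, 0 < C ∧ ∀ H : ℕ → ℝ, IsGauge p C₀ H → ∀ Q δ : ℝ, 2 ≤ Q → 0 < δ →
      δ < 1 / 2 → |NSw f w Q δ - 2 * (∫ x, w x) / (p + 3 : ℕ) * δ * Q ^ (p + 3)| ≤
        C * (Q ^ (p + 2) * (ell ⌊Q⌋₊ * (ell ⌊Q⌋₊ + H ⌊Q⌋₊))) := by
  obtain ⟨R, hR, C₀, hC₀, C, hC, hmain⟩ := h.exists_abs_sum_sub_le hw
  obtain ⟨C₁, hC₁, hW⟩ := h.exists_norm_weylSum_zero_sub_le hw hR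
  set I := ∫ x, w x with hI
  refine ⟨C₀, hC₀, C + C₁ + 2 * |I| + 1, by positivity, fun H hH Q δ hQ hδ hδ' => ?_⟩
  set N := ⌊Q⌋₊ with hN
  have hN1 : 1 ≤ N := (Nat.one_le_floor_iff Q).2 (by linarith)
  have hNQ : (N : ℝ) ≤ Q := Nat.floor_le (by linarith)
  rw [NSw_eq_sum f hR (by linarith)]
  have h1 := hmain H hH N hN1 δ hδ hδ'
  set F := ∑ i ∈ ratBox (p + 2) R N, if nint (ratVal f i) < δ then w (ratPt i) else 0
  set M := ∑ i ∈ ratBox (p + 2) R N, w (ratPt i) with hM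
  have hell := one_le_ell N
  have hH2 := hH.two_le N
  have hT : 1 ≤ ell N * (ell N + H N) := by nlinarith
  set T := ell N * (ell N + H N)
  have hQp : Q ≤ Q ^ (p + 2) := le_self_pow₀ (by linarith) (by omega)
  have h2 : |M - (∑ q ∈ Finset.Icc 1 N, (q : ℝ) ^ (p + 2)) * I| ≤ C₁ * Q ^ (p + 2) := by
    have e1 : ((M - (∑ q ∈ Finset.Icc 1 N, (q : ℝ) ^ (p + 2)) * I : ℝ) : ℂ) =
        ∑ q ∈ Finset.Icc 1 N, (weylSum f w R 0 q - (q : ℂ) ^ (p + 2) * ∫ x, (w x : ℂ)) := by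
      rw [Finset.sum_sub_distrib, ← Finset.sum_mul, ← ratSum_eq, integral_complex_ofReal]
      simp [ratSum, expSum, turn_zero, hM, hI]
    rw [← Real.norm_eq_abs, ← Complex.norm_real, e1]
    refine (norm_sum_le _ _).trans ((Finset.sum_le_card_nsmul _ _ C₁ fun q hq =>
      hW q (Finset.mem_Icc.1 hq).1).trans ?_)
    rw [Nat.card_Icc, nsmul_eq_mul, add_tsub_cancel_right, mul_comm]
    exact mul_le_mul_of_nonneg_left (hNQ.trans hQp) hC₁
  have h3 := abs_sum_floor_pow_sub_le (p + 2) (by linarith : 0 ≤ Q)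
  rw [← hN] at h3
  set P := ∑ q ∈ Finset.Icc 1 N, (q : ℝ) ^ (p + 2)
  push_cast at h3 ⊢
  have e2 : F - 2 * I / (p + 3) * δ * Q ^ (p + 3) = (F - 2 * δ * M) + 2 * δ * (M - P * I) +
      2 * δ * I * (P - Q ^ (p + 2 + 1) / (p + 2 + 1)) := by
    rw [show (p : ℝ) + 2 + 1 = p + 3 by ring]
    ring
  rw [e2]
  have d1 : |2 * δ * (M - P * I)| ≤ C₁ * Q ^ (p + 2) := by
    rw [abs_mul, abs_of_pos (by positivity)]
    refine le_trans (mul_le_of_le_one_left (abs_nonneg _) (by linarith)) h2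
  have d2 : |2 * δ * I * (P - Q ^ (p + 2 + 1) / (p + 2 + 1))| ≤ |I| * (2 * Q ^ (p + 2)) := by
    rw [abs_mul, abs_mul, abs_of_pos (by positivity : 0 < 2 * δ)]
    refine mul_le_mul (mul_le_of_le_one_left (abs_nonneg _) (by linarith)) h3 (abs_nonneg _)
      (abs_nonneg _)
  have d3 : C * ((N : ℝ) ^ (p + 2) * T) ≤ C * (Q ^ (p + 2) * T) := by gcongr
  have d4 : (C₁ + 2 * |I|) * Q ^ (p + 2) ≤ (C₁ + 2 * |I|) * (Q ^ (p + 2) * T) := by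
    refine mul_le_mul_of_nonneg_left ?_ (by positivity)
    exact le_mul_of_one_le_right (by positivity) hT
  have d5 : 0 ≤ Q ^ (p + 2) * T := by positivity
  refine (abs_add_three _ _ _).trans ?_
  linarith

theorem ell_floor_le {Q : ℝ} (hQ : 2 ≤ Q) : ell ⌊Q⌋₊ ≤ 4 * Real.log Q := by
  have h1 : 1 ≤ ⌊Q⌋₊ := (Nat.one_le_floor_iff Q).2 (by linarith)
  have h2 := Real.log_le_log (by exact_mod_cast h1 : (0 : ℝ) < ⌊Q⌋₊)
    (Nat.floor_le (by linarith : 0 ≤ Q))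
  have h3 := Real.log_le_log two_pos hQ
  have h4 := Real.log_two_gt_d9
  rw [ell]
  linarith

theorem exists_abs_NSw_sub_le_of_three {D D' : Set (Fin 2 → ℝ)} {f f' w : (Fin 2 → ℝ) → ℝ}
    (h : IsLegendrePair D f D' f') (hw : IsWeight D w) :
    ∃ c > (0 : ℝ), ∃ C > (0 : ℝ), ∀ Q δ : ℝ, 2 ≤ Q → 0 < δ → δ < 1 / 2 →
      |NSw f w Q δ - 2 * (∫ x, w x) / (3 : ℕ) * δ * Q ^ 3| ≤
        C * (Q ^ 2 * Real.exp (c * √(Real.log Q))) := by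
  obtain ⟨C₀, hC₀, C, hC, hmain⟩ := IsLegendrePair.exists_abs_NSw_sub_le (p := 0) h hw
  refine ⟨2 * (2 + 4 * C₀), by positivity, 3 * C, by positivity, fun Q δ hQ hδ hδ' => ?_⟩
  refine (hmain _ (isGauge_exp hC₀) Q δ hQ hδ hδ').trans ?_
  have hell := one_le_ell ⌊Q⌋₊
  have hle := ell_floor_le hQ
  set s := √(ell ⌊Q⌋₊) with hs
  have hs0 : 0 ≤ s := Real.sqrt_nonneg _
  have hs2 : ell ⌊Q⌋₊ = s ^ 2 := (Real.sq_sqrt (by linarith)).symm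
  have h1 : s ≤ 2 * √(Real.log Q) := by
    rw [hs, Real.sqrt_le_left (by positivity), mul_pow, Real.sq_sqrt (by linarith)]
    linarith
  have h2 : ell ⌊Q⌋₊ ≤ Real.exp (2 * s) := by
    have h3 : s ≤ Real.exp s := by linarith [Real.add_one_le_exp s]
    rw [hs2, two_mul, Real.exp_add, ← sq]
    exact pow_le_pow_left₀ hs0 h3 2
  have h4 : Real.exp (2 * s) ≤ Real.exp (4 * C₀ * s) := Real.exp_le_exp.2 (by nlinarith)
  have h5 : ell ⌊Q⌋₊ * (ell ⌊Q⌋₊ + 2 * Real.exp (4 * C₀ * s)) ≤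
      3 * Real.exp (2 * (2 + 4 * C₀) * √(Real.log Q)) := by
    calc _ ≤ Real.exp (2 * s) * (Real.exp (4 * C₀ * s) + 2 * Real.exp (4 * C₀ * s)) := by
          gcongr
          exact h2.trans h4
      _ = 3 * Real.exp (2 * s + 4 * C₀ * s) := by
          rw [Real.exp_add]
          ring
      _ ≤ _ := by
          gcongr
          nlinarith
  calc _ ≤ C * (Q ^ 2 * (3 * Real.exp (2 * (2 + 4 * C₀) * √(Real.log Q)))) := by
        gcongr
    _ = _ := by ring

theorem exists_abs_NSw_sub_le_of_four_le {p : ℕ} {D D' : Set (Fin (p + 3) → ℝ)}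
    {f f' w : (Fin (p + 3) → ℝ) → ℝ} (h : IsLegendrePair D f D' f') (hw : IsWeight D w) :
    ∃ C > (0 : ℝ), ∀ Q δ : ℝ, 2 ≤ Q → 0 < δ → δ < 1 / 2 →
      |NSw f w Q δ - 2 * (∫ x, w x) / (p + 4 : ℕ) * δ * Q ^ (p + 4)| ≤
        C * (Q ^ (p + 3) * Real.log Q ^ (2 : ℝ)) := by
  obtain ⟨C₀, hC₀, C, hC, hmain⟩ := IsLegendrePair.exists_abs_NSw_sub_le (p := p + 1) h hw
  refine ⟨C * (16 * (1 + 16 * C₀ ^ 2)), by positivity, fun Q δ hQ hδ hδ' => ?_⟩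
  refine (hmain _ (isGauge_ell hC₀) Q δ hQ hδ hδ').trans ?_
  have hell := one_le_ell ⌊Q⌋₊
  have hle := ell_floor_le hQ
  rw [Real.rpow_two]
  calc _ = C * (1 + 16 * C₀ ^ 2) * Q ^ (p + 3) * ell ⌊Q⌋₊ ^ 2 := by ring
    _ ≤ C * (1 + 16 * C₀ ^ 2) * Q ^ (p + 3) * (4 * Real.log Q) ^ 2 := by gcongr
    _ = _ := by ring

end CountingFunction

theorem statement2 (n : ℕ) (hn : 3 ≤ n) (l : ℕ)
    (hl : l = max ((n - 1) / 2 + 5) (n + 1))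
    (D : Set (Fin (n - 1) → ℝ)) (hDopen : IsOpen D)
    (hDbdd : Bornology.IsBounded D) (hDconn : IsConnected D)
    (f : (Fin (n - 1) → ℝ) → ℝ) (hf : ContDiffOn ℝ (l : ℕ∞) f D)
    (c₁ c₂ : ℝ) (hc₁ : 0 < c₁)
    (hHess : ∀ x ∈ D, c₁ ≤ |(hess f x).det| ∧ |(hess f x).det| ≤ c₂)
    -- `∇f : D → ∇f(D)` is a diffeomorphism
    (hdiffeo : Set.InjOn (gradv f) D)
    (w : (Fin (n - 1) → ℝ) → ℝ) (hw : ContDiff ℝ (⊤ : ℕ∞) w)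
    (hwc : HasCompactSupport w) (hwD : tsupport w ⊆ D) :
    ∃ c > (0 : ℝ), ∃ κ > (0 : ℝ), ∃ C > (0 : ℝ), ∀ Q δ : ℝ, 2 ≤ Q → 0 < δ → δ < 1 / 2 →
      |NSw f w Q δ - 2 * (∫ x, w x) / n * δ * Q ^ n| ≤ C *
        (if n = 3 then Q ^ 2 * Real.exp (c * Real.sqrt (Real.log Q))
         else Q ^ (n - 1) * Real.log Q ^ κ) := by
  have hf' : ContDiffOn ℝ (n - 1 + 2 : ℕ) f D := by
    refine hf.of_le ?_
    have : n - 1 + 2 ≤ l := by omega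
    exact WithTop.coe_le_coe.2 (Nat.cast_le.2 this)
  have hdet : ∀ x ∈ D, (hess f x).det ≠ 0 := fun x hx h0 => by
    have := (hHess x hx).1
    rw [h0, abs_zero] at this
    linarith
  obtain ⟨D', f', hL⟩ := exists_isLegendrePair hDopen hf' hdet hdiffeo
  have hW : IsWeight D w := ⟨hw.of_le (WithTop.coe_le_coe.2 le_top), hwc, hwD⟩
  rcases Nat.lt_or_ge n 4 with h4 | h4
  · obtain rfl : n = 3 := by omega
    obtain ⟨c, hc, C, hC, hmain⟩ := exists_abs_NSw_sub_le_of_three hL hW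
    refine ⟨c, hc, 1, one_pos, C, hC, fun Q δ hQ hδ hδ' => ?_⟩
    rw [if_pos rfl]
    exact hmain Q δ hQ hδ hδ'
  · obtain ⟨p, rfl⟩ : ∃ p, n = p + 4 := ⟨n - 4, by omega⟩
    obtain ⟨C, hC, hmain⟩ := exists_abs_NSw_sub_le_of_four_le (p := p) hL hW
    refine ⟨1, one_pos, 2, two_pos, C, hC, fun Q δ hQ hδ hδ' => ?_⟩
    rw [if_neg (by omega)]
    exact hmain Q δ hQ hδ hδ'
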